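/- arXiv:1702.07574 — 3 statements merged into one kernel-verified Lean document; each statement's English description precedes it below -/
import Mathlib

section
/- Let I ⊆ S be a k-clean monomial ideal with cleaner monomial u (i.e., u ∉ I is a cleaner monomial with |supp(u)| ≤ k+1 such that both I : u and I + Su are k-clean). Then pd(S/I) = max{ pd(S/(I + Su)), pd(S/(I : u)) }, where pd denotes projective dimension over S. -/
open MvPolynomial

/-- A monomial ideal: an ideal generated by monomials. -/
def IsMonomialIdeal {K : Type*} [Field K] {σ : Type*}
    (I : Ideal (MvPolynomial σ K)) : Prop :=
  ∃ G : Set (σ →₀ ℕ), I = Ideal.span ((fun a : σ →₀ ℕ => (monomial a (1 : K))) '' G)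

/-- `u = x^a` is a cleaner monomial of `I`: `u` is a non-unit monomial not in `I`
with `min(I + Su) ⊆ min(I)`. -/
def IsCleaner {K : Type*} [Field K] {σ : Type*}
    (I : Ideal (MvPolynomial σ K)) (a : σ →₀ ℕ) : Prop :=
  a ≠ 0 ∧ (monomial a (1 : K)) ∉ I ∧
    (I + Ideal.span {(monomial a (1 : K))}).minimalPrimes ⊆ I.minimalPrimes

/-- `I` has no embedded prime ideals: every associated prime of `S/I` is a minimal prime of `I`. -/
def NoEmbeddedPrimes {K : Type*} [Field K] {σ : Type*}
    (I : Ideal (MvPolynomial σ K)) : Prop :=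
  ∀ P ∈ associatedPrimes (MvPolynomial σ K) (MvPolynomial σ K ⧸ I), P ∈ I.minimalPrimes

/-- `I` is `k`-clean: `I` is prime, or `I` has no embedded primes and there is a cleaner
monomial `u ∉ I` with `|supp u| ≤ k+1` such that `I : u` and `I + Su` are `k`-clean. -/
inductive KClean (K : Type*) [Field K] (σ : Type*) (k : ℕ) :
    Ideal (MvPolynomial σ K) → Prop
  | prime (I : Ideal (MvPolynomial σ K)) (h : I.IsPrime) : KClean K σ k I
  | step (I : Ideal (MvPolynomial σ K)) (a : σ →₀ ℕ)
      (hne : NoEmbeddedPrimes I) (hcl : IsCleaner I a)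
      (hsupp : a.support.card ≤ k + 1)
      (hcolon : KClean K σ k (Submodule.colon I (Ideal.span {(monomial a (1 : K))})))
      (hsum : KClean K σ k (I + Ideal.span {(monomial a (1 : K))})) : KClean K σ k I

/-- A submodule of `S/I` is multigraded iff it is generated by images of monomials. -/
def IsMultigradedSubmodule {K : Type*} [Field K] {σ : Type*}
    (I : Ideal (MvPolynomial σ K)) (N : Submodule (MvPolynomial σ K) (MvPolynomial σ K ⧸ I)) :
    Prop :=
  ∃ A : Set (σ →₀ ℕ),
    N = Submodule.span (MvPolynomial σ K)
      ((fun a : σ →₀ ℕ => Ideal.Quotient.mk I (monomial a (1 : K))) '' A)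

/-- `I` is clean: `S/I` admits a multigraded prime filtration
`0 = M₀ ⊂ M₁ ⊂ ⋯ ⊂ M_r = S/I` whose factors `M_i/M_{i-1}` are isomorphic to `S/P_i`
(with a multidegree shift) for minimal primes `P_i` of `I`. -/
def IsClean {K : Type*} [Field K] {σ : Type*} (I : Ideal (MvPolynomial σ K)) : Prop :=
  ∃ (r : ℕ) (M : Fin (r + 1) → Submodule (MvPolynomial σ K) (MvPolynomial σ K ⧸ I)),
    M 0 = ⊥ ∧ M (Fin.last r) = ⊤ ∧ StrictMono M ∧
    (∀ i, IsMultigradedSubmodule I (M i)) ∧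
    (∀ i : Fin r, ∃ P ∈ I.minimalPrimes,
      Nonempty ((↥(M i.succ) ⧸ (Submodule.comap (M i.succ).subtype (M i.castSucc)))
        ≃ₗ[MvPolynomial σ K] (MvPolynomial σ K ⧸ P)))

/-- A finite graded free resolution of `S/I` over `S = K[x₁,…,xₙ]`:
`⋯ → F₁ → F₀ → S/I → 0`, where `Fᵢ` is free with basis elements of (twisted) degrees
`dg i j`, the differentials are given by matrices of homogeneous entries respecting the
degrees, the augmentation sends the `j`-th basis vector of `F₀` to the class of the
homogeneous polynomial `gen j`, and only finitely many `Fᵢ` are nonzero. -/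
structure GradedFreeResolution (K : Type*) [Field K] (n : ℕ)
    (I : Ideal (MvPolynomial (Fin n) K)) where
  rank : ℕ → ℕ
  dg : (i : ℕ) → Fin (rank i) → ℕ
  mat : (i : ℕ) → Matrix (Fin (rank i)) (Fin (rank (i + 1))) (MvPolynomial (Fin n) K)
  gen : Fin (rank 0) → MvPolynomial (Fin n) K
  finite : ∃ N : ℕ, ∀ i : ℕ, N < i → rank i = 0
  gen_hom : ∀ j, (gen j).IsHomogeneous (dg 0 j)
  mat_hom : ∀ i k l, mat i k l = 0 ∨
    ∃ c : ℕ, (mat i k l).IsHomogeneous c ∧ dg (i + 1) l = dg i k + c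
  aug_surj : Function.Surjective
    (fun v : Fin (rank 0) → MvPolynomial (Fin n) K =>
      Ideal.Quotient.mk I (∑ j, v j * gen j))
  exact_zero : Function.Exact (fun w => (mat 0).mulVec w)
    (fun v : Fin (rank 0) → MvPolynomial (Fin n) K =>
      Ideal.Quotient.mk I (∑ j, v j * gen j))
  exact_succ : ∀ i : ℕ, Function.Exact
    (fun w => (mat (i + 1)).mulVec w) (fun w => (mat i).mulVec w)

/-- The projective dimension of `S/I`, as the minimal length of a (graded) free
resolution of `S/I`. -/
noncomputable def pdQuot {K : Type*} [Field K] {n : ℕ}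
    (I : Ideal (MvPolynomial (Fin n) K)) : ℕ :=
  sInf {r : ℕ | ∃ F : GradedFreeResolution K n I, ∀ i : ℕ, r < i → F.rank i = 0}

/-- The Castelnuovo–Mumford regularity of `S/I`: the least `m` such that `S/I` has a
graded free resolution with all twists in homological degree `i` at most `m + i`. -/
noncomputable def regQuot {K : Type*} [Field K] {n : ℕ}
    (I : Ideal (MvPolynomial (Fin n) K)) : ℕ :=
  sInf {m : ℕ | ∃ F : GradedFreeResolution K n I,
    ∀ (i : ℕ) (j : Fin (F.rank i)), F.dg i j ≤ m + i}


namespace PdClean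

open MvPolynomial CategoryTheory CategoryTheory.Abelian

universe u

/-- The monomial prime generated by the variables indexed by `T`. -/
noncomputable def PT (K : Type u) [Field K] {n : ℕ} (T : Finset (Fin n)) : Ideal (MvPolynomial (Fin n) K) :=
  Ideal.span (X '' (T : Set (Fin n)))

section lower

variable {K : Type u} [Field K] {n : ℕ}

lemma X_mul_mem_span {s : Set (Fin n)} {i : Fin n} (hi : i ∉ s) {f : MvPolynomial (Fin n) K}
    (h : X i * f ∈ Ideal.span (X '' s : Set (MvPolynomial (Fin n) K))) :
    f ∈ Ideal.span (X '' s : Set (MvPolynomial (Fin n) K)) := by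
  rw [mem_ideal_span_X_image] at h ⊢
  intro m hm
  obtain ⟨j, hj, hj'⟩ := h (m + Finsupp.single i 1) (by
    rw [mem_support_iff, add_comm, coeff_X_mul]
    exact mem_support_iff.1 hm)
  refine ⟨j, hj, ?_⟩
  have : j ≠ i := fun e => hi (e ▸ hj)
  simpa [Finsupp.single_apply, this.symm] using hj'

lemma mem_smul_top_pi {R : Type u} [CommRing R] {m : ℕ} (J : Ideal R) (f : Fin m → R) :
    f ∈ (J • ⊤ : Submodule R (Fin m → R)) ↔ ∀ j, f j ∈ J := by
  constructor
  · intro h j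
    refine Submodule.smul_induction_on h ?_ ?_
    · intro r hr x _
      simpa using J.mul_mem_right (x j) hr
    · intro x y hx hy
      simpa using J.add_mem hx hy
  · intro h
    have : f = ∑ j, f j • Pi.single j (1 : R) := by
      ext k
      simp [Finset.sum_apply, Pi.single_apply]
    rw [this]
    exact Submodule.sum_mem _ fun j _ => Submodule.smul_mem_smul (h j) trivial

lemma PT_ne_top (T : Finset (Fin n)) : (1 : MvPolynomial (Fin n) K) ∉ PT K T := by
  intro h
  unfold PT at h
  rw [mem_ideal_span_X_image] at h
  obtain ⟨i, _, hi⟩ := h 0 (by simp)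
  simp at hi

lemma isRegular_free (T : Finset (Fin n)) (m : ℕ) (hm : 0 < m) :
    RingTheory.Sequence.IsRegular (Fin m → MvPolynomial (Fin n) K)
      (T.toList.map (X : Fin n → MvPolynomial (Fin n) K)) := by
  have key : ∀ l : List (Fin n), Ideal.ofList (l.map (X : Fin n → MvPolynomial (Fin n) K)) =
      Ideal.span (X '' {i | i ∈ l}) := by
    intro l
    unfold Ideal.ofList
    congr 1
    ext; simp
  refine ⟨⟨?_⟩, ?_⟩
  · intro i hi
    rw [isSMulRegular_quotient_iff_mem_of_smul_mem]
    intro f hf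
    rw [← List.map_take, key, mem_smul_top_pi] at hf ⊢
    intro j
    refine X_mul_mem_span (i := T.toList[i]'(by simpa using hi)) ?_ (by simpa using hf j)
    have := T.nodup_toList
    intro hmem
    simp only [Set.mem_ofPred_eq] at hmem
    rw [List.mem_take_iff_getElem] at hmem
    obtain ⟨k, hk, hk'⟩ := hmem
    have := (this.getElem_inj_iff).1 hk'
    omega
  · intro h
    have : (fun _ => 1 : Fin m → MvPolynomial (Fin n) K) ∈
      (Ideal.ofList (T.toList.map (X : Fin n → MvPolynomial (Fin n) K)) • ⊤ : Submodule (MvPolynomial (Fin n) K) (Fin m → MvPolynomial (Fin n) K)) := by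
      rw [← h]; trivial
    rw [key, mem_smul_top_pi] at this
    have := this ⟨0, hm⟩
    apply PT_ne_top (K := K) T
    simpa [PT] using this

lemma ext_zero {R : Type u} [CommRing R] (N M : ModuleCat.{u} R) [Subsingleton M] (i : ℕ) :
    Subsingleton (Ext N M i) := by
  have hz : Limits.IsZero M := ModuleCat.isZero_of_subsingleton M
  refine ⟨fun x y => ?_⟩
  have : ∀ x : Ext N M i, x = 0 := by
    intro x
    rw [← Ext.comp_mk₀_id x, hz.eq_of_src (𝟙 M) 0]
    simp
  rw [this x, this y]

lemma ext_free (T : Finset (Fin n)) (m : ℕ) (i : ℕ) (hi : i < T.card) :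
    Subsingleton (Ext (ModuleCat.of (MvPolynomial (Fin n) K) (MvPolynomial (Fin n) K ⧸ PT K T))
      (ModuleCat.of (MvPolynomial (Fin n) K) (Fin m → MvPolynomial (Fin n) K)) i) := by
  rcases Nat.eq_zero_or_pos m with rfl | hm
  · exact ext_zero _ _ _
  refine ModuleCat.subsingleton_ext_of_exists_isRegular (PT K T) _ ?_ _ ?_
    (T.toList.map (X : Fin n → MvPolynomial (Fin n) K)) ?_ (isRegular_free T m hm) i (by simpa using hi)
  · rw [Module.support_eq_zeroLocus, Ideal.annihilator_quotient]
  · rw [lt_top_iff_ne_top]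
    intro h
    have : (fun _ => 1 : Fin m → MvPolynomial (Fin n) K) ∈
      (PT K T • ⊤ : Submodule (MvPolynomial (Fin n) K) (Fin m → MvPolynomial (Fin n) K)) := by
      rw [h]; trivial
    rw [mem_smul_top_pi] at this
    exact PT_ne_top T (this ⟨0, hm⟩)
  · intro r hr
    simp only [List.mem_map, Finset.mem_toList] at hr
    obtain ⟨j, hj, rfl⟩ := hr
    exact Ideal.subset_span ⟨j, hj, rfl⟩

lemma ext_step {R : Type u} [CommRing R] (N : ModuleCat.{u} R) {A B C : Type u} [AddCommGroup A]
    [AddCommGroup B] [AddCommGroup C] [Module R A] [Module R B] [Module R C]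
    (f : A →ₗ[R] B) (g : B →ₗ[R] C) (hf : Function.Injective f) (hfg : Function.Exact f g)
    (hg : Function.Surjective g) (i : ℕ)
    (hB : Subsingleton (Ext N (ModuleCat.of R B) i))
    (hA : Subsingleton (Ext N (ModuleCat.of R A) (i + 1))) :
    Subsingleton (Ext N (ModuleCat.of R C) i) := by
  let S : ShortComplex (ModuleCat.{u} R) :=
    ShortComplex.mk (ModuleCat.ofHom f) (ModuleCat.ofHom g) (by
      ext x; simpa using hfg.apply_apply_eq_zero x)
  have hS : S.ShortExact :=
    { exact := ModuleCat.shortComplex_exact _ hfg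
      mono_f := by simpa [S, ModuleCat.mono_iff_injective] using hf
      epi_g := by simpa [S, ModuleCat.epi_iff_surjective] using hg }
  have zero1 := AddCommGrpCat.isZero_of_iff_subsingleton.mpr hB
  have zero2 := AddCommGrpCat.isZero_of_iff_subsingleton.mpr hA
  exact AddCommGrpCat.subsingleton_of_isZero <| ShortComplex.Exact.isZero_of_both_zeros
        ((Ext.covariant_sequence_exact₃' N hS) i (i + 1) rfl)
        (zero1.eq_zero_of_src _) (zero2.eq_zero_of_tgt _)

theorem lower_bound {I : Ideal (MvPolynomial (Fin n) K)} (F : GradedFreeResolution K n I)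
    (r : ℕ) (hr : ∀ i : ℕ, r < i → F.rank i = 0) (T : Finset (Fin n))
    (hT : PT K T ∈ associatedPrimes (MvPolynomial (Fin n) K) (MvPolynomial (Fin n) K ⧸ I)) :
    T.card ≤ r := by
  by_contra hlt
  push Not at hlt
  have claim : ∀ k j i : ℕ, r ≤ j + k → i ≤ j + 1 →
      Subsingleton (Ext (ModuleCat.of (MvPolynomial (Fin n) K) (MvPolynomial (Fin n) K ⧸ PT K T))
        (ModuleCat.of (MvPolynomial (Fin n) K) (LinearMap.range (F.mat j).mulVecLin)) i) := by
    intro k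
    induction k with
    | zero =>
      intro j i hj hi
      have : IsEmpty (Fin (F.rank (j + 1))) := by
        rw [hr (j + 1) (by omega)]; infer_instance
      have : Subsingleton (LinearMap.range (F.mat j).mulVecLin) := by
        refine ⟨?_⟩
        rintro ⟨_, x, rfl⟩ ⟨_, y, rfl⟩
        rw [Subsingleton.elim x y]
      exact ext_zero _ _ _
    | succ k ih =>
      intro j i hj hi
      rcases le_or_gt r j with h | h
      · exact (by
          have : IsEmpty (Fin (F.rank (j + 1))) := by
            rw [hr (j + 1) (by omega)]; infer_instance
          have : Subsingleton (LinearMap.range (F.mat j).mulVecLin) := by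
            refine ⟨?_⟩
            rintro ⟨_, x, rfl⟩ ⟨_, y, rfl⟩
            rw [Subsingleton.elim x y]
          exact ext_zero _ _ _)
      refine ext_step _ (LinearMap.range (F.mat (j + 1)).mulVecLin).subtype
        (F.mat j).mulVecLin.rangeRestrict (Submodule.injective_subtype _) ?_
        (LinearMap.surjective_rangeRestrict _) i (ext_free T _ i (by omega))
        (ih (j + 1) (i + 1) (by omega) (by omega))
      intro y
      have := F.exact_succ j y
      simp only [Submodule.coe_subtype, Subtype.range_coe_subtype]
      rw [← Subtype.coe_inj]
      simp only [LinearMap.codRestrict_apply, Matrix.mulVecLin_apply]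
      exact this
  have h0 : Subsingleton (Ext (ModuleCat.of (MvPolynomial (Fin n) K) (MvPolynomial (Fin n) K ⧸ PT K T))
        (ModuleCat.of (MvPolynomial (Fin n) K) (MvPolynomial (Fin n) K ⧸ I)) 0) := by
    let g : (Fin (F.rank 0) → MvPolynomial (Fin n) K) →ₗ[MvPolynomial (Fin n) K]
        (MvPolynomial (Fin n) K ⧸ I) := (Submodule.mkQ I).comp (Fintype.linearCombination _ F.gen)
    have hg : ∀ v, g v = Ideal.Quotient.mk I (∑ j, v j * F.gen j) := fun v => rfl
    refine ext_step _ (LinearMap.range (F.mat 0).mulVecLin).subtype g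
      (Submodule.injective_subtype _) ?_ ?_ 0 (ext_free T _ 0 (by omega))
      (claim r 0 1 (by omega) (by omega))
    · intro y
      have := F.exact_zero y
      simp only [Submodule.coe_subtype, Subtype.range_coe_subtype]
      rw [hg]
      exact this
    · exact F.aug_surj
  have : Subsingleton (ModuleCat.of (MvPolynomial (Fin n) K) (MvPolynomial (Fin n) K ⧸ PT K T) ⟶ (ModuleCat.of (MvPolynomial (Fin n) K) (MvPolynomial (Fin n) K ⧸ I))) :=
    Ext.addEquiv₀.subsingleton_congr.mp h0
  have : Subsingleton ((MvPolynomial (Fin n) K ⧸ PT K T) →ₗ[MvPolynomial (Fin n) K]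
      (MvPolynomial (Fin n) K ⧸ I)) :=
    ⟨fun f g => congrArg ModuleCat.Hom.hom
      (Subsingleton.elim (ModuleCat.ofHom f) (ModuleCat.ofHom g))⟩
  rw [AssociatedPrimes.mem_iff, isAssociatedPrime_iff] at hT
  obtain ⟨_, x, hx⟩ := hT
  have hker : ∀ y ∈ PT K T, y • x = 0 := by
    intro y hy
    rw [hx, Submodule.mem_colon_singleton] at hy
    simpa using hy
  let φ : (MvPolynomial (Fin n) K ⧸ PT K T) →ₗ[MvPolynomial (Fin n) K]
      (MvPolynomial (Fin n) K ⧸ I) :=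
    Submodule.liftQ (PT K T) (LinearMap.toSpanSingleton _ _ x) (by
      intro y hy
      simpa using hker y hy)
  have hφ : φ (Submodule.Quotient.mk 1) = x := by
    change (1 : MvPolynomial (Fin n) K) • x = x
    rw [one_smul]
  have : φ = 0 := Subsingleton.elim _ _
  rw [this] at hφ
  apply PT_ne_top (K := K) T
  rw [hx, Submodule.mem_colon_singleton, ← hφ]
  simp

end lower

section hom

open Function

variable {K : Type u} [Field K] {n : ℕ}

/-- Homogeneous elements of degree `e` in the free module with generators in degrees `d`. -/
def FD {m : ℕ} (d : Fin m → ℕ) (e : ℕ) : AddSubgroup (Fin m → MvPolynomial (Fin n) K) where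
  carrier := {v | ∀ j, v j = 0 ∨ ∃ c : ℕ, (v j).IsHomogeneous c ∧ e = d j + c}
  zero_mem' := fun j => Or.inl rfl
  add_mem' := by
    intro v w hv hw j
    rcases hv j with h | ⟨c, hc, hce⟩
    · simpa [h] using hw j
    · rcases hw j with h | ⟨c', hc', hce'⟩
      · right; exact ⟨c, by simpa [h] using hc, hce⟩
      · right
        obtain rfl : c = c' := by omega
        exact ⟨c, hc.add hc', hce⟩
  neg_mem' := by
    intro v hv j
    rcases hv j with h | ⟨c, hc, hce⟩
    · left; simpa using h
    · right; exact ⟨c, hc.neg, hce⟩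

lemma mem_FD {m : ℕ} {d : Fin m → ℕ} {e : ℕ} {v : Fin m → MvPolynomial (Fin n) K} :
    v ∈ FD d e ↔ ∀ j, v j = 0 ∨ ∃ c : ℕ, (v j).IsHomogeneous c ∧ e = d j + c := Iff.rfl

/-- The grading is compatible with multiplication by homogeneous polynomials. -/
def IsGr {M : Type u} [AddCommGroup M] [Module (MvPolynomial (Fin n) K) M]
    (G : ℕ → AddSubgroup M) : Prop :=
  ∀ (c e : ℕ) (p : MvPolynomial (Fin n) K) (x : M), p.IsHomogeneous c → x ∈ G e → p • x ∈ G (e + c)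

/-- The induced grading on a submodule of a graded free module. -/
noncomputable def subG {m : ℕ} (d : Fin m → ℕ)
    (N : Submodule (MvPolynomial (Fin n) K) (Fin m → MvPolynomial (Fin n) K)) (e : ℕ) :
    AddSubgroup N := (FD d e).comap N.subtype.toAddMonoidHom

lemma mem_subG {m : ℕ} {d : Fin m → ℕ}
    {N : Submodule (MvPolynomial (Fin n) K) (Fin m → MvPolynomial (Fin n) K)} {e : ℕ} {v : N} :
    v ∈ subG d N e ↔ v.1 ∈ FD d e := Iff.rfl

lemma isGr_subG {m : ℕ} (d : Fin m → ℕ)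
    (N : Submodule (MvPolynomial (Fin n) K) (Fin m → MvPolynomial (Fin n) K)) :
    IsGr (K := K) (n := n) (subG d N) := by
  intro c e p x hp hx j
  rcases hx j with h | ⟨c', hc', hce'⟩
  · left
    change p * (x.1 j) = 0
    have h : x.1 j = 0 := h
    rw [h, mul_zero]
  · right
    exact ⟨c + c', hp.mul hc', by omega⟩

/-- `M` has a graded free resolution with at most `r` nonzero terms. -/
def GR {K : Type u} [Field K] {n : ℕ} : ℕ → ∀ (M : Type u) [AddCommGroup M] [Module (MvPolynomial (Fin n) K) M],
    (ℕ → AddSubgroup M) → Prop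
  | 0, M, _, _, _ => Subsingleton M
  | r + 1, M, _, _, G => ∃ (m : ℕ) (d : Fin m → ℕ)
      (φ : (Fin m → MvPolynomial (Fin n) K) →ₗ[MvPolynomial (Fin n) K] M),
      Surjective φ ∧ (∀ j, φ (Pi.single j 1) ∈ G (d j)) ∧
      (∀ e, ∀ x ∈ G e, ∃ v ∈ FD d e, φ v = x) ∧
      GR (K := K) (n := n) r (LinearMap.ker φ) (subG d (LinearMap.ker φ))

lemma GR_mono : ∀ (r : ℕ) (M : Type u) [AddCommGroup M] [Module (MvPolynomial (Fin n) K) M]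
    (G : ℕ → AddSubgroup M), GR (K := K) (n := n) r M G → GR (K := K) (n := n) (r + 1) M G := by
  intro r
  induction r with
  | zero =>
    intro M _ _ G h
    have h : Subsingleton M := h
    refine ⟨0, fun _ => 0, 0, fun x => ⟨0, Subsingleton.elim _ _⟩, fun j => j.elim0,
      fun e x _ => ⟨0, (FD _ e).zero_mem, Subsingleton.elim _ _⟩, ?_⟩
    change Subsingleton _
    infer_instance
  | succ r ih =>
    rintro M _ _ G ⟨m, d, φ, h1, h2, h3, h4⟩
    exact ⟨m, d, φ, h1, h2, h3, ih _ _ h4⟩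

lemma GR_mono' {r s : ℕ} (hrs : r ≤ s) (M : Type u) [AddCommGroup M]
    [Module (MvPolynomial (Fin n) K) M]
    (G : ℕ → AddSubgroup M) (h : GR (K := K) (n := n) r M G) : GR (K := K) (n := n) s M G := by
  induction hrs with
  | refl => exact h
  | step _ ih => exact GR_mono _ _ _ ih

lemma GR_shift (c : ℕ) : ∀ (r : ℕ) (M : Type u) [AddCommGroup M]
    [Module (MvPolynomial (Fin n) K) M]
    (G G' : ℕ → AddSubgroup M), (∀ e x, x ∈ G' (e + c) ↔ x ∈ G e) →
    (∀ e x, e < c → x ∈ G' e → x = 0) → GR (K := K) (n := n) r M G → GR (K := K) (n := n) r M G' := by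
  intro r
  induction r with
  | zero => intro M _ _ G G' _ _ h; exact h
  | succ r ih =>
    rintro M _ _ G G' hG hG' ⟨m, d, φ, h1, h2, h3, h4⟩
    have key : ∀ e (v : Fin m → MvPolynomial (Fin n) K),
        v ∈ FD (fun j => d j + c) (e + c) ↔ v ∈ FD d e := by
      intro e v
      refine forall_congr' fun j => or_congr Iff.rfl (exists_congr fun c' => and_congr Iff.rfl ?_)
      change e + c = d j + c + c' ↔ e = d j + c'
      omega
    have key' : ∀ e (v : Fin m → MvPolynomial (Fin n) K), e < c →
        v ∈ FD (fun j => d j + c) e → v = 0 := by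
      intro e v he hv
      ext1 j
      rcases hv j with h | ⟨c', _, h⟩
      · exact h
      · have h : e = d j + c + c' := h
        omega
    refine ⟨m, fun j => d j + c, φ, h1, fun j => (hG _ _).2 (h2 j), ?_, ?_⟩
    · intro e x hx
      rcases lt_or_ge e c with he | he
      · exact ⟨0, (FD _ e).zero_mem, by rw [hG' e x he hx, map_zero]⟩
      · obtain ⟨e', rfl⟩ := Nat.exists_eq_add_of_le' he
        obtain ⟨v, hv, hvx⟩ := h3 e' x ((hG _ _).1 hx)
        exact ⟨v, (key _ _).2 hv, hvx⟩
    · refine ih _ (subG d _) (subG (fun j => d j + c) _) (fun e x => key e x.1) (fun e x he hx => ?_) h4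
      exact Subtype.ext (key' e x.1 he hx)

lemma phi_mem {M : Type u} [AddCommGroup M] [Module (MvPolynomial (Fin n) K) M]
    {G : ℕ → AddSubgroup M} (hG : IsGr (K := K) (n := n) G) {m : ℕ} {d : Fin m → ℕ}
    {φ : (Fin m → MvPolynomial (Fin n) K) →ₗ[MvPolynomial (Fin n) K] M}
    (h : ∀ j, φ (Pi.single j 1) ∈ G (d j)) {e : ℕ} {v : Fin m → MvPolynomial (Fin n) K}
    (hv : v ∈ FD d e) : φ v ∈ G e := by
  have : v = ∑ j, v j • Pi.single j (1 : MvPolynomial (Fin n) K) := by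
    ext1 k
    simp [Finset.sum_apply, Pi.single_apply]
  rw [this, map_sum]
  refine AddSubgroup.sum_mem _ fun j _ => ?_
  rw [map_smul]
  rcases hv j with h0 | ⟨c, hc, hce⟩
  · rw [h0, zero_smul]; exact (G e).zero_mem
  · rw [hce]; exact hG c _ _ _ hc (h j)

/-- Graded short exact sequences. -/
structure SES {A B C : Type u} [AddCommGroup A] [AddCommGroup B] [AddCommGroup C]
    [Module (MvPolynomial (Fin n) K) A] [Module (MvPolynomial (Fin n) K) B]
    [Module (MvPolynomial (Fin n) K) C]
    (GA : ℕ → AddSubgroup A) (GB : ℕ → AddSubgroup B) (GC : ℕ → AddSubgroup C)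
    (i : A →ₗ[MvPolynomial (Fin n) K] B) (p : B →ₗ[MvPolynomial (Fin n) K] C) : Prop where
  gr : IsGr (K := K) (n := n) GB
  inj : Injective i
  exact : ∀ b, p b = 0 → ∃ a, i a = b
  comp : ∀ a, p (i a) = 0
  surj : Surjective p
  mem_i : ∀ e a, i a ∈ GB e ↔ a ∈ GA e
  mem_p : ∀ e b, b ∈ GB e → p b ∈ GC e
  surj_p : ∀ e c, c ∈ GC e → ∃ b ∈ GB e, p b = c

lemma mem_FD_append {m m' : ℕ} {d : Fin m → ℕ} {d' : Fin m' → ℕ} {e : ℕ}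
    {v : Fin m → MvPolynomial (Fin n) K} {w : Fin m' → MvPolynomial (Fin n) K} :
    Fin.append v w ∈ FD (Fin.append d d') e ↔ v ∈ FD d e ∧ w ∈ FD d' e := by
  simp only [mem_FD]
  constructor
  · intro h
    exact ⟨fun j => by simpa using h (Fin.castAdd _ j), fun j => by simpa using h (Fin.natAdd _ j)⟩
  · rintro ⟨h1, h2⟩ j
    refine Fin.addCases (fun j => ?_) (fun j => ?_) j
    · simpa using h1 j
    · simpa using h2 j

/-- `Fin.append` as a linear equivalence. -/
def appE (m m' : ℕ) :
    ((Fin m → MvPolynomial (Fin n) K) × (Fin m' → MvPolynomial (Fin n) K))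
      ≃ₗ[MvPolynomial (Fin n) K] (Fin (m + m') → MvPolynomial (Fin n) K) where
  toFun v := Fin.append v.1 v.2
  map_add' v w := by
    ext1 j
    refine Fin.addCases (fun j => ?_) (fun j => ?_) j <;> simp
  map_smul' c v := by
    ext1 j
    refine Fin.addCases (fun j => ?_) (fun j => ?_) j <;> simp
  invFun v := (fun j => v (Fin.castAdd _ j), fun j => v (Fin.natAdd _ j))
  left_inv v := by ext1 <;> ext1 j <;> simp
  right_inv v := by
    ext1 j
    refine Fin.addCases (fun j => ?_) (fun j => ?_) j <;> simp

lemma mem_FD_appE {m m' : ℕ} {d : Fin m → ℕ} {d' : Fin m' → ℕ} {e : ℕ}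
    {v : (Fin m → MvPolynomial (Fin n) K) × (Fin m' → MvPolynomial (Fin n) K)} :
    appE m m' v ∈ FD (Fin.append d d') e ↔ v.1 ∈ FD d e ∧ v.2 ∈ FD d' e := mem_FD_append

lemma horseshoe : ∀ (r : ℕ) {A B C : Type u} [AddCommGroup A] [AddCommGroup B] [AddCommGroup C]
    [Module (MvPolynomial (Fin n) K) A] [Module (MvPolynomial (Fin n) K) B]
    [Module (MvPolynomial (Fin n) K) C]
    (GA : ℕ → AddSubgroup A) (GB : ℕ → AddSubgroup B) (GC : ℕ → AddSubgroup C)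
    (i : A →ₗ[MvPolynomial (Fin n) K] B) (p : B →ₗ[MvPolynomial (Fin n) K] C),
    SES GA GB GC i p → GR (K := K) (n := n) r A GA → GR (K := K) (n := n) r C GC →
      GR (K := K) (n := n) r B GB := by
  intro r
  induction r with
  | zero =>
    intro A B C _ _ _ _ _ _ GA GB GC i p h hA hC
    have hA : Subsingleton A := hA
    have hC : Subsingleton C := hC
    change Subsingleton B
    refine ⟨fun x y => ?_⟩
    obtain ⟨a, ha⟩ := h.exact x (Subsingleton.elim _ _)
    obtain ⟨b, hb⟩ := h.exact y (Subsingleton.elim _ _)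
    rw [← ha, ← hb, Subsingleton.elim a b]
  | succ r ih =>
    rintro A B C _ _ _ _ _ _ GA GB GC i p h ⟨m, d, φ, a1, a2, a3, a4⟩ ⟨m', d', φ', c1, c2, c3, c4⟩
    choose b hb hpb using fun j => h.surj_p _ _ (c2 j)
    let ψ : (Fin m' → MvPolynomial (Fin n) K) →ₗ[MvPolynomial (Fin n) K] B :=
      Fintype.linearCombination _ b
    have hψ : ∀ j, ψ (Pi.single j 1) = b j := by
      intro j
      simp [ψ, Fintype.linearCombination_apply, Pi.single_apply]
    have hpψ : ∀ v, p (ψ v) = φ' v := by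
      intro v
      have : p.comp ψ = φ' := by
        refine LinearMap.pi_ext' fun j => LinearMap.ext_ring ?_
        simp [hψ, hpb]
      exact LinearMap.congr_fun this v
    have hψmem : ∀ e v, v ∈ FD d' e → ψ v ∈ GB e := fun e v hv =>
      phi_mem h.gr (fun j => by rw [hψ]; exact hb j) hv
    let Φ : (Fin (m + m') → MvPolynomial (Fin n) K) →ₗ[MvPolynomial (Fin n) K] B :=
      (LinearMap.coprod (i.comp φ) ψ).comp (appE m m').symm.toLinearMap
    have hΦ : ∀ v w, Φ (appE m m' (v, w)) = i (φ v) + ψ w := by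
      intro v w; simp [Φ]
    have hkill : ∀ z, φ' z = 0 → ∃ w, i (φ w) = ψ z ∧ ∀ e, z ∈ FD d' e →
        ∃ w ∈ FD d e, i (φ w) = ψ z := by
      intro z hz
      obtain ⟨a, ha⟩ := h.exact (ψ z) (by rw [hpψ, hz])
      obtain ⟨w, hw⟩ := a1 a
      refine ⟨w, by rw [hw, ha], fun e he => ?_⟩
      obtain ⟨w, hw, hw'⟩ := a3 e a ((h.mem_i e a).1 (by rw [ha]; exact hψmem e z he))
      exact ⟨w, hw, by rw [hw', ha]⟩
    refine ⟨m + m', Fin.append d d', Φ, ?_, ?_, ?_, ?_⟩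
    · intro x
      obtain ⟨z, hz⟩ := c1 (p x)
      obtain ⟨a, ha⟩ := h.exact (x - ψ z) (by rw [map_sub, hpψ, hz, sub_self])
      obtain ⟨w, hw⟩ := a1 a
      exact ⟨appE m m' (w, z), by rw [hΦ, hw, ha]; abel⟩
    · intro j
      refine Fin.addCases (fun j => ?_) (fun j => ?_) j
      · have : (Pi.single (Fin.castAdd m' j) 1 : Fin (m + m') → MvPolynomial (Fin n) K) =
            appE m m' (Pi.single j 1, 0) := by
          ext1 k
          refine Fin.addCases (fun k => ?_) (fun k => ?_) k
          · simp [appE, Pi.single_apply]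
          · simp [appE, Pi.single_apply, Fin.ext_iff]; omega
        rw [this, hΦ, map_zero, add_zero, Fin.append_left, h.mem_i]
        exact a2 j
      · have : (Pi.single (Fin.natAdd m j) 1 : Fin (m + m') → MvPolynomial (Fin n) K) =
            appE m m' (0, Pi.single j 1) := by
          ext1 k
          refine Fin.addCases (fun k => ?_) (fun k => ?_) k
          · simp [appE, Pi.single_apply, Fin.ext_iff]; omega
          · simp [appE, Pi.single_apply]
        rw [this, hΦ, map_zero, map_zero, zero_add, Fin.append_right, hψ]
        exact hb j
    · intro e x hx
      obtain ⟨z, hze, hz⟩ := c3 e (p x) (h.mem_p e x hx)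
      obtain ⟨a, ha⟩ := h.exact (x - ψ z) (by rw [map_sub, hpψ, hz, sub_self])
      obtain ⟨w, hwe, hw⟩ := a3 e a ((h.mem_i e a).1 (by
        rw [ha]; exact (GB e).sub_mem hx (hψmem e z hze)))
      exact ⟨appE m m' (w, z), mem_FD_appE.2 ⟨hwe, hze⟩, by rw [hΦ, hw, ha]; abel⟩
    · let i' : LinearMap.ker φ →ₗ[MvPolynomial (Fin n) K] LinearMap.ker Φ :=
        LinearMap.codRestrict _
          ((appE m m').toLinearMap.comp ((LinearMap.inl _ _ _).comp (LinearMap.ker φ).subtype)) (by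
            rintro ⟨x, hx⟩
            have hx : φ x = 0 := hx
            simp [hΦ, hx])
      let p' : LinearMap.ker Φ →ₗ[MvPolynomial (Fin n) K] LinearMap.ker φ' :=
        LinearMap.codRestrict _
          ((LinearMap.snd _ _ _).comp ((appE m m').symm.toLinearMap.comp
            (LinearMap.ker Φ).subtype)) (by
            rintro ⟨x, hx⟩
            obtain ⟨⟨v, w⟩, rfl⟩ := (appE m m').surjective x
            have hx : i (φ v) + ψ w = 0 := by rw [← hΦ]; exact hx
            have := congrArg p hx
            rw [map_add, h.comp, hpψ, zero_add, map_zero] at this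
            simpa using this)
      have hi' : ∀ x, (i' x).1 = appE m m' (x.1, 0) := fun x => rfl
      have hp' : ∀ v w hx, (p' ⟨appE m m' (v, w), hx⟩).1 = w := by
        intro v w hx
        simp [p']
      refine ih (subG d _) (subG _ _) (subG d' _) i' p' ?_ a4 c4
      refine ⟨isGr_subG _ _, ?_, ?_, ?_, ?_, ?_, ?_, ?_⟩
      · intro x y hxy
        have := congrArg Subtype.val hxy
        rw [hi', hi'] at this
        have := (appE m m').injective this
        exact Subtype.ext (congrArg Prod.fst this)
      · rintro ⟨x, hx⟩ h0
        obtain ⟨⟨v, w⟩, rfl⟩ := (appE m m').surjective x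
        have h0 := congrArg Subtype.val h0
        rw [hp'] at h0
        have h0 : w = 0 := h0
        subst h0
        have hx' : i (φ v) + ψ 0 = 0 := by rw [← hΦ]; exact hx
        rw [map_zero, add_zero] at hx'
        exact ⟨⟨v, h.inj (by rw [hx', map_zero])⟩, Subtype.ext (hi' _)⟩
      · rintro x
        apply Subtype.ext
        change ((appE m m').symm (appE m m' (x.1, 0))).2 = 0
        rw [LinearEquiv.symm_apply_apply]
      · rintro ⟨z, hz⟩
        obtain ⟨w, hw, -⟩ := hkill z hz
        refine ⟨⟨appE m m' (-w, z), ?_⟩, Subtype.ext (hp' _ _ _)⟩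
        rw [LinearMap.mem_ker, hΦ, map_neg, map_neg, hw, neg_add_cancel]
      · intro e x
        rw [mem_subG, mem_subG, hi', mem_FD_appE]
        exact ⟨fun h => h.1, fun h => ⟨h, (FD d' e).zero_mem⟩⟩
      · rintro e ⟨x, hx⟩ hxe
        obtain ⟨⟨v, w⟩, rfl⟩ := (appE m m').surjective x
        rw [mem_subG, hp']
        exact (mem_FD_appE.1 hxe).2
      · rintro e ⟨z, hz⟩ hze
        obtain ⟨-, -, hw⟩ := hkill z hz
        obtain ⟨w, hwe, hw⟩ := hw e hze
        refine ⟨⟨appE m m' (-w, z), ?_⟩, ?_, Subtype.ext (hp' _ _ _)⟩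
        · rw [LinearMap.mem_ker, hΦ, map_neg, map_neg, hw, neg_add_cancel]
        · exact mem_FD_appE.2 ⟨(FD d e).neg_mem hwe, hze⟩

lemma cone (r : ℕ) {A B C : Type u} [AddCommGroup A] [AddCommGroup B] [AddCommGroup C]
    [Module (MvPolynomial (Fin n) K) A] [Module (MvPolynomial (Fin n) K) B]
    [Module (MvPolynomial (Fin n) K) C]
    (GA : ℕ → AddSubgroup A) (GB : ℕ → AddSubgroup B) (GC : ℕ → AddSubgroup C)
    (i : A →ₗ[MvPolynomial (Fin n) K] B) (p : B →ₗ[MvPolynomial (Fin n) K] C)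
    (h : SES GA GB GC i p) (hA : GR (K := K) (n := n) r A GA)
    (hB : GR (K := K) (n := n) r B GB) : GR (K := K) (n := n) (r + 1) C GC := by
  cases r with
  | zero =>
    apply GR_mono
    have hB : Subsingleton B := hB
    change Subsingleton C
    exact h.surj.subsingleton
  | succ r =>
    obtain ⟨m, d, φ, b1, b2, b3, b4⟩ := hB
    refine ⟨m, d, p.comp φ, h.surj.comp b1, fun j => h.mem_p _ _ (b2 j), ?_, ?_⟩
    · intro e x hx
      obtain ⟨b, hb, hbx⟩ := h.surj_p e x hx
      obtain ⟨v, hv, hvb⟩ := b3 e b hb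
      exact ⟨v, hv, by simp [hvb, hbx]⟩
    · let q : LinearMap.ker (p.comp φ) →ₗ[MvPolynomial (Fin n) K] A :=
        (LinearEquiv.ofInjective i h.inj).symm.toLinearMap.comp
          (LinearMap.codRestrict (LinearMap.range i) (φ.comp (LinearMap.ker (p.comp φ)).subtype)
            (fun x => h.exact _ x.2))
      have hq : ∀ x, i (q x) = φ x.1 := by
        intro x
        have := (LinearEquiv.ofInjective i h.inj).apply_symm_apply
          (LinearMap.codRestrict (LinearMap.range i) (φ.comp (LinearMap.ker (p.comp φ)).subtype)
            (fun x => h.exact _ x.2) x)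
        exact congrArg Subtype.val this
      have hle : LinearMap.ker φ ≤ LinearMap.ker (p.comp φ) := LinearMap.ker_le_ker_comp _ _
      refine horseshoe (r + 1) (subG d _) (subG d _) GA (Submodule.inclusion hle) q ?_
        (GR_mono _ _ _ b4) hA
      refine ⟨isGr_subG _ _, Submodule.inclusion_injective _, ?_, ?_, ?_, ?_, ?_, ?_⟩
      · rintro x hx
        have := hq x
        rw [hx, map_zero] at this
        exact ⟨⟨x.1, this.symm⟩, rfl⟩
      · rintro ⟨x, hx⟩
        apply h.inj
        rw [hq, map_zero]
        exact hx
      · intro a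
        obtain ⟨v, hv⟩ := b1 (i a)
        refine ⟨⟨v, ?_⟩, h.inj ?_⟩
        · simp [hv, h.comp]
        · rw [hq, hv]
      · intro e x
        rfl
      · intro e x hx
        rw [← h.mem_i, hq]
        exact phi_mem h.gr b2 hx
      · intro e a ha
        obtain ⟨v, hve, hv⟩ := b3 e (i a) ((h.mem_i _ _).2 ha)
        refine ⟨⟨v, ?_⟩, hve, h.inj ?_⟩
        · simp [hv, h.comp]
        · rw [hq, hv]

end hom

section resolution

open Function

variable {K : Type u} [Field K] {n : ℕ}

/-- A syzygy module together with a bound on its resolution. -/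
structure St (K : Type u) [Field K] (n : ℕ) where
  m : ℕ
  d : Fin m → ℕ
  N : Submodule (MvPolynomial (Fin n) K) (Fin m → MvPolynomial (Fin n) K)
  r : ℕ
  h : GR (K := K) (n := n) r N (subG d N)

lemma St.exists_next (s : St K n) : ∃ (t : St K n) (A : Matrix (Fin s.m) (Fin t.m)
    (MvPolynomial (Fin n) K)), LinearMap.range A.mulVecLin = s.N ∧
      t.N = LinearMap.ker A.mulVecLin ∧ t.r = s.r - 1 ∧ (s.r = 0 → t.m = 0) ∧
      ∀ k l, A k l = 0 ∨ ∃ c : ℕ, (A k l).IsHomogeneous c ∧ t.d l = s.d k + c := by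
  obtain ⟨m, d, N, r, h⟩ := s
  cases r with
  | zero =>
    have h : Subsingleton N := h
    refine ⟨⟨0, fun _ => 0, ⊤, 0, ?_⟩, fun _ j => j.elim0, ?_, ?_, rfl, fun _ => rfl, ?_⟩
    · change Subsingleton _
      infer_instance
    · rw [Submodule.subsingleton_iff_eq_bot] at h
      refine Eq.trans ?_ h.symm
      rw [LinearMap.range_eq_bot]
      refine LinearMap.ext fun v => ?_
      have hv : v = 0 := funext fun j => Fin.elim0 j
      rw [hv, map_zero, map_zero]
    · ext1 v
      rw [Subsingleton.elim v 0]
      simp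
    · intro k l; exact l.elim0
  | succ r =>
    obtain ⟨m', d', φ, h1, h2, h3, h4⟩ := h
    let ψ := N.subtype.comp φ
    have hψ : (LinearMap.toMatrix' ψ).mulVecLin = ψ := by
      rw [← Matrix.toLin'_apply', Matrix.toLin'_toMatrix']
    have hker : LinearMap.ker φ = LinearMap.ker ψ := by
      rw [LinearMap.ker_comp_of_ker_eq_bot _ (Submodule.ker_subtype N)]
    refine ⟨⟨m', d', LinearMap.ker φ, r, h4⟩, LinearMap.toMatrix' ψ, ?_, ?_, rfl, fun h => ?_, ?_⟩
    · change _ = N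
      rw [hψ, LinearMap.range_comp, LinearMap.range_eq_top.2 h1, Submodule.map_top,
        Submodule.range_subtype]
    · rw [hψ]; exact hker
    · exact absurd h (Nat.succ_ne_zero r)
    · intro k l
      have := h2 l k
      rw [LinearMap.toMatrix'_apply]
      exact this

/-- The next syzygy module. -/
noncomputable def St.next (s : St K n) : St K n := s.exists_next.choose

/-- The matrix presenting a syzygy module. -/
noncomputable def St.mat (s : St K n) : Matrix (Fin s.m) (Fin s.next.m) (MvPolynomial (Fin n) K) :=
  s.exists_next.choose_spec.choose

lemma St.spec (s : St K n) : LinearMap.range s.mat.mulVecLin = s.N ∧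
      s.next.N = LinearMap.ker s.mat.mulVecLin ∧ s.next.r = s.r - 1 ∧ (s.r = 0 → s.next.m = 0) ∧
      ∀ k l, s.mat k l = 0 ∨ ∃ c : ℕ, (s.mat k l).IsHomogeneous c ∧ s.next.d l = s.d k + c :=
  s.exists_next.choose_spec.choose_spec

/-- The sequence of syzygy modules. -/
noncomputable def St.seq (s : St K n) : ℕ → St K n
  | 0 => s
  | i + 1 => (St.seq s i).next

lemma St.seq_r (s : St K n) (i : ℕ) : (s.seq i).r = s.r - i := by
  induction i with
  | zero => rfl
  | succ i ih =>
    change (s.seq i).next.r = _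
    rw [(s.seq i).spec.2.2.1, ih]; omega

/-- The standard grading on `S/I`. -/
noncomputable def stdG (I : Ideal (MvPolynomial (Fin n) K)) (e : ℕ) :
    AddSubgroup (MvPolynomial (Fin n) K ⧸ I) :=
  (homogeneousSubmodule (Fin n) K e).toAddSubgroup.map (Submodule.mkQ I).toAddMonoidHom

lemma mem_stdG {I : Ideal (MvPolynomial (Fin n) K)} {e : ℕ} {x : MvPolynomial (Fin n) K ⧸ I} :
    x ∈ stdG I e ↔ ∃ p : MvPolynomial (Fin n) K, p.IsHomogeneous e ∧ Submodule.Quotient.mk p = x :=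
  Iff.rfl

lemma exists_resolution (I : Ideal (MvPolynomial (Fin n) K)) (r : ℕ)
    (h : GR (K := K) (n := n) (r + 1) (MvPolynomial (Fin n) K ⧸ I) (stdG I)) :
    ∃ F : GradedFreeResolution K n I, ∀ i : ℕ, r < i → F.rank i = 0 := by
  obtain ⟨m, d, φ, h1, h2, h3, h4⟩ := h
  choose g hg hg' using fun j => mem_stdG.1 (h2 j)
  let s : St K n := ⟨m, d, LinearMap.ker φ, r, h4⟩
  have hφ : ∀ v, φ v = Ideal.Quotient.mk I (∑ j, v j * g j) := by
    intro v
    have : v = ∑ j, v j • Pi.single j (1 : MvPolynomial (Fin n) K) := by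
      ext1 k
      simp [Finset.sum_apply, Pi.single_apply]
    conv_lhs => rw [this]
    rw [map_sum, map_sum]
    refine Finset.sum_congr rfl fun j _ => ?_
    rw [map_smul, ← hg' j]
    rfl
  have hrank : ∀ i : ℕ, r < i → (s.seq i).m = 0 := by
    intro i hi
    obtain ⟨i, rfl⟩ : ∃ i', i = i' + 1 := ⟨i - 1, by omega⟩
    refine (s.seq i).spec.2.2.2.1 ?_
    rw [s.seq_r]
    change r - i = 0
    omega
  refine ⟨⟨fun i => (s.seq i).m, fun i => (s.seq i).d, fun i => (s.seq i).mat, g, ⟨r, hrank⟩, hg,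
    fun i => (s.seq i).spec.2.2.2.2, ?_, ?_, ?_⟩, hrank⟩
  · intro x
    obtain ⟨v, hv⟩ := h1 x
    exact ⟨v, (hφ v).symm.trans hv⟩
  · intro v
    have key : ∀ v : Fin m → MvPolynomial (Fin n) K,
        Ideal.Quotient.mk I (∑ j, v j * g j) = 0 ↔ v ∈ LinearMap.range s.mat.mulVecLin := by
      intro v
      rw [s.spec.1, ← hφ]
      rfl
    exact key v
  · intro i v
    have : v ∈ LinearMap.range (s.seq i).next.mat.mulVecLin ↔
        v ∈ LinearMap.ker (s.seq i).mat.mulVecLin := by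
      rw [(s.seq i).next.spec.1, (s.seq i).spec.2.1]
    exact this.symm

end resolution

section ideals

open Function

variable {K : Type u} [Field K] {n : ℕ}

/-- Monomial ideals, via supports. -/
def Mon (I : Ideal (MvPolynomial (Fin n) K)) : Prop :=
  ∀ f ∈ I, ∀ m ∈ f.support, monomial m (1 : K) ∈ I

lemma mon_of_isMonomialIdeal {I : Ideal (MvPolynomial (Fin n) K)} (h : IsMonomialIdeal I) :
    Mon I := by
  obtain ⟨G, rfl⟩ := h
  intro f hf m hm
  rw [mem_ideal_span_monomial_image] at hf ⊢
  intro m' hm'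
  have := support_monomial_subset hm'
  rw [Finset.mem_singleton] at this
  subst this
  exact hf m' hm

lemma Mon.mem {I : Ideal (MvPolynomial (Fin n) K)} (h : Mon I) {f : MvPolynomial (Fin n) K} :
    f ∈ I ↔ ∀ m ∈ f.support, monomial m (1 : K) ∈ I := by
  refine ⟨h f, fun hf => ?_⟩
  rw [f.as_sum]
  refine I.sum_mem fun m hm => ?_
  have : monomial m (coeff m f) = C (coeff m f) * monomial m 1 := by
    rw [C_mul_monomial, mul_one]
  rw [this]
  exact I.mul_mem_left _ (hf m hm)

lemma mem_colon_iff {I : Ideal (MvPolynomial (Fin n) K)} {u y : MvPolynomial (Fin n) K} :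
    y ∈ Submodule.colon I (Ideal.span {u} : Ideal (MvPolynomial (Fin n) K)) ↔ u * y ∈ I := by
  rw [Submodule.mem_colon]
  constructor
  · intro h
    have := h u (Ideal.mem_span_singleton_self u)
    rwa [smul_eq_mul, mul_comm] at this
  · intro h s hs
    obtain ⟨t, rfl⟩ := Ideal.mem_span_singleton'.1 hs
    have := I.mul_mem_left t h
    rw [smul_eq_mul]
    convert this using 1
    ring

lemma mem_add_iff {I : Ideal (MvPolynomial (Fin n) K)} {u y : MvPolynomial (Fin n) K} :
    y ∈ I + Ideal.span {u} ↔ ∃ z, y - u * z ∈ I := by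
  rw [Submodule.add_eq_sup, Submodule.mem_sup]
  constructor
  · rintro ⟨a, ha, b, hb, rfl⟩
    obtain ⟨t, rfl⟩ := Ideal.mem_span_singleton'.1 hb
    exact ⟨t, by convert ha using 1; ring⟩
  · rintro ⟨z, hz⟩
    exact ⟨_, hz, u * z, Ideal.mul_mem_right _ _ (Ideal.mem_span_singleton_self u), by ring⟩

lemma Mon.colon {I : Ideal (MvPolynomial (Fin n) K)} (h : Mon I) (a : Fin n →₀ ℕ) :
    Mon (Submodule.colon I (Ideal.span {(monomial a (1 : K))} : Ideal (MvPolynomial (Fin n) K))) := by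
  intro f hf m hm
  rw [mem_colon_iff] at hf ⊢
  rw [monomial_mul, mul_one]
  refine h _ hf _ ?_
  rw [mem_support_iff, coeff_monomial_mul, one_mul]
  exact mem_support_iff.1 hm

lemma Mon.add {I : Ideal (MvPolynomial (Fin n) K)} (h : Mon I) (a : Fin n →₀ ℕ) :
    Mon (I + Ideal.span {(monomial a (1 : K))}) := by
  intro f hf m hm
  obtain ⟨z, hz⟩ := mem_add_iff.1 hf
  by_cases hm' : m ∈ (f - monomial a 1 * z).support
  · exact Submodule.mem_sup_left (h _ hz _ hm')
  · rw [mem_support_iff, coeff_sub, not_not, sub_eq_zero, coeff_monomial_mul'] at hm'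
    rw [mem_support_iff, hm'] at hm
    split_ifs at hm with hle
    · refine mem_add_iff.2 ⟨monomial (m - a) 1, ?_⟩
      rw [monomial_mul, add_tsub_cancel_of_le hle, mul_one, sub_self]
      exact I.zero_mem
    · exact absurd rfl hm

lemma Mon.component {I : Ideal (MvPolynomial (Fin n) K)} (h : Mon I) {f : MvPolynomial (Fin n) K}
    (hf : f ∈ I) (e : ℕ) : homogeneousComponent e f ∈ I := by
  rw [h.mem]
  intro m hm
  refine h f hf m ?_
  rw [mem_support_iff] at hm ⊢
  rw [coeff_homogeneousComponent] at hm
  split_ifs at hm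
  · exact hm
  · exact absurd rfl hm

lemma isGr_stdG (I : Ideal (MvPolynomial (Fin n) K)) : IsGr (K := K) (n := n) (stdG I) := by
  rintro c e p x hp hx
  obtain ⟨q, hq, rfl⟩ := mem_stdG.1 hx
  refine mem_stdG.2 ⟨p * q, ?_, rfl⟩
  rw [add_comm]
  exact hp.mul hq

lemma component_monomial_mul (a : Fin n →₀ ℕ) (p : MvPolynomial (Fin n) K) (e : ℕ) :
    homogeneousComponent (e + a.degree) (monomial a (1 : K) * p) =
      monomial a (1 : K) * homogeneousComponent e p := by
  ext m
  rw [coeff_homogeneousComponent, coeff_monomial_mul', coeff_monomial_mul',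
    coeff_homogeneousComponent]
  by_cases h : a ≤ m
  · obtain ⟨b, rfl⟩ := exists_add_of_le h
    simp [add_comm e]
  · simp [h]

lemma component_monomial_mul_lt (a : Fin n →₀ ℕ) (p : MvPolynomial (Fin n) K) (e : ℕ)
    (he : e < a.degree) :
    homogeneousComponent e (monomial a (1 : K) * p) = 0 := by
  ext m
  rw [coeff_homogeneousComponent, coeff_monomial_mul']
  by_cases h : a ≤ m
  · obtain ⟨b, rfl⟩ := exists_add_of_le h
    have : a.degree + b.degree ≠ e := by omega
    simp [this]
  · simp [h]

lemma exists_SES {I : Ideal (MvPolynomial (Fin n) K)} (h : Mon I) (a : Fin n →₀ ℕ)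
    (J L : Ideal (MvPolynomial (Fin n) K)) (hJ : ∀ y, y ∈ J ↔ monomial a (1 : K) * y ∈ I)
    (hL : ∀ y, y ∈ L ↔ ∃ z, y - monomial a (1 : K) * z ∈ I) :
    ∃ (G : ℕ → AddSubgroup (MvPolynomial (Fin n) K ⧸ J))
      (i : (MvPolynomial (Fin n) K ⧸ J) →ₗ[MvPolynomial (Fin n) K] (MvPolynomial (Fin n) K ⧸ I))
      (p : (MvPolynomial (Fin n) K ⧸ I) →ₗ[MvPolynomial (Fin n) K] (MvPolynomial (Fin n) K ⧸ L)),
      SES G (stdG I) (stdG L) i p ∧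
      ∀ r, GR (K := K) (n := n) r (MvPolynomial (Fin n) K ⧸ J) (stdG J) →
        GR (K := K) (n := n) r (MvPolynomial (Fin n) K ⧸ J) G := by
  let i : (MvPolynomial (Fin n) K ⧸ J) →ₗ[MvPolynomial (Fin n) K] (MvPolynomial (Fin n) K ⧸ I) :=
    Submodule.mapQ J I (LinearMap.mulLeft _ (monomial a (1 : K))) (fun y hy => (hJ y).1 hy)
  have hIL : I ≤ L := fun y hy => (hL y).2 ⟨0, by simpa using hy⟩
  let p : (MvPolynomial (Fin n) K ⧸ I) →ₗ[MvPolynomial (Fin n) K] (MvPolynomial (Fin n) K ⧸ L) :=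
    Submodule.mapQ I L LinearMap.id hIL
  have hi : ∀ y, i (Submodule.Quotient.mk y) = Submodule.Quotient.mk (monomial a (1 : K) * y) :=
    fun y => rfl
  have hp : ∀ y, p (Submodule.Quotient.mk y) = Submodule.Quotient.mk y := fun y => rfl
  refine ⟨fun e => (stdG I e).comap i.toAddMonoidHom, i, p, ?_, ?_⟩
  · refine ⟨isGr_stdG I, ?_, ?_, ?_, ?_, ?_, ?_, ?_⟩
    · rw [injective_iff_map_eq_zero]
      intro x hx
      obtain ⟨y, rfl⟩ := Submodule.Quotient.mk_surjective J x
      rw [hi, Submodule.Quotient.mk_eq_zero] at hx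
      rw [Submodule.Quotient.mk_eq_zero]
      exact (hJ y).2 hx
    · intro x hx
      obtain ⟨y, rfl⟩ := Submodule.Quotient.mk_surjective I x
      rw [hp, Submodule.Quotient.mk_eq_zero, hL] at hx
      obtain ⟨z, hz⟩ := hx
      refine ⟨Submodule.Quotient.mk z, ?_⟩
      rw [hi]
      exact ((Submodule.Quotient.eq I).2 hz).symm
    · intro x
      obtain ⟨y, rfl⟩ := Submodule.Quotient.mk_surjective J x
      rw [hi, hp, Submodule.Quotient.mk_eq_zero, hL]
      exact ⟨y, by simp⟩
    · intro x
      obtain ⟨y, rfl⟩ := Submodule.Quotient.mk_surjective L x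
      exact ⟨Submodule.Quotient.mk y, rfl⟩
    · intro e x; rfl
    · intro e x hx
      obtain ⟨q, hq, rfl⟩ := mem_stdG.1 hx
      exact mem_stdG.2 ⟨q, hq, rfl⟩
    · intro e x hx
      obtain ⟨q, hq, rfl⟩ := mem_stdG.1 hx
      exact ⟨Submodule.Quotient.mk q, mem_stdG.2 ⟨q, hq, rfl⟩, rfl⟩
  · intro r hr
    refine GR_shift a.degree r _ (stdG J) _ ?_ ?_ hr
    · intro e x
      obtain ⟨y, rfl⟩ := Submodule.Quotient.mk_surjective J x
      change i (Submodule.Quotient.mk y) ∈ stdG I _ ↔ _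
      rw [hi, mem_stdG, mem_stdG]
      constructor
      · rintro ⟨q, hq, hqy⟩
        rw [Submodule.Quotient.eq] at hqy
        refine ⟨homogeneousComponent e y, homogeneousComponent_isHomogeneous _ _, ?_⟩
        rw [Submodule.Quotient.eq, hJ]
        have := h.component hqy (e + a.degree)
        rw [map_sub, component_monomial_mul, homogeneousComponent_of_mem hq, if_pos rfl] at this
        have := I.sub_mem hqy this
        convert this using 1
        ring
      · rintro ⟨q, hq, hqy⟩
        rw [Submodule.Quotient.eq, hJ] at hqy
        refine ⟨monomial a 1 * q, ?_, ?_⟩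
        · rw [add_comm]
          exact (isHomogeneous_monomial 1 rfl).mul hq
        · rw [Submodule.Quotient.eq]
          convert hqy using 1
          ring
    · intro e x he hx
      obtain ⟨y, rfl⟩ := Submodule.Quotient.mk_surjective J x
      have hx : i (Submodule.Quotient.mk y) ∈ stdG I e := hx
      rw [hi, mem_stdG] at hx
      obtain ⟨q, hq, hqy⟩ := hx
      rw [Submodule.Quotient.eq] at hqy
      have := h.component hqy e
      rw [map_sub, component_monomial_mul_lt _ _ _ he, homogeneousComponent_of_mem hq, if_pos rfl,
        sub_zero] at this
      rw [Submodule.Quotient.mk_eq_zero, hJ]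
      have := I.sub_mem this hqy
      convert this using 1
      ring

lemma mon_PT (T : Finset (Fin n)) : Mon (PT K T) := by
  intro f hf m hm
  unfold PT at hf ⊢
  rw [mem_ideal_span_X_image] at hf ⊢
  intro m' hm'
  have := support_monomial_subset hm'
  rw [Finset.mem_singleton] at this
  subst this
  exact hf m' hm

lemma GR_PT (T : Finset (Fin n)) :
    GR (K := K) (n := n) (T.card + 1) (MvPolynomial (Fin n) K ⧸ PT K T) (stdG (PT K T)) := by
  classical
  induction T using Finset.induction_on with
  | empty =>
    have hbot : PT K (∅ : Finset (Fin n)) = ⊥ := by simp [PT]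
    let φ : (Fin 1 → MvPolynomial (Fin n) K) →ₗ[MvPolynomial (Fin n) K]
        (MvPolynomial (Fin n) K ⧸ PT K (∅ : Finset (Fin n))) :=
      (Submodule.mkQ _).comp (LinearMap.proj 0)
    have hφ : ∀ v, φ v = Submodule.Quotient.mk (v 0) := fun v => rfl
    refine ⟨1, fun _ => 0, φ, ?_, ?_, ?_, ?_⟩
    · intro x
      obtain ⟨y, rfl⟩ := Submodule.Quotient.mk_surjective _ x
      exact ⟨fun _ => y, rfl⟩
    · intro j
      refine mem_stdG.2 ⟨1, isHomogeneous_one _ _, ?_⟩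
      rw [hφ, Subsingleton.elim j 0, Pi.single_eq_same]
    · intro e x hx
      obtain ⟨q, hq, rfl⟩ := mem_stdG.1 hx
      exact ⟨fun _ => q, fun j => Or.inr ⟨e, hq, (zero_add e).symm⟩, rfl⟩
    · change Subsingleton _
      rw [Submodule.subsingleton_iff_eq_bot, Submodule.eq_bot_iff]
      intro v hv
      rw [LinearMap.mem_ker, hφ, Submodule.Quotient.mk_eq_zero, hbot, Submodule.mem_bot] at hv
      ext1 j
      rw [Subsingleton.elim j 0, hv]; rfl
  | insert j T hj ih =>
    have hins : PT K (insert j T) = PT K T + Ideal.span {monomial (Finsupp.single j 1) (1 : K)} := by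
      unfold PT
      rw [Finset.coe_insert, Set.image_insert_eq, Ideal.span_insert, add_comm]
      rfl
    obtain ⟨G, i, p, hS, hG⟩ := exists_SES (mon_PT (K := K) T) (Finsupp.single j 1) (PT K T)
      (PT K (insert j T)) (fun y => ⟨fun h => Ideal.mul_mem_left _ _ h, fun h =>
        X_mul_mem_span (by simpa using hj) h⟩) (fun y => by rw [hins]; exact mem_add_iff)
    rw [Finset.card_insert_of_notMem hj]
    exact cone _ _ _ _ i p hS (hG _ ih) ih

lemma prime_eq_PT {I : Ideal (MvPolynomial (Fin n) K)} (h : Mon I) (hp : I.IsPrime) :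
    ∃ T, I = PT K T := by
  classical
  refine ⟨Finset.univ.filter fun i => X i ∈ I, le_antisymm ?_ ?_⟩
  · intro f hf
    rw [(mon_PT _).mem]
    intro m hm
    have := h f hf m hm
    rw [monomial_eq, C_1, one_mul, Finsupp.prod] at this
    obtain ⟨i, hi, hi'⟩ := hp.prod_mem_iff.1 this
    have hXi := hp.mem_of_pow_mem _ hi'
    unfold PT
    rw [mem_ideal_span_X_image]
    intro m' hm'
    have := support_monomial_subset hm'
    rw [Finset.mem_singleton] at this
    subst this
    exact ⟨i, by simpa using hXi, by simpa using hi⟩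
  · unfold PT
    rw [Ideal.span_le]
    rintro _ ⟨i, hi, rfl⟩
    simpa using hi

lemma ass_of_min {I P : Ideal (MvPolynomial (Fin n) K)} (h : P ∈ I.minimalPrimes) :
    P ∈ associatedPrimes (MvPolynomial (Fin n) K) (MvPolynomial (Fin n) K ⧸ I) := by
  apply Module.associatedPrimes.minimalPrimes_annihilator_subset_associatedPrimes
  rwa [Ideal.annihilator_quotient]

lemma min_colon {I : Ideal (MvPolynomial (Fin n) K)} (hI : NoEmbeddedPrimes I)
    (u : MvPolynomial (Fin n) K) :
    (Submodule.colon I (Ideal.span {u} : Ideal (MvPolynomial (Fin n) K))).minimalPrimes ⊆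
      I.minimalPrimes := by
  intro P hP
  apply hI
  set J := Submodule.colon I (Ideal.span {u} : Ideal (MvPolynomial (Fin n) K)) with hJ
  have hle : J ≤ Submodule.comap (LinearMap.mulLeft (MvPolynomial (Fin n) K) u) I :=
    fun y hy => mem_colon_iff.1 hy
  refine associatedPrimes.subset_of_injective (f := Submodule.mapQ J I
    (LinearMap.mulLeft (MvPolynomial (Fin n) K) u) hle) ?_ (ass_of_min hP)
  rw [injective_iff_map_eq_zero]
  intro x hx
  obtain ⟨y, rfl⟩ := Submodule.Quotient.mk_surjective J x
  rw [Submodule.mapQ_apply, Submodule.Quotient.mk_eq_zero] at hx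
  rw [Submodule.Quotient.mk_eq_zero]
  exact mem_colon_iff.2 hx

lemma upper {k : ℕ} {I : Ideal (MvPolynomial (Fin n) K)} (hk : KClean K (Fin n) k I)
    (b : ℕ) : Mon I → (∀ T, PT K T ∈ I.minimalPrimes → T.card ≤ b) →
    GR (K := K) (n := n) (b + 1) (MvPolynomial (Fin n) K ⧸ I) (stdG I) := by
  induction hk with
  | prime I hp =>
    intro hI hb
    obtain ⟨T, rfl⟩ := prime_eq_PT hI hp
    refine GR_mono' ?_ _ _ (GR_PT T)
    have := hb T (by rw [Ideal.minimalPrimes_eq_subsingleton_self]; rfl)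
    omega
  | step I a hne hcl hsupp hcolon hsum ih1 ih2 =>
    intro hI hb
    obtain ⟨G, i, p, hS, hG⟩ := exists_SES hI a _ _ (fun y => mem_colon_iff) (fun y => mem_add_iff)
    exact horseshoe _ _ _ _ i p hS
      (hG _ (ih1 (hI.colon a) fun T hT => hb T (min_colon hne _ hT)))
      (ih2 (hI.add a) fun T hT => hb T (hcl.2.2 hT))

lemma noEmb {k : ℕ} {I : Ideal (MvPolynomial (Fin n) K)} (hk : KClean K (Fin n) k I) :
    NoEmbeddedPrimes I := by
  cases hk with
  | prime _ h =>
    intro P hP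
    rw [AssociatedPrimes.mem_iff, isAssociatedPrime_iff] at hP
    obtain ⟨hP, x, hx⟩ := hP
    obtain ⟨y, rfl⟩ := Submodule.Quotient.mk_surjective I x
    have hmem : ∀ z, z ∈ P ↔ z * y ∈ I := by
      intro z
      rw [hx, Submodule.mem_colon_singleton, Submodule.mem_bot, ← Submodule.Quotient.mk_smul,
        Submodule.Quotient.mk_eq_zero, smul_eq_mul]
    have hy : y ∉ I := fun hy => hP.ne_top ((Ideal.eq_top_iff_one _).2 ((hmem 1).2 (by simpa using hy)))
    have : P = I := by
      ext z
      rw [hmem]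
      exact ⟨fun hz => (h.mem_or_mem hz).resolve_right hy, fun hz => I.mul_mem_right _ hz⟩
    rw [this, Ideal.minimalPrimes_eq_subsingleton_self]; rfl
  | step _ _ hne => exact hne

open Classical in
/-- The big height of a monomial ideal. -/
noncomputable def bigh (I : Ideal (MvPolynomial (Fin n) K)) : ℕ :=
  (Finset.univ.filter fun T : Finset (Fin n) => PT K T ∈ I.minimalPrimes).sup Finset.card

lemma le_bigh {I : Ideal (MvPolynomial (Fin n) K)} {T : Finset (Fin n)}
    (hT : PT K T ∈ I.minimalPrimes) : T.card ≤ bigh I := by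
  classical
  exact Finset.le_sup (f := Finset.card) (by simpa using hT)

lemma bigh_le {I : Ideal (MvPolynomial (Fin n) K)} {b : ℕ}
    (h : ∀ T, PT K T ∈ I.minimalPrimes → T.card ≤ b) : bigh I ≤ b := by
  classical
  exact Finset.sup_le fun T hT => h T (by simpa using hT)

lemma pdQuot_eq {k : ℕ} {I : Ideal (MvPolynomial (Fin n) K)} (hk : KClean K (Fin n) k I)
    (hI : Mon I) : pdQuot I = bigh I := by
  have hex := exists_resolution I _ (upper hk (bigh I) hI fun T hT => le_bigh hT)
  apply le_antisymm
  · exact Nat.sInf_le hex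
  · obtain ⟨F, hF⟩ := Nat.sInf_mem (s := {r : ℕ | ∃ F : GradedFreeResolution K n I,
      ∀ i : ℕ, r < i → F.rank i = 0}) ⟨_, hex⟩
    exact bigh_le fun T hT => lower_bound F _ hF T (ass_of_min hT)

end ideals

end PdClean

open PdClean in
theorem pd_eq_max' {K : Type*} [Field K] {n : ℕ}
    (I : Ideal (MvPolynomial (Fin n) K)) (hmon : IsMonomialIdeal I)
    (k : ℕ) (hk : KClean K (Fin n) k I) (a : Fin n →₀ ℕ)
    (hcl : IsCleaner I a)
    (hcolon : KClean K (Fin n) k (Submodule.colon I (Ideal.span {(monomial a (1 : K))})))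
    (hsum : KClean K (Fin n) k (I + Ideal.span {(monomial a (1 : K))})) :
    pdQuot I = max (pdQuot (I + Ideal.span {(monomial a (1 : K))}))
      (pdQuot (Submodule.colon I (Ideal.span {(monomial a (1 : K))}))) := by
  have hI := mon_of_isMonomialIdeal hmon
  rw [pdQuot_eq hk hI, pdQuot_eq hsum (hI.add a), pdQuot_eq hcolon (hI.colon a)]
  apply le_antisymm
  · refine bigh_le fun T hT => ?_
    have hp : (PT K T).IsPrime := hT.1.1
    have hle : I ≤ PT K T := hT.1.2
    by_cases hu : monomial a (1 : K) ∈ PT K T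
    · refine le_max_of_le_left (le_bigh ⟨⟨hp, ?_⟩, ?_⟩)
      · rw [Submodule.add_eq_sup, sup_le_iff, Ideal.span_singleton_le_iff_mem]
        exact ⟨hle, hu⟩
      · rintro Q ⟨hQ, hQ'⟩ hQT
        exact hT.2 ⟨hQ, le_trans le_sup_left hQ'⟩ hQT
    · refine le_max_of_le_right (le_bigh ⟨⟨hp, ?_⟩, ?_⟩)
      · intro y hy
        exact (hp.mem_or_mem (hle (mem_colon_iff.1 hy))).resolve_left hu
      · rintro Q ⟨hQ, hQ'⟩ hQT
        refine hT.2 ⟨hQ, le_trans ?_ hQ'⟩ hQT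
        intro y hy
        exact mem_colon_iff.2 (I.mul_mem_left _ hy)
  · refine max_le (bigh_le fun T hT => le_bigh (hcl.2.2 hT))
      (bigh_le fun T hT => le_bigh (min_colon (noEmb hk) _ hT))


theorem pd_eq_max {K : Type*} [Field K] {n : ℕ}
    (I : Ideal (MvPolynomial (Fin n) K)) (hmon : IsMonomialIdeal I)
    (k : ℕ) (hk : KClean K (Fin n) k I) (a : Fin n →₀ ℕ)
    (hcl : IsCleaner I a) (hsupp : a.support.card ≤ k + 1)
    (hcolon : KClean K (Fin n) k (Submodule.colon I (Ideal.span {(monomial a (1 : K))})))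
    (hsum : KClean K (Fin n) k (I + Ideal.span {(monomial a (1 : K))})) :
    pdQuot I = max (pdQuot (I + Ideal.span {(monomial a (1 : K))}))
      (pdQuot (Submodule.colon I (Ideal.span {(monomial a (1 : K))}))) := by
  exact pd_eq_max' I hmon k hk a hcl hcolon hsum
end

section
/- Let I ⊆ S be a k-clean monomial ideal with cleaner monomial u (i.e., u ∉ I is a cleaner monomial with |supp(u)| ≤ k+1 such that both I : u and I + Su are k-clean). Then reg(S/I) = max{ reg(S/(I + Su)), reg(S/(I : u)) + deg(u) }, where reg denotes Castelnuovo–Mumford regularity. -/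
open MvPolynomial

/-! ## Homogeneity with integer degrees -/

/-- `p` is homogeneous of the integer degree `z`. -/
def HD {K : Type*} [Field K] {n : ℕ} (p : MvPolynomial (Fin n) K) (z : ℤ) : Prop :=
  ∀ m, coeff m p ≠ 0 → (m.degree : ℤ) = z

section HDlemmas
variable {K : Type*} [Field K] {n : ℕ}

theorem HD.zero (z : ℤ) : HD (0 : MvPolynomial (Fin n) K) z := by
  intro m hm; simp at hm

theorem HD.add {p q : MvPolynomial (Fin n) K} {z : ℤ} (hp : HD p z) (hq : HD q z) :
    HD (p + q) z := by
  intro m hm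
  rw [coeff_add] at hm
  by_cases h : coeff m p = 0
  · exact hq m (by intro h2; exact hm (by rw [h, h2, add_zero]))
  · exact hp m h

theorem HD.neg {p : MvPolynomial (Fin n) K} {z : ℤ} (hp : HD p z) : HD (-p) z := by
  intro m hm
  rw [coeff_neg] at hm
  exact hp m (by simpa using hm)

theorem HD.mul {p q : MvPolynomial (Fin n) K} {y z : ℤ} (hp : HD p y) (hq : HD q z) :
    HD (p * q) (y + z) := by
  intro m hm
  rw [coeff_mul] at hm
  obtain ⟨x, hx, hne⟩ := Finset.exists_ne_zero_of_sum_ne_zero hm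
  rw [Finset.HasAntidiagonal.mem_antidiagonal] at hx
  have h1 := hp x.1 (left_ne_zero_of_mul hne)
  have h2 := hq x.2 (right_ne_zero_of_mul hne)
  rw [← hx, map_add]; push_cast; rw [h1, h2]

theorem HD.sum {ι : Type*} (s : Finset ι) {f : ι → MvPolynomial (Fin n) K} {z : ℤ}
    (h : ∀ i ∈ s, HD (f i) z) : HD (∑ i ∈ s, f i) z := by
  classical
  induction s using Finset.induction_on with
  | empty => simpa using HD.zero z
  | insert a s ha ih =>
    rw [Finset.sum_insert ha]
    exact HD.add (h a (by simp)) (ih fun i hi => h i (by simp [hi]))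

theorem HD.eq_zero_of_neg {p : MvPolynomial (Fin n) K} {z : ℤ} (hp : HD p z) (hz : z < 0) :
    p = 0 := by
  ext m
  by_contra h
  have := hp m (by simpa using h)
  omega

theorem HD.monomial (a : Fin n →₀ ℕ) : HD (monomial a (1 : K)) (a.degree : ℤ) := by
  intro m hm
  rw [coeff_monomial] at hm
  split_ifs at hm with h
  · rw [h]
  · simp at hm

theorem HD.one : HD (1 : MvPolynomial (Fin n) K) 0 := by
  have := HD.monomial (K := K) (0 : Fin n →₀ ℕ)
  simpa using this

theorem HD.X (i : Fin n) : HD (X i : MvPolynomial (Fin n) K) 1 := by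
  have := HD.monomial (K := K) (Finsupp.single i 1)
  simpa [MvPolynomial.X] using this

theorem HD.iff_isHomogeneous {p : MvPolynomial (Fin n) K} {c : ℕ} :
    HD p (c : ℤ) ↔ p.IsHomogeneous c := by
  have hw : ∀ m : Fin n →₀ ℕ, Finsupp.weight (1 : Fin n → ℕ) m = m.degree := by
    intro m; rw [Finsupp.degree_eq_weight_one]; rfl
  unfold HD MvPolynomial.IsHomogeneous IsWeightedHomogeneous
  constructor
  · intro h m hm
    have := h m hm
    rw [hw]
    exact_mod_cast this
  · intro h m hm
    have := h hm
    rw [hw] at this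
    exact_mod_cast this

/-- degree-`z` component -/
noncomputable def hcmp (z : ℤ) (p : MvPolynomial (Fin n) K) : MvPolynomial (Fin n) K :=
  if 0 ≤ z then homogeneousComponent z.toNat p else 0

theorem coeff_hcmp (z : ℤ) (p : MvPolynomial (Fin n) K) (m : Fin n →₀ ℕ) :
    coeff m (hcmp z p) = if (m.degree : ℤ) = z then coeff m p else 0 := by
  unfold hcmp
  split_ifs with h1 h2 h3
  · rw [coeff_homogeneousComponent, if_pos (by omega)]
  · rw [coeff_homogeneousComponent, if_neg (by omega)]
  · omega
  · simp

theorem hcmp_HD (z : ℤ) (p : MvPolynomial (Fin n) K) : HD (hcmp z p) z := by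
  intro m hm
  rw [coeff_hcmp] at hm
  by_contra h
  rw [if_neg h] at hm
  exact hm rfl

theorem hcmp_add (z : ℤ) (p q : MvPolynomial (Fin n) K) : hcmp z (p + q) = hcmp z p + hcmp z q := by
  ext m
  simp only [coeff_add, coeff_hcmp]
  split_ifs <;> simp

theorem hcmp_sum {ι : Type*} (z : ℤ) (s : Finset ι) (f : ι → MvPolynomial (Fin n) K) :
    hcmp z (∑ i ∈ s, f i) = ∑ i ∈ s, hcmp z (f i) := by
  ext m
  simp only [coeff_sum, coeff_hcmp]
  split_ifs <;> simp

theorem HD.hcmp_eq {p : MvPolynomial (Fin n) K} {z : ℤ} (h : HD p z) : hcmp z p = p := by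
  ext m
  rw [coeff_hcmp]
  split_ifs with h1
  · rfl
  · by_contra h2
    exact h1 (h m (Ne.symm h2))

theorem hcmp_mul {p q : MvPolynomial (Fin n) K} {y z : ℤ} (h : HD p y) :
    hcmp z (p * q) = p * hcmp (z - y) q := by
  ext m
  rw [coeff_hcmp, coeff_mul, coeff_mul]
  have key : ∀ x ∈ Finset.HasAntidiagonal.antidiagonal m, coeff x.1 p * coeff x.2 (hcmp (z - y) q) =
      if (m.degree : ℤ) = z then coeff x.1 p * coeff x.2 q else 0 := by
    intro x hx
    rw [Finset.HasAntidiagonal.mem_antidiagonal] at hx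
    rw [coeff_hcmp]
    by_cases h0 : coeff x.1 p = 0
    · simp [h0]
    · have h1 := h x.1 h0
      have h2 : (m.degree : ℤ) = x.1.degree + x.2.degree := by
        rw [← hx, map_add]; push_cast; rfl
      split_ifs <;> first | rfl | omega | simp
  rw [Finset.sum_congr rfl key]
  split_ifs <;> simp

open Matrix

/-- graded lifting -/
theorem lift_vec {ι κ : Type*} [Fintype κ] {A : Matrix ι κ (MvPolynomial (Fin n) K)}
    {da : ι → ℤ} {db : κ → ℤ} (hA : ∀ k l, HD (A k l) (db l - da k)) {t : ℤ}
    {y : ι → MvPolynomial (Fin n) K} (hy : ∀ k, HD (y k) (t - da k))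
    (h : ∃ w, A *ᵥ w = y) : ∃ w, A *ᵥ w = y ∧ ∀ l, HD (w l) (t - db l) := by
  obtain ⟨w, rfl⟩ := h
  refine ⟨fun l => hcmp (t - db l) (w l), ?_, fun l => hcmp_HD _ _⟩
  funext k
  rw [← (hy k).hcmp_eq]
  simp only [mulVec, dotProduct, hcmp_sum]
  refine Finset.sum_congr rfl fun l _ => ?_
  rw [hcmp_mul (hA k l)]
  congr 2; ring

/-- graded lifting for matrices -/
theorem lift_mat {ι κ μ : Type*} [Fintype κ] {A : Matrix ι κ (MvPolynomial (Fin n) K)}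
    {da : ι → ℤ} {db : κ → ℤ} (hA : ∀ k l, HD (A k l) (db l - da k)) {dm : μ → ℤ}
    {Y : Matrix ι μ (MvPolynomial (Fin n) K)} (hY : ∀ k j, HD (Y k j) (dm j - da k))
    (h : ∀ j, ∃ w, A *ᵥ w = fun k => Y k j) :
    ∃ W : Matrix κ μ (MvPolynomial (Fin n) K), A * W = Y ∧
      ∀ l j, HD (W l j) (dm j - db l) := by
  choose W hW hW2 using fun j => lift_vec hA (hY · j) (h j)
  refine ⟨fun l j => W j l, ?_, fun l j => hW2 j l⟩
  ext1 k j
  exact congrFun (hW j) k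

/-- graded lifting for the augmentation -/
theorem lift_aug {κ : Type*} [Fintype κ] {I : Ideal (MvPolynomial (Fin n) K)}
    (hI : ∀ z p, p ∈ I → hcmp z p ∈ I) {g : κ → MvPolynomial (Fin n) K} {db : κ → ℤ}
    (hg : ∀ l, HD (g l) (db l)) {t : ℤ} {y : MvPolynomial (Fin n) K} (hy : HD y t)
    (h : ∃ w, y - g ⬝ᵥ w ∈ I) : ∃ w, y - g ⬝ᵥ w ∈ I ∧ ∀ l, HD (w l) (t - db l) := by
  obtain ⟨w, hw⟩ := h
  refine ⟨fun l => hcmp (t - db l) (w l), ?_, fun l => hcmp_HD _ _⟩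
  have h1 : y = (y - g ⬝ᵥ w) + g ⬝ᵥ w := by ring
  have h2 := congrArg (hcmp t) h1
  rw [hy.hcmp_eq, hcmp_add] at h2
  have h3 : hcmp t (g ⬝ᵥ w) = g ⬝ᵥ (fun l => hcmp (t - db l) (w l)) := by
    simp only [dotProduct, hcmp_sum]
    exact Finset.sum_congr rfl fun l _ => hcmp_mul (hg l)
  rw [h3] at h2
  have h4 := hI t _ hw
  rw [← sub_eq_iff_eq_add] at h2
  rw [h2]
  exact h4

end HDlemmas

/-- dependent choice -/
theorem dep_choice {X : ℕ → Type*} (Q : ∀ i, X i → Prop) (R : ∀ i, X i → X (i + 1) → Prop)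
    (P0 : X 0 → Prop) (h0 : ∃ x, P0 x ∧ Q 0 x)
    (hs : ∀ i x, Q i x → ∃ y, R i x y ∧ Q (i + 1) y) :
    ∃ f : ∀ i, X i, P0 (f 0) ∧ ∀ i, Q i (f i) ∧ R i (f i) (f (i + 1)) := by
  obtain ⟨x0, hx0, hq0⟩ := h0
  choose next hnext using hs
  let F : ∀ i, {x : X i // Q i x} := fun i =>
    Nat.rec (motive := fun i => {x : X i // Q i x}) ⟨x0, hq0⟩
      (fun i x => ⟨next i x.1 x.2, (hnext i x.1 x.2).2⟩) i
  exact ⟨fun i => (F i).1, hx0, fun i => ⟨(F i).2, (hnext i (F i).1 (F i).2).1⟩⟩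

/-! ## Graded free resolutions over arbitrary finite index types -/

open Matrix in
/-- A graded free resolution of `S/I`, with arbitrary finite index types. -/
structure Res {K : Type*} [Field K] {n : ℕ} (I : Ideal (MvPolynomial (Fin n) K)) where
  ι : ℕ → Type
  fin : ∀ i, Fintype (ι i)
  dec : ∀ i, DecidableEq (ι i)
  dg : ∀ i, ι i → ℕ
  D : ∀ i, Matrix (ι i) (ι (i + 1)) (MvPolynomial (Fin n) K)
  g : ι 0 → MvPolynomial (Fin n) K
  bdd : ∃ N : ℕ, ∀ i, N < i → IsEmpty (ι i)
  g_hom : ∀ j, HD (g j) (dg 0 j)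
  D_hom : ∀ i k l, HD (D i k l) ((dg (i + 1) l : ℤ) - dg i k)
  surj : ∀ p, ∃ v, p - g ⬝ᵥ v ∈ I
  ex0 : ∀ v, g ⬝ᵥ v ∈ I ↔ ∃ w, D 0 *ᵥ w = v
  ex1 : ∀ i v, D i *ᵥ v = 0 ↔ ∃ w, D (i + 1) *ᵥ w = v

attribute [instance] Res.fin Res.dec

namespace Res
open Matrix
variable {K : Type*} [Field K] {n : ℕ} {I : Ideal (MvPolynomial (Fin n) K)}

/-- cycles -/
def Cyc (G : Res I) : ∀ i, (G.ι i → MvPolynomial (Fin n) K) → Prop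
  | 0, v => G.g ⬝ᵥ v ∈ I
  | i + 1, v => G.D i *ᵥ v = 0

theorem cyc_iff (G : Res I) (i : ℕ) (v) : G.Cyc i v ↔ ∃ w, G.D i *ᵥ w = v := by
  cases i with
  | zero => exact G.ex0 v
  | succ i => exact G.ex1 i v

theorem D_mul_D (G : Res I) (i : ℕ) : G.D i * G.D (i + 1) = 0 := by
  ext1 k l
  have := (G.ex1 i (G.D (i + 1) *ᵥ Pi.single l 1)).2 ⟨_, rfl⟩
  have h2 := congrFun this k
  rw [mulVec_mulVec] at h2
  simpa using h2

/-- coboundaries of the dual complex -/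
noncomputable def Cob (G : Res I) : ∀ i, Submodule (MvPolynomial (Fin n) K) (G.ι i → MvPolynomial (Fin n) K)
  | 0 => ⊥
  | i + 1 => LinearMap.range (Matrix.vecMulLinear (G.D i))

theorem mem_cob_zero (G : Res I) (φ) : φ ∈ G.Cob 0 ↔ φ = 0 := Submodule.mem_bot _

theorem mem_cob_succ (G : Res I) (i : ℕ) (φ) : φ ∈ G.Cob (i + 1) ↔ ∃ ψ, ψ ᵥ* G.D i = φ := by
  rfl

theorem cob_coc (G : Res I) (i : ℕ) (φ) (h : φ ∈ G.Cob i) : φ ᵥ* G.D i = 0 := by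
  cases i with
  | zero => rw [mem_cob_zero] at h; rw [h, zero_vecMul]
  | succ i =>
    obtain ⟨ψ, rfl⟩ := (G.mem_cob_succ i φ).1 h
    rw [vecMul_vecMul, D_mul_D, vecMul_zero]

theorem col_lift {R : Type*} [CommRing R] {α β γ : Type*} [Fintype β] {A : Matrix α β R}
    {Y : Matrix α γ R} (h : ∀ j, ∃ w, A *ᵥ w = fun k => Y k j) : ∃ W : Matrix β γ R, A * W = Y := by
  choose W hW using h
  refine ⟨fun l j => W j l, ?_⟩
  ext1 k j
  exact congrFun (hW j) k

theorem HD_matmul {α β γ : Type*} [Fintype β] {A : Matrix α β (MvPolynomial (Fin n) K)}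
    {B : Matrix β γ (MvPolynomial (Fin n) K)} {da : α → ℤ} {db : β → ℤ} {dc : γ → ℤ}
    (hA : ∀ k l, HD (A k l) (db l - da k)) (hB : ∀ k l, HD (B k l) (dc l - db k)) (k l) :
    HD ((A * B) k l) (dc l - da k) := by
  rw [Matrix.mul_apply]
  refine HD.sum _ fun j _ => ?_
  have := (hA k j).mul (hB j l)
  convert this using 1
  ring

theorem dot_mul_col {R : Type*} [CommRing R] {α β γ : Type*} [Fintype β] [Fintype α]
    (g : α → R) (A : Matrix α β R) (B : Matrix β γ R) (j : γ) :
    g ⬝ᵥ (fun k => (A * B) k j) = (g ᵥ* A) ⬝ᵥ (fun k => B k j) := by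
  have : (fun k => (A * B) k j) = A *ᵥ (fun k => B k j) := by
    funext k; rfl
  rw [this, dotProduct_mulVec]

theorem dot_mem {R : Type*} [CommRing R] {α : Type*} [Fintype α] {I : Ideal R} {v : α → R}
    (w : α → R) (h : ∀ k, v k ∈ I) : v ⬝ᵥ w ∈ I :=
  Ideal.sum_mem _ fun k _ => Ideal.mul_mem_right _ _ (h k)

theorem g_D (G : Res I) (j) : G.g ⬝ᵥ (fun k => G.D 0 k j) ∈ I := by
  rw [G.ex0]
  exact ⟨Pi.single j 1, by ext1 k; simp⟩

/-- comparison maps -/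
theorem exists_chain (hI : ∀ z p, p ∈ I → hcmp z p ∈ I) (G F : Res I) :
    ∃ f : ∀ i, Matrix (F.ι i) (G.ι i) (MvPolynomial (Fin n) K),
      (∀ j, G.g j - F.g ⬝ᵥ (fun k => f 0 k j) ∈ I) ∧
      (∀ i, F.D i * f (i + 1) = f i * G.D i) ∧
      ∀ i k l, HD (f i k l) ((G.dg i l : ℤ) - F.dg i k) := by
  have H := dep_choice (X := fun i => Matrix (F.ι i) (G.ι i) (MvPolynomial (Fin n) K))
    (Q := fun i f => (∀ k l, HD (f k l) ((G.dg i l : ℤ) - F.dg i k)) ∧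
      ∀ j, F.Cyc i (fun k => (f * G.D i) k j))
    (R := fun i f f' => F.D i * f' = f * G.D i)
    (P0 := fun f => ∀ j, G.g j - F.g ⬝ᵥ (fun k => f k j) ∈ I)
  refine Exists.elim (H ?_ ?_) ?_
  rotate_left 2
  · rintro f ⟨h0, hf⟩
    exact ⟨f, h0, fun i => (hf i).2, fun i => (hf i).1.1⟩
  · choose f hf hf2 using fun j => lift_aug hI F.g_hom (G.g_hom j) (F.surj (G.g j))
    refine ⟨fun k j => f j k, hf, fun k l => hf2 l k, fun j => ?_⟩
    change F.g ⬝ᵥ (fun k => ((Matrix.of fun k j => f j k) * G.D 0) k j) ∈ I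
    rw [dot_mul_col]
    have h1 := G.g_D j
    have h2 : (G.g - (F.g ᵥ* (Matrix.of fun k j => f j k))) ⬝ᵥ (fun k => G.D 0 k j) ∈ I :=
      dot_mem _ fun k => hf k
    rw [sub_dotProduct] at h2
    have := I.sub_mem h1 h2
    simpa using this
  · rintro i f ⟨hf1, hf2⟩
    obtain ⟨W, hW, hW2⟩ := lift_mat (F.D_hom i) (Y := f * G.D i) (dm := fun j => (G.dg (i+1) j : ℤ))
      (HD_matmul hf1 (G.D_hom i)) (fun j => (F.cyc_iff i _).1 (hf2 j))
    refine ⟨W, hW, hW2, fun j => ?_⟩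
    change F.D i *ᵥ (fun k => (W * G.D (i + 1)) k j) = 0
    have : F.D i * (W * G.D (i + 1)) = 0 := by
      rw [← Matrix.mul_assoc, hW, Matrix.mul_assoc, D_mul_D, Matrix.mul_zero]
    funext k
    exact congrFun (congrFun this k) j

/-- null-homotopy -/
theorem exists_homotopy (G : Res I) (e : ∀ i, Matrix (G.ι i) (G.ι i) (MvPolynomial (Fin n) K))
    (h0 : ∀ j, G.g ⬝ᵥ (fun k => e 0 k j) ∈ I) (he : ∀ i, G.D i * e (i + 1) = e i * G.D i) :
    ∃ h : ∀ i, Matrix (G.ι (i + 1)) (G.ι i) (MvPolynomial (Fin n) K),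
      e 0 = G.D 0 * h 0 ∧ ∀ i, e (i + 1) = G.D (i + 1) * h (i + 1) + h i * G.D i := by
  have H := dep_choice
    (X := fun i => Matrix (G.ι (i + 1)) (G.ι i) (MvPolynomial (Fin n) K))
    (Q := fun i h => G.D i * h * G.D i = e i * G.D i)
    (R := fun i h h' => e (i + 1) = G.D (i + 1) * h' + h * G.D i)
    (P0 := fun h => e 0 = G.D 0 * h)
  refine Exists.elim (H ?_ ?_) ?_
  rotate_left 2
  · rintro h ⟨hh0, hh⟩
    exact ⟨h, hh0, fun i => (hh i).2⟩
  · obtain ⟨W, hW⟩ := col_lift (A := G.D 0) (Y := e 0) fun j => (G.ex0 _).1 (h0 j)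
    exact ⟨W, hW.symm, by rw [hW]⟩
  · intro i h hQ
    have hz : G.D i * (e (i + 1) - h * G.D i) = 0 := by
      rw [Matrix.mul_sub, he, ← Matrix.mul_assoc, hQ, sub_self]
    obtain ⟨W, hW⟩ := col_lift (A := G.D (i + 1)) (Y := e (i + 1) - h * G.D i) fun j =>
      (G.ex1 i _).1 (by funext k; exact congrFun (congrFun hz k) j)
    refine ⟨W, by rw [hW]; abel, ?_⟩
    rw [hW, Matrix.sub_mul, Matrix.mul_assoc, D_mul_D, Matrix.mul_zero, sub_zero]

theorem bound (hI : ∀ z p, p ∈ I → hcmp z p ∈ I) (G F : Res I) (c : ℕ) (s : ℤ)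
    (φ : G.ι c → MvPolynomial (Fin n) K) (hφ : φ ᵥ* G.D c = 0)
    (hdeg : ∀ j, HD (φ j) ((G.dg c j : ℤ) - s)) (hnc : φ ∉ G.Cob c) :
    ∃ l, s ≤ (F.dg c l : ℤ) := by
  by_contra! hlt
  obtain ⟨f, f0, f1, -⟩ := exists_chain hI G F
  obtain ⟨g, g0, g1, g2⟩ := exists_chain hI F G
  obtain ⟨h, h0, h1⟩ := exists_homotopy G (fun i => g i * f i - 1) (by
    intro j
    have e1 : (fun k => (g 0 * f 0 - (1 : Matrix (G.ι 0) (G.ι 0) (MvPolynomial (Fin n) K))) k j) = (fun k => (g 0 * f 0) k j) - Pi.single j 1 := by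
      funext k; simp [Matrix.sub_apply, Matrix.one_apply, Pi.single_apply]
    rw [e1, dotProduct_sub, dot_mul_col]
    have e2 : (F.g - (G.g ᵥ* g 0)) ⬝ᵥ (fun k => f 0 k j) ∈ I := dot_mem _ fun k => g0 k
    rw [sub_dotProduct] at e2
    have e3 := f0 j
    have := I.neg_mem (I.add_mem e2 e3)
    simpa using this) (by
    intro i
    rw [Matrix.mul_sub, Matrix.sub_mul, ← Matrix.mul_assoc, g1, Matrix.mul_assoc, f1,
      Matrix.mul_assoc, Matrix.mul_one, Matrix.one_mul])
  have hz : φ ᵥ* g c = 0 := by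
    funext l
    refine HD.eq_zero_of_neg (z := (F.dg c l : ℤ) - s) ?_ (by have := hlt l; omega)
    refine HD.sum _ fun k _ => ?_
    have := (hdeg k).mul (g2 c k l)
    convert this using 1
    ring
  have he : φ ᵥ* (g c * f c - 1) = -φ := by
    rw [vecMul_sub, ← vecMul_vecMul, hz]; simp
  apply hnc
  cases c with
  | zero =>
    rw [mem_cob_zero]
    rw [h0, ← vecMul_vecMul, hφ] at he
    simpa using he.symm
  | succ c =>
    rw [mem_cob_succ]
    rw [h1, vecMul_add, ← vecMul_vecMul, ← vecMul_vecMul, hφ] at he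
    refine ⟨-(φ ᵥ* h c), ?_⟩
    rw [neg_vecMul]
    simpa using congrArg Neg.neg he

end Res

/-! ## The horseshoe resolution -/

namespace Res
open Matrix
variable {K : Type*} [Field K] {n : ℕ} {I J₁ J₂ : Ideal (MvPolynomial (Fin n) K)}

theorem g_D_HD (B : Res J₂) (l) : HD (B.g ⬝ᵥ (fun k => B.D 0 k l)) (B.dg 1 l : ℤ) := by
  refine HD.sum _ fun k _ => ?_
  have := (B.g_hom k).mul (B.D_hom 0 k l)
  convert this using 1
  simp

/-- The data of a horseshoe. -/
structure Theta (u : MvPolynomial (Fin n) K) (d : ℕ) (I : Ideal (MvPolynomial (Fin n) K))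
    (A : Res J₁) (B : Res J₂) where
  θ : ∀ i, Matrix (A.ι i) (B.ι (i + 1)) (MvPolynomial (Fin n) K)
  h0 : ∀ l, u * (A.g ⬝ᵥ (fun k => θ 0 k l)) + B.g ⬝ᵥ (fun k => B.D 0 k l) ∈ I
  h1 : ∀ i, A.D i * θ (i + 1) + θ i * B.D (i + 1) = 0
  deg : ∀ i k l, HD (θ i k l) ((B.dg (i + 1) l : ℤ) - ((A.dg i k + d : ℕ) : ℤ))

theorem exists_theta (u : MvPolynomial (Fin n) K) (d : ℕ) (hu : HD u d)
    (hI : ∀ z p, p ∈ I → hcmp z p ∈ I) (hJ : ∀ z p, p ∈ J₁ → hcmp z p ∈ J₁)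
    (hJ₁ : ∀ p, u * p ∈ I ↔ p ∈ J₁) (hJ₂ : ∀ p, p ∈ J₂ ↔ ∃ s, p - u * s ∈ I)
    (A : Res J₁) (B : Res J₂) : Nonempty (Theta u d I A B) := by
  have H := dep_choice (X := fun i => Matrix (A.ι i) (B.ι (i + 1)) (MvPolynomial (Fin n) K))
    (Q := fun i θ => (∀ k l, HD (θ k l) ((B.dg (i + 1) l : ℤ) - ((A.dg i k + d : ℕ) : ℤ))) ∧
      ∀ j, A.Cyc i (fun k => (θ * B.D (i + 1)) k j))
    (R := fun i θ θ' => A.D i * θ' + θ * B.D (i + 1) = 0)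
    (P0 := fun θ => ∀ l, u * (A.g ⬝ᵥ (fun k => θ k l)) + B.g ⬝ᵥ (fun k => B.D 0 k l) ∈ I)
  refine Exists.elim (H ?_ ?_) ?_
  rotate_left 2
  · rintro θ ⟨h0, hθ⟩
    exact ⟨⟨θ, h0, fun i => (hθ i).2, fun i => (hθ i).1.1⟩⟩
  · have key : ∀ l, ∃ w : A.ι 0 → MvPolynomial (Fin n) K,
        u * (A.g ⬝ᵥ w) + B.g ⬝ᵥ (fun k => B.D 0 k l) ∈ I ∧
        ∀ k, HD (w k) ((B.dg 1 l : ℤ) - ((A.dg 0 k + d : ℕ) : ℤ)) := by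
      intro l
      obtain ⟨s0, hs0⟩ := (hJ₂ _).1 (B.g_D l)
      obtain ⟨s, hs, hsd⟩ := lift_aug (κ := Unit) hI (g := fun _ => u) (db := fun _ => (d : ℤ))
        (fun _ => hu) (B.g_D_HD l) ⟨fun _ => s0, by simpa [dotProduct] using hs0⟩
      obtain ⟨w, hw, hwd⟩ := lift_aug hJ A.g_hom (hsd ()).neg (A.surj _)
      refine ⟨w, ?_, fun k => ?_⟩
      · have h1 := (hJ₁ _).2 hw
        have h2 : B.g ⬝ᵥ (fun k => B.D 0 k l) - u * s () ∈ I := by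
          simpa [dotProduct] using hs
        have := I.sub_mem h2 h1
        convert this using 1
        ring
      · convert hwd k using 1
        push_cast; ring
    choose w hw hwd using key
    refine ⟨fun k l => w l k, hw, fun k l => hwd l k, fun j => ?_⟩
    change A.g ⬝ᵥ (fun k => ((Matrix.of fun k l => w l k) * B.D (0 + 1)) k j) ∈ J₁
    rw [dot_mul_col, ← hJ₁]
    have h2 : (u • (A.g ᵥ* (Matrix.of fun k l => w l k)) + B.g ᵥ* B.D 0) ⬝ᵥ
      (fun k => B.D (0 + 1) k j) ∈ I := dot_mem _ fun k => hw k
    rw [add_dotProduct, ← dot_mul_col B.g, D_mul_D] at h2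
    simpa using h2
  · rintro i θ ⟨hf1, hf2⟩
    have hd : ∀ k l, HD ((-(θ * B.D (i + 1))) k l)
        ((B.dg (i + 1 + 1) l : ℤ) - ((A.dg i k + d : ℕ) : ℤ)) := fun k l =>
      (HD_matmul hf1 (B.D_hom (i + 1)) k l).neg
    obtain ⟨W, hW, hW2⟩ := lift_mat (A := A.D i) (da := fun k => ((A.dg i k + d : ℕ) : ℤ))
      (db := fun k => ((A.dg (i + 1) k + d : ℕ) : ℤ))
      (by intro k l; convert A.D_hom i k l using 1; push_cast; ring)
      (Y := -(θ * B.D (i + 1))) (dm := fun j => (B.dg (i + 1 + 1) j : ℤ)) hd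
      (fun j => by
        obtain ⟨w, hw⟩ := (A.cyc_iff i _).1 (hf2 j)
        refine ⟨-w, ?_⟩
        rw [mulVec_neg, hw]; rfl)
    refine ⟨W, by rw [hW]; abel, hW2, fun j => ?_⟩
    change A.D i *ᵥ (fun k => (W * B.D (i + 1 + 1)) k j) = 0
    have : A.D i * (W * B.D (i + 1 + 1)) = 0 := by
      rw [← Matrix.mul_assoc, hW, Matrix.neg_mul, Matrix.mul_assoc, D_mul_D, Matrix.mul_zero,
        neg_zero]
    funext k
    exact congrFun (congrFun this k) j

theorem elim_eta {α β γ : Type*} (v : α ⊕ β → γ) : Sum.elim (v ∘ Sum.inl) (v ∘ Sum.inr) = v := by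
  funext x; cases x <;> rfl

theorem elim_eq_zero {α β R : Type*} [Zero R] (f : α → R) (g : β → R) :
    Sum.elim f g = 0 ↔ f = 0 ∧ g = 0 := by
  constructor
  · intro h
    exact ⟨funext fun x => congrFun h (Sum.inl x), funext fun x => congrFun h (Sum.inr x)⟩
  · rintro ⟨rfl, rfl⟩; funext x; cases x <;> rfl

theorem blk_mulVec {R : Type*} [CommRing R] {α β γ δ : Type*} [Fintype γ] [Fintype δ]
    (A : Matrix α γ R) (T : Matrix α δ R) (B : Matrix β δ R) (v : γ → R) (w : δ → R) :
    fromBlocks A T 0 B *ᵥ Sum.elim v w = Sum.elim (A *ᵥ v + T *ᵥ w) (B *ᵥ w) := by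
  rw [fromBlocks_mulVec]; simp

theorem blk_vecMul {R : Type*} [CommRing R] {α β γ δ : Type*} [Fintype α] [Fintype β]
    (A : Matrix α γ R) (T : Matrix α δ R) (B : Matrix β δ R) (v : α → R) (w : β → R) :
    Sum.elim v w ᵥ* fromBlocks A T 0 B = Sum.elim (v ᵥ* A) (v ᵥ* T + w ᵥ* B) := by
  rw [vecMul_fromBlocks]; simp

theorem dot_mulVec_mem {R : Type*} [CommRing R] {α β : Type*} [Fintype α] [Fintype β]
    {I : Ideal R} (g : α → R) (A : Matrix α β R) (h : ∀ l, g ⬝ᵥ (fun k => A k l) ∈ I) (w : β → R) :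
    g ⬝ᵥ (A *ᵥ w) ∈ I := by
  rw [dotProduct_mulVec]
  exact dot_mem _ h

/-- The horseshoe resolution. -/
noncomputable def shoe {u : MvPolynomial (Fin n) K} {d : ℕ} (hu : HD u d)
    (hJ₁ : ∀ p, u * p ∈ I ↔ p ∈ J₁) (hJ₂ : ∀ p, p ∈ J₂ ↔ ∃ s, p - u * s ∈ I)
    {A : Res J₁} {B : Res J₂} (T : Theta u d I A B) : Res I where
  ι i := A.ι i ⊕ B.ι i
  fin i := inferInstance
  dec i := inferInstance
  dg i := Sum.elim (fun k => A.dg i k + d) (B.dg i)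
  D i := fromBlocks (A.D i) (T.θ i) 0 (B.D i)
  g := Sum.elim (u • A.g) B.g
  bdd := by
    obtain ⟨N, hN⟩ := A.bdd
    obtain ⟨M, hM⟩ := B.bdd
    refine ⟨max N M, fun i hi => ?_⟩
    have := hN i (by omega)
    have := hM i (by omega)
    infer_instance
  g_hom j := by
    rcases j with j | j
    · have := hu.mul (A.g_hom j)
      simp only [Sum.elim_inl, Pi.smul_apply, smul_eq_mul]
      convert this using 1
      push_cast; ring
    · exact B.g_hom j
  D_hom i k l := by
    rcases k with k | k <;> rcases l with l | l
    · simp only [Sum.elim_inl, fromBlocks_apply₁₁]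
      convert A.D_hom i k l using 1
      push_cast; ring
    · exact T.deg i k l
    · simpa using HD.zero _
    · exact B.D_hom i k l
  surj p := by
    obtain ⟨v, hv⟩ := B.surj p
    obtain ⟨s, hs⟩ := (hJ₂ _).1 hv
    obtain ⟨w, hw⟩ := A.surj s
    refine ⟨Sum.elim w v, ?_⟩
    rw [sumElim_dotProduct_sumElim, smul_dotProduct, smul_eq_mul]
    have := I.add_mem hs ((hJ₁ _).2 hw)
    convert this using 1
    ring
  ex0 v := by
    rw [← elim_eta v]
    generalize v ∘ Sum.inl = v₁
    generalize v ∘ Sum.inr = v₂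
    have hD : ∀ w₁ w₂, Sum.elim (u • A.g) B.g ⬝ᵥ
        (fromBlocks (A.D 0) (T.θ 0) 0 (B.D 0) *ᵥ Sum.elim w₁ w₂) ∈ I := by
      intro w₁ w₂
      apply dot_mulVec_mem
      rintro (l | l)
      · have h1 := (hJ₁ _).2 (A.g_D l)
        have : (fun k => fromBlocks (A.D 0) (T.θ 0) 0 (B.D 0) k (Sum.inl l)) =
          Sum.elim (fun k => A.D 0 k l) (0 : B.ι 0 → _) := by
          funext k; cases k <;> rfl
        rw [this, sumElim_dotProduct_sumElim, smul_dotProduct]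
        simpa using h1
      · have h1 := T.h0 l
        have : (fun k => fromBlocks (A.D 0) (T.θ 0) 0 (B.D 0) k (Sum.inr l)) =
          Sum.elim (fun k => T.θ 0 k l) (fun k => B.D 0 k l) := by
          funext k; cases k <;> rfl
        rw [this, sumElim_dotProduct_sumElim, smul_dotProduct]
        simpa using h1
    constructor
    · intro h
      have h2 : B.g ⬝ᵥ v₂ ∈ J₂ := by
        rw [hJ₂]
        refine ⟨-(A.g ⬝ᵥ v₁), ?_⟩
        rw [sumElim_dotProduct_sumElim, smul_dotProduct, smul_eq_mul] at h
        convert h using 1; ring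
      obtain ⟨w₂, rfl⟩ := (B.ex0 _).1 h2
      have h3 := I.sub_mem h (hD 0 w₂)
      rw [blk_mulVec, sumElim_dotProduct_sumElim, sumElim_dotProduct_sumElim, smul_dotProduct,
        smul_dotProduct, smul_eq_mul, smul_eq_mul, mulVec_zero, zero_add (T.θ 0 *ᵥ w₂)] at h3
      have h4 : A.g ⬝ᵥ (v₁ - T.θ 0 *ᵥ w₂) ∈ J₁ := by
        rw [← hJ₁, dotProduct_sub]
        convert h3 using 1; ring
      obtain ⟨w₁, hw₁⟩ := (A.ex0 _).1 h4
      refine ⟨Sum.elim w₁ w₂, ?_⟩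
      rw [blk_mulVec, hw₁]; simp
    · rintro ⟨w, hw⟩
      rw [← hw, ← elim_eta w]
      exact hD _ _
  ex1 i v := by
    rw [← elim_eta v]
    generalize v ∘ Sum.inl = v₁
    generalize v ∘ Sum.inr = v₂
    constructor
    · intro h
      rw [blk_mulVec, elim_eq_zero] at h
      obtain ⟨w₂, rfl⟩ := (B.ex1 _ _).1 h.2
      have h4 : A.D i *ᵥ (v₁ - T.θ (i + 1) *ᵥ w₂) = 0 := by
        have h5 := h.1
        have h6 := congrArg (fun M => M *ᵥ w₂) (T.h1 i)
        simp only [add_mulVec, zero_mulVec, ← mulVec_mulVec] at h6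
        rw [mulVec_sub, eq_neg_of_add_eq_zero_left h6, eq_neg_of_add_eq_zero_left h5, sub_self]
      obtain ⟨w₁, hw₁⟩ := (A.ex1 _ _).1 h4
      refine ⟨Sum.elim w₁ w₂, ?_⟩
      rw [blk_mulVec, hw₁]; simp
    · rintro ⟨w, hw⟩
      rw [← hw, mulVec_mulVec, fromBlocks_multiply, A.D_mul_D, B.D_mul_D, T.h1]
      simp

end Res

/-! ## Splitting of the dual long exact sequence -/

/-- number of variables in `P` -/
noncomputable def htv {K : Type*} [Field K] {n : ℕ} (P : Ideal (MvPolynomial (Fin n) K)) : ℕ :=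
  Set.ncard {i : Fin n | (X i : MvPolynomial (Fin n) K) ∈ P}

namespace Res
open Matrix
variable {K : Type*} [Field K] {n : ℕ} {I J₁ J₂ : Ideal (MvPolynomial (Fin n) K)}

/-- torsion-freeness of the dual cohomology -/
def Tors (G : Res I) (Ps : Set (Ideal (MvPolynomial (Fin n) K))) : Prop :=
  ∀ (c : ℕ) (J : Ideal (MvPolynomial (Fin n) K)), (∀ P ∈ Ps, htv P = c → ¬ J ≤ P) →
    ∀ φ, φ ᵥ* G.D c = 0 → (∀ s ∈ J, s • φ ∈ G.Cob c) → φ ∈ G.Cob c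

/-- annihilators of the dual cohomology -/
def Ann (G : Res I) (Ps : Set (Ideal (MvPolynomial (Fin n) K))) : Prop :=
  ∀ c : ℕ, ∃ J : Ideal (MvPolynomial (Fin n) K),
    (∀ s ∈ J, ∀ φ, φ ᵥ* G.D c = 0 → s • φ ∈ G.Cob c) ∧
    ∀ Q : Ideal (MvPolynomial (Fin n) K), Q.IsPrime →
      (∀ P ∈ Ps, htv P = c → ¬ P ≤ Q) → ¬ J ≤ Q

/-- extremal nonvanishing class -/
def NV (G : Res I) (r : ℕ) : Prop :=
  ∃ (c : ℕ) (φ : G.ι c → MvPolynomial (Fin n) K), φ ᵥ* G.D c = 0 ∧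
    (∀ j, HD (φ j) ((G.dg c j : ℤ) - ((r + c : ℕ) : ℤ))) ∧ φ ∉ G.Cob c

section
variable {u : MvPolynomial (Fin n) K} {d : ℕ} (hu : HD u d)
    (hJ₁ : ∀ p, u * p ∈ I ↔ p ∈ J₁) (hJ₂ : ∀ p, p ∈ J₂ ↔ ∃ s, p - u * s ∈ I)
    {A : Res J₁} {B : Res J₂} (T : Theta u d I A B)

/-- cochains on the horseshoe -/
def sE (c : ℕ) (φ₁ : A.ι c → MvPolynomial (Fin n) K) (φ₂ : B.ι c → MvPolynomial (Fin n) K) :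
    (shoe hu hJ₁ hJ₂ T).ι c → MvPolynomial (Fin n) K := Sum.elim φ₁ φ₂

theorem sE_surj (c : ℕ) (φ) : ∃ φ₁ φ₂, φ = sE hu hJ₁ hJ₂ T c φ₁ φ₂ :=
  ⟨φ ∘ Sum.inl, φ ∘ Sum.inr, (elim_eta φ).symm⟩

theorem sE_smul (c : ℕ) (s : MvPolynomial (Fin n) K) (φ₁ φ₂) :
    s • sE hu hJ₁ hJ₂ T c φ₁ φ₂ = sE hu hJ₁ hJ₂ T c (s • φ₁) (s • φ₂) := by
  funext x; cases x <;> rfl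

theorem sE_add (c : ℕ) (φ₁ φ₂ ψ₁ ψ₂) :
    sE hu hJ₁ hJ₂ T c φ₁ φ₂ + sE hu hJ₁ hJ₂ T c ψ₁ ψ₂ =
      sE hu hJ₁ hJ₂ T c (φ₁ + ψ₁) (φ₂ + ψ₂) := by
  funext x; cases x <;> rfl

theorem sE_sub (c : ℕ) (φ₁ φ₂ ψ₁ ψ₂) :
    sE hu hJ₁ hJ₂ T c φ₁ φ₂ - sE hu hJ₁ hJ₂ T c ψ₁ ψ₂ =
      sE hu hJ₁ hJ₂ T c (φ₁ - ψ₁) (φ₂ - ψ₂) := by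
  funext x; cases x <;> rfl

theorem sE_coc (c : ℕ) (φ₁ φ₂) : sE hu hJ₁ hJ₂ T c φ₁ φ₂ ᵥ* (shoe hu hJ₁ hJ₂ T).D c = 0 ↔
    φ₁ ᵥ* A.D c = 0 ∧ φ₁ ᵥ* T.θ c + φ₂ ᵥ* B.D c = 0 := by
  change Sum.elim φ₁ φ₂ ᵥ* fromBlocks (A.D c) (T.θ c) 0 (B.D c) = 0 ↔ _
  rw [blk_vecMul, elim_eq_zero]

theorem sE_cob_zero (φ₁ φ₂) : sE hu hJ₁ hJ₂ T 0 φ₁ φ₂ ∈ (shoe hu hJ₁ hJ₂ T).Cob 0 ↔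
    φ₁ = 0 ∧ φ₂ = 0 := by
  rw [mem_cob_zero]
  exact elim_eq_zero _ _

theorem sE_cob_succ (c : ℕ) (φ₁ φ₂) :
    sE hu hJ₁ hJ₂ T (c + 1) φ₁ φ₂ ∈ (shoe hu hJ₁ hJ₂ T).Cob (c + 1) ↔
    ∃ ψ₁ ψ₂, ψ₁ ᵥ* A.D c = φ₁ ∧ ψ₁ ᵥ* T.θ c + ψ₂ ᵥ* B.D c = φ₂ := by
  rw [mem_cob_succ]
  have key : ∀ ψ₁ ψ₂, sE hu hJ₁ hJ₂ T c ψ₁ ψ₂ ᵥ* (shoe hu hJ₁ hJ₂ T).D c =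
      sE hu hJ₁ hJ₂ T (c + 1) φ₁ φ₂ ↔ (ψ₁ ᵥ* A.D c = φ₁ ∧ ψ₁ ᵥ* T.θ c + ψ₂ ᵥ* B.D c = φ₂) := by
    intro ψ₁ ψ₂
    change Sum.elim ψ₁ ψ₂ ᵥ* fromBlocks (A.D c) (T.θ c) 0 (B.D c) = Sum.elim φ₁ φ₂ ↔ _
    rw [blk_vecMul]
    constructor
    · intro h
      exact ⟨funext fun x => congrFun h (Sum.inl x), funext fun x => congrFun h (Sum.inr x)⟩
    · rintro ⟨h1, h2⟩
      rw [h1, h2]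
  constructor
  · rintro ⟨ψ, hψ⟩
    obtain ⟨ψ₁, ψ₂, rfl⟩ := sE_surj hu hJ₁ hJ₂ T c ψ
    exact ⟨ψ₁, ψ₂, (key _ _).1 hψ⟩
  · rintro ⟨ψ₁, ψ₂, h⟩
    exact ⟨_, (key ψ₁ ψ₂).2 h⟩

theorem sE_cob_inl (c : ℕ) (φ₁ φ₂) (h : sE hu hJ₁ hJ₂ T c φ₁ φ₂ ∈ (shoe hu hJ₁ hJ₂ T).Cob c) :
    φ₁ ∈ A.Cob c := by
  cases c with
  | zero => rw [sE_cob_zero] at h; rw [mem_cob_zero]; exact h.1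
  | succ c =>
    rw [sE_cob_succ] at h
    obtain ⟨ψ₁, -, h, -⟩ := h
    rw [mem_cob_succ]; exact ⟨ψ₁, h⟩

theorem sE_cob_lift (c : ℕ) (φ₁) (h : φ₁ ∈ A.Cob c) :
    ∃ φ₂, sE hu hJ₁ hJ₂ T c φ₁ φ₂ ∈ (shoe hu hJ₁ hJ₂ T).Cob c := by
  cases c with
  | zero =>
    rw [mem_cob_zero] at h
    exact ⟨0, by rw [sE_cob_zero]; exact ⟨h, rfl⟩⟩
  | succ c =>
    rw [mem_cob_succ] at h
    obtain ⟨ψ, h⟩ := h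
    exact ⟨ψ ᵥ* T.θ c, by rw [sE_cob_succ]; exact ⟨ψ, 0, h, by simp⟩⟩

theorem sE_cob_inr (c : ℕ) (φ₂) (h : φ₂ ∈ B.Cob c) :
    sE hu hJ₁ hJ₂ T c 0 φ₂ ∈ (shoe hu hJ₁ hJ₂ T).Cob c := by
  cases c with
  | zero =>
    rw [mem_cob_zero] at h
    rw [sE_cob_zero]; exact ⟨rfl, h⟩
  | succ c =>
    rw [mem_cob_succ] at h
    obtain ⟨ψ, h⟩ := h
    rw [sE_cob_succ]; exact ⟨0, ψ, by simp, by simpa using h⟩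

theorem theta_coc (c : ℕ) (φ₁) (h : φ₁ ᵥ* A.D c = 0) : (φ₁ ᵥ* T.θ c) ᵥ* B.D (c + 1) = 0 := by
  have h6 := congrArg (fun M => φ₁ ᵥ* M) (T.h1 c)
  simp only [vecMul_add, vecMul_zero, ← vecMul_vecMul, h, zero_vecMul, zero_add] at h6
  exact h6

theorem theta_cob (c : ℕ) (φ₁) (h : φ₁ ∈ A.Cob c) : φ₁ ᵥ* T.θ c ∈ B.Cob (c + 1) := by
  cases c with
  | zero =>
    rw [mem_cob_zero] at h
    rw [h, zero_vecMul]; exact Submodule.zero_mem _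
  | succ c =>
    rw [mem_cob_succ] at h
    obtain ⟨ψ, rfl⟩ := h
    rw [mem_cob_succ]
    have h6 := congrArg (fun M => ψ ᵥ* M) (T.h1 c)
    simp only [vecMul_add, vecMul_zero, ← vecMul_vecMul] at h6
    refine ⟨-(ψ ᵥ* T.θ c), ?_⟩
    rw [neg_vecMul]
    exact (eq_neg_of_add_eq_zero_left h6).symm

/-- the connecting map vanishes -/
theorem theta_split {P₁ P₂ : Set (Ideal (MvPolynomial (Fin n) K))} (hA : A.Ann P₁) (hB : B.Tors P₂)
    (hpr : ∀ Q ∈ P₂, Q.IsPrime) (hinc : ∀ P ∈ P₁, ∀ Q ∈ P₂, P ≤ Q → P = Q)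
    (c : ℕ) (φ₁) (h : φ₁ ᵥ* A.D c = 0) : φ₁ ᵥ* T.θ c ∈ B.Cob (c + 1) := by
  obtain ⟨J, hJ, hJ'⟩ := hA c
  refine hB (c + 1) J ?_ _ (theta_coc T c φ₁ h) ?_
  · intro Q hQ hc
    refine hJ' Q (hpr Q hQ) fun P hP hPc hle => ?_
    have := hinc P hP Q hQ hle
    rw [this] at hPc
    omega
  · intro s hs
    have := theta_cob T c _ (hJ s hs φ₁ h)
    rwa [smul_vecMul] at this

section split

theorem sE_cob_inr_inv
    (Z : ∀ c φ₁, φ₁ ᵥ* A.D c = 0 → φ₁ ᵥ* T.θ c ∈ B.Cob (c + 1))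
    (c : ℕ) (φ₂)
    (h : sE hu hJ₁ hJ₂ T c 0 φ₂ ∈ (shoe hu hJ₁ hJ₂ T).Cob c) : φ₂ ∈ B.Cob c := by
  cases c with
  | zero =>
    rw [sE_cob_zero] at h
    rw [mem_cob_zero]; exact h.2
  | succ c =>
    rw [sE_cob_succ] at h
    obtain ⟨ψ₁, ψ₂, h1, rfl⟩ := h
    exact Submodule.add_mem _ (Z c ψ₁ h1) ((B.mem_cob_succ c _).2 ⟨ψ₂, rfl⟩)

/-- reduction of a cocycle whose first part is a coboundary -/
theorem reduce
    (Z : ∀ c φ₁, φ₁ ᵥ* A.D c = 0 → φ₁ ᵥ* T.θ c ∈ B.Cob (c + 1))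
    (c : ℕ) (φ₁ φ₂)
    (h : sE hu hJ₁ hJ₂ T c φ₁ φ₂ ᵥ* (shoe hu hJ₁ hJ₂ T).D c = 0) (h1 : φ₁ ∈ A.Cob c) :
    ∃ ψ, ψ ᵥ* B.D c = 0 ∧ sE hu hJ₁ hJ₂ T c φ₁ φ₂ - sE hu hJ₁ hJ₂ T c 0 ψ ∈
      (shoe hu hJ₁ hJ₂ T).Cob c := by
  obtain ⟨χ, hχ⟩ := sE_cob_lift hu hJ₁ hJ₂ T c φ₁ h1
  refine ⟨φ₂ - χ, ?_, ?_⟩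
  · have h2 := cob_coc _ _ _ hχ
    rw [sE_coc] at h h2
    have h3 := h.2
    rw [← h2.2] at h3
    rw [sub_vecMul, sub_eq_zero]
    exact add_left_cancel h3
  · rw [sE_sub, sub_zero, sub_sub_cancel]
    exact hχ

theorem shoe_tors
    (Z : ∀ c φ₁, φ₁ ᵥ* A.D c = 0 → φ₁ ᵥ* T.θ c ∈ B.Cob (c + 1))
    {P₁ P₂ : Set (Ideal (MvPolynomial (Fin n) K))} (hA : A.Tors P₁)
    (hB : B.Tors P₂) : (shoe hu hJ₁ hJ₂ T).Tors (P₁ ∪ P₂) := by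
  intro c J hJ φ hφ hs
  obtain ⟨φ₁, φ₂, rfl⟩ := sE_surj hu hJ₁ hJ₂ T c φ
  have h1 : φ₁ ∈ A.Cob c := by
    refine hA c J (fun P hP => hJ P (Or.inl hP)) φ₁ ((sE_coc _ _ _ _ _ _ _).1 hφ).1 fun s hs' => ?_
    have := hs s hs'
    rw [sE_smul] at this
    exact sE_cob_inl _ _ _ _ _ _ _ this
  obtain ⟨ψ, hψ, hd⟩ := reduce hu hJ₁ hJ₂ T Z c φ₁ φ₂ hφ h1
  have h2 : ψ ∈ B.Cob c := by
    refine hB c J (fun P hP => hJ P (Or.inr hP)) ψ hψ fun s hs' => ?_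
    have h3 := Submodule.sub_mem _ (hs s hs') (Submodule.smul_mem _ s hd)
    rw [← smul_sub, sub_sub_cancel, sE_smul, smul_zero] at h3
    exact sE_cob_inr_inv _ _ _ _ Z _ _ h3
  have h4 := Submodule.add_mem _ hd (sE_cob_inr hu hJ₁ hJ₂ T c ψ h2)
  rwa [sub_add_cancel] at h4

theorem shoe_ann
    (Z : ∀ c φ₁, φ₁ ᵥ* A.D c = 0 → φ₁ ᵥ* T.θ c ∈ B.Cob (c + 1))
    {P₁ P₂ : Set (Ideal (MvPolynomial (Fin n) K))} (hA : A.Ann P₁)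
    (hB : B.Ann P₂) : (shoe hu hJ₁ hJ₂ T).Ann (P₁ ∪ P₂) := by
  intro c
  obtain ⟨J, hJ, hJ'⟩ := hA c
  obtain ⟨L, hL, hL'⟩ := hB c
  refine ⟨L * J, ?_, ?_⟩
  · intro s hs φ hφ
    obtain ⟨φ₁, φ₂, rfl⟩ := sE_surj hu hJ₁ hJ₂ T c φ
    induction hs using Submodule.mul_induction_on' with
    | mem_mul_mem l hl j hj =>
      have hj1 := hJ j hj φ₁ ((sE_coc _ _ _ _ _ _ _).1 hφ).1
      have hφ' : sE hu hJ₁ hJ₂ T c (j • φ₁) (j • φ₂) ᵥ* (shoe hu hJ₁ hJ₂ T).D c = 0 := by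
        rw [← sE_smul, smul_vecMul, hφ, smul_zero]
      obtain ⟨ψ, hψ, hd⟩ := reduce hu hJ₁ hJ₂ T Z c _ _ hφ' hj1
      have h4 := Submodule.add_mem _ (Submodule.smul_mem _ l hd)
        (sE_cob_inr hu hJ₁ hJ₂ T c _ (hL l hl ψ hψ))
      rw [smul_sub, sE_smul _ _ _ _ _ l 0, smul_zero, sub_add_cancel, ← sE_smul] at h4
      rwa [smul_smul] at h4
    | add x _ y _ hx hy =>
      rw [add_smul]
      exact Submodule.add_mem _ hx hy
  · intro Q hQ hP hle
    rcases hQ.mul_le.1 hle with h | h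
    · exact hL' Q hQ (fun P hP' => hP P (Or.inr hP')) h
    · exact hJ' Q hQ (fun P hP' => hP P (Or.inl hP')) h

theorem shoe_nv_right
    (Z : ∀ c φ₁, φ₁ ᵥ* A.D c = 0 → φ₁ ᵥ* T.θ c ∈ B.Cob (c + 1))
    {r : ℕ} (h : B.NV r) : (shoe hu hJ₁ hJ₂ T).NV r := by
  obtain ⟨c, φ, h1, h2, h3⟩ := h
  refine ⟨c, sE hu hJ₁ hJ₂ T c 0 φ, ?_, ?_, fun h4 => h3 (sE_cob_inr_inv _ _ _ _ Z _ _ h4)⟩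
  · rw [sE_coc]
    exact ⟨by simp, by simpa using h1⟩
  · rintro (j | j)
    · exact HD.zero _
    · exact h2 j

theorem shoe_nv_left
    (Z : ∀ c φ₁, φ₁ ᵥ* A.D c = 0 → φ₁ ᵥ* T.θ c ∈ B.Cob (c + 1))
    {r : ℕ} (h : A.NV r) : (shoe hu hJ₁ hJ₂ T).NV (r + d) := by
  obtain ⟨c, φ, h1, h2, h3⟩ := h
  obtain ⟨ψ, hψ⟩ := (B.mem_cob_succ c _).1 (Z c φ h1)
  obtain ⟨χ, hχ, hχd⟩ := lift_vec (A := (B.D c)ᵀ) (da := fun k => -(B.dg (c + 1) k : ℤ))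
    (db := fun k => -(B.dg c k : ℤ)) (t := -((r + d + c : ℕ) : ℤ)) (y := φ ᵥ* T.θ c)
    (fun k l => by
      rw [transpose_apply, neg_sub_neg]
      exact B.D_hom c l k)
    (fun k => by
      refine HD.sum _ fun l _ => ?_
      have := (h2 l).mul (T.deg c l k)
      convert this using 1
      push_cast; ring)
    ⟨ψ, by rw [mulVec_transpose, hψ]⟩
  rw [mulVec_transpose] at hχ
  refine ⟨c, sE hu hJ₁ hJ₂ T c φ (-χ), ?_, ?_, fun h4 => h3 (sE_cob_inl _ _ _ _ _ _ _ h4)⟩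
  · rw [sE_coc]
    refine ⟨h1, ?_⟩
    rw [neg_vecMul, hχ, add_neg_cancel]
  · rintro (j | j)
    · change HD (φ j) (((A.dg c j + d : ℕ) : ℤ) - _)
      convert h2 j using 1
      push_cast; ring
    · change HD (-χ j) ((B.dg c j : ℤ) - _)
      have := (hχd j).neg
      convert this using 1
      ring

end split
end
end Res

/-- An ideal with a resolution having all the good properties. -/
def Good {K : Type*} [Field K] {n : ℕ} (I : Ideal (MvPolynomial (Fin n) K)) (r : ℕ)
    (Ps : Set (Ideal (MvPolynomial (Fin n) K))) : Prop :=
  ∃ G : Res I, (∀ i j, G.dg i j ≤ r + i) ∧ G.NV r ∧ G.Tors Ps ∧ G.Ann Ps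

theorem Good.mono {K : Type*} [Field K] {n : ℕ} {I : Ideal (MvPolynomial (Fin n) K)} {r : ℕ}
    {Ps Qs : Set (Ideal (MvPolynomial (Fin n) K))} (h : Good I r Ps) (hs : Ps ⊆ Qs) :
    Good I r Qs := by
  obtain ⟨G, h1, h2, h3, h4⟩ := h
  refine ⟨G, h1, h2, fun c J hJ => h3 c J fun P hP => hJ P (hs hP), fun c => ?_⟩
  obtain ⟨J, hJ, hJ'⟩ := h4 c
  exact ⟨J, hJ, fun Q hQ hP => hJ' Q hQ fun P hP' => hP P (hs hP')⟩

theorem Good.combine {K : Type*} [Field K] {n : ℕ} {I J₁ J₂ : Ideal (MvPolynomial (Fin n) K)}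
    {u : MvPolynomial (Fin n) K} {d : ℕ} (hu : HD u d)
    (hI : ∀ z p, p ∈ I → hcmp z p ∈ I) (hJ : ∀ z p, p ∈ J₁ → hcmp z p ∈ J₁)
    (hJ₁ : ∀ p, u * p ∈ I ↔ p ∈ J₁) (hJ₂ : ∀ p, p ∈ J₂ ↔ ∃ s, p - u * s ∈ I)
    {r₁ r₂ : ℕ} {P₁ P₂ : Set (Ideal (MvPolynomial (Fin n) K))}
    (h₁ : Good J₁ r₁ P₁) (h₂ : Good J₂ r₂ P₂)
    (hpr : ∀ Q ∈ P₂, Q.IsPrime) (hinc : ∀ P ∈ P₁, ∀ Q ∈ P₂, P ≤ Q → P = Q) :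
    Good I (max r₂ (r₁ + d)) (P₁ ∪ P₂) := by
  obtain ⟨A, a1, a2, a3, a4⟩ := h₁
  obtain ⟨B, b1, b2, b3, b4⟩ := h₂
  obtain ⟨T⟩ := Res.exists_theta u d hu hI hJ hJ₁ hJ₂ A B
  have Z := Res.theta_split T a4 b3 hpr hinc
  refine ⟨Res.shoe hu hJ₁ hJ₂ T, ?_, ?_, Res.shoe_tors hu hJ₁ hJ₂ T Z a3 b3,
    Res.shoe_ann hu hJ₁ hJ₂ T Z a4 b4⟩
  · rintro i (j | j)
    · have := a1 i j
      change A.dg i j + d ≤ _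
      have := le_max_right r₂ (r₁ + d)
      omega
    · have := b1 i j
      change B.dg i j ≤ _
      have := le_max_left r₂ (r₁ + d)
      omega
  · rcases le_total r₂ (r₁ + d) with h | h
    · rw [max_eq_right h]; exact Res.shoe_nv_left hu hJ₁ hJ₂ T Z a2
    · rw [max_eq_left h]; exact Res.shoe_nv_right hu hJ₁ hJ₂ T Z b2

/-! ## Conversion to and from `GradedFreeResolution`, and the regularity -/

section conversion
open Matrix
variable {K : Type*} [Field K] {n : ℕ} {I : Ideal (MvPolynomial (Fin n) K)}

/-- from the frozen structure -/
noncomputable def GradedFreeResolution.toRes (F : GradedFreeResolution K n I) : Res I where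
  ι i := Fin (F.rank i)
  fin i := inferInstance
  dec i := inferInstance
  dg := F.dg
  D := F.mat
  g := F.gen
  bdd := by
    obtain ⟨N, hN⟩ := F.finite
    exact ⟨N, fun i hi => by rw [hN i hi]; infer_instance⟩
  g_hom j := HD.iff_isHomogeneous.2 (F.gen_hom j)
  D_hom i k l := by
    rcases F.mat_hom i k l with h | ⟨c, hc, hd⟩
    · rw [h]; exact HD.zero _
    · rw [hd]
      convert HD.iff_isHomogeneous.2 hc using 1
      push_cast; ring
  surj p := by
    obtain ⟨v, hv⟩ := F.aug_surj (Ideal.Quotient.mk I p)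
    refine ⟨v, ?_⟩
    rw [← Ideal.Quotient.eq_zero_iff_mem, map_sub, sub_eq_zero, ← hv, dotProduct_comm]
    rfl
  ex0 v := by
    rw [← Ideal.Quotient.eq_zero_iff_mem, dotProduct_comm]
    exact F.exact_zero v
  ex1 i v := F.exact_succ i v

/-- to the frozen structure -/
noncomputable def Res.toFrozen (G : Res I) : GradedFreeResolution K n I where
  rank i := Fintype.card (G.ι i)
  dg i j := G.dg i ((Fintype.equivFin (G.ι i)).symm j)
  mat i := (G.D i).submatrix (Fintype.equivFin (G.ι i)).symm (Fintype.equivFin (G.ι (i + 1))).symm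
  gen j := G.g ((Fintype.equivFin (G.ι 0)).symm j)
  finite := by
    obtain ⟨N, hN⟩ := G.bdd
    exact ⟨N, fun i hi => by have := hN i hi; exact Fintype.card_eq_zero⟩
  gen_hom j := HD.iff_isHomogeneous.1 (G.g_hom _)
  mat_hom i k l := by
    by_cases h : (G.D i) ((Fintype.equivFin (G.ι i)).symm k)
      ((Fintype.equivFin (G.ι (i + 1))).symm l) = 0
    · exact Or.inl h
    · right
      have hd := G.D_hom i ((Fintype.equivFin (G.ι i)).symm k)
        ((Fintype.equivFin (G.ι (i + 1))).symm l)
      have hle : 0 ≤ (G.dg (i + 1) ((Fintype.equivFin (G.ι (i + 1))).symm l) : ℤ) -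
          G.dg i ((Fintype.equivFin (G.ι i)).symm k) := by
        by_contra hlt
        exact h (hd.eq_zero_of_neg (by omega))
      obtain ⟨c, hc⟩ := Int.eq_ofNat_of_zero_le hle
      refine ⟨c, ?_, by omega⟩
      rw [hc] at hd
      exact HD.iff_isHomogeneous.1 hd
  aug_surj := by
    intro q
    obtain ⟨p, rfl⟩ := Ideal.Quotient.mk_surjective q
    obtain ⟨v, hv⟩ := G.surj p
    refine ⟨v ∘ (Fintype.equivFin (G.ι 0)).symm, ?_⟩
    rw [← Ideal.Quotient.eq_zero_iff_mem, map_sub, sub_eq_zero] at hv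
    rw [hv, dotProduct_comm]
    exact congrArg (Ideal.Quotient.mk I)
      (Equiv.sum_comp (Fintype.equivFin (G.ι 0)).symm (fun j => v j * G.g j))
  exact_zero := by
    intro v
    have h := G.ex0 (v ∘ Fintype.equivFin (G.ι 0))
    have e : ∑ j, v j * G.g ((Fintype.equivFin (G.ι 0)).symm j) =
        G.g ⬝ᵥ (v ∘ Fintype.equivFin (G.ι 0)) := by
      rw [dotProduct_comm]
      exact (Equiv.sum_comp (Fintype.equivFin (G.ι 0))
        (fun j => v j * G.g ((Fintype.equivFin (G.ι 0)).symm j))).symm.trans (by simp [dotProduct])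
    change Ideal.Quotient.mk I (∑ j, v j * G.g ((Fintype.equivFin (G.ι 0)).symm j)) = 0 ↔ _
    rw [e, Ideal.Quotient.eq_zero_iff_mem, h]
    constructor
    · rintro ⟨w, hw⟩
      refine ⟨w ∘ (Fintype.equivFin (G.ι (0 + 1))).symm, ?_⟩
      beta_reduce
      rw [submatrix_mulVec_equiv]
      simp [Function.comp_assoc, hw]
    · rintro ⟨w, hw⟩
      refine ⟨w ∘ (Fintype.equivFin (G.ι (0 + 1))), ?_⟩
      beta_reduce at hw
      rw [← hw, submatrix_mulVec_equiv]
      simp [Function.comp_assoc]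
  exact_succ i := by
    intro v
    have h := G.ex1 i (v ∘ Fintype.equivFin (G.ι (i + 1)))
    have e : (G.D i).submatrix (Fintype.equivFin (G.ι i)).symm
        (Fintype.equivFin (G.ι (i + 1))).symm *ᵥ v = 0 ↔
        G.D i *ᵥ (v ∘ Fintype.equivFin (G.ι (i + 1))) = 0 := by
      rw [submatrix_mulVec_equiv]
      simp only [Equiv.symm_symm]
      constructor
      · intro h2
        funext x
        have := congrFun h2 (Fintype.equivFin (G.ι i) x)
        simpa using this
      · intro h2
        rw [h2]; rfl
    rw [e, h]
    constructor
    · rintro ⟨w, hw⟩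
      refine ⟨w ∘ (Fintype.equivFin (G.ι (i + 1 + 1))).symm, ?_⟩
      beta_reduce
      rw [submatrix_mulVec_equiv]
      simp [Function.comp_assoc, hw]
    · rintro ⟨w, hw⟩
      refine ⟨w ∘ (Fintype.equivFin (G.ι (i + 1 + 1))), ?_⟩
      beta_reduce at hw
      rw [← hw, submatrix_mulVec_equiv]
      simp [Function.comp_assoc]

theorem Good.regQuot_eq (hI : ∀ z p, p ∈ I → hcmp z p ∈ I) {r : ℕ}
    {Ps : Set (Ideal (MvPolynomial (Fin n) K))} (h : Good I r Ps) : regQuot I = r := by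
  obtain ⟨G, h1, ⟨c, φ, h2, h3, h4⟩, -, -⟩ := h
  unfold regQuot
  have hmem : r ∈ {m : ℕ | ∃ F : GradedFreeResolution K n I,
      ∀ (i : ℕ) (j : Fin (F.rank i)), F.dg i j ≤ m + i} := ⟨G.toFrozen, fun i j => h1 i _⟩
  refine le_antisymm (Nat.sInf_le hmem) (le_csInf ⟨r, hmem⟩ ?_)
  rintro m ⟨F, hF⟩
  obtain ⟨l, hl⟩ := Res.bound hI G F.toRes c _ φ h2 h3 h4
  have h5 : F.toRes.dg c l ≤ m + c := hF c l
  omega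

end conversion

/-! ## Monomial ideals -/

section mono
variable {K : Type*} [Field K] {n : ℕ} {I : Ideal (MvPolynomial (Fin n) K)}

theorem IsMonomialIdeal.mem_iff (h : IsMonomialIdeal I) (p : MvPolynomial (Fin n) K) :
    p ∈ I ↔ ∀ m, coeff m p ≠ 0 → monomial m (1 : K) ∈ I := by
  obtain ⟨G, rfl⟩ := h
  rw [mem_ideal_span_monomial_image]
  constructor
  · intro h m hm
    rw [mem_ideal_span_monomial_image]
    intro x hx
    have : x = m := by
      rw [mem_support_iff, coeff_monomial] at hx
      by_contra hne
      rw [if_neg (Ne.symm hne)] at hx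
      exact hx rfl
    rw [this]
    exact h m (mem_support_iff.2 hm)
  · intro h m hm
    have := h m (mem_support_iff.1 hm)
    rw [mem_ideal_span_monomial_image] at this
    exact this m (by simp [mem_support_iff])

theorem isMonomialIdeal_of_mem_iff
    (h : ∀ p, p ∈ I → ∀ m, coeff m p ≠ 0 → monomial m (1 : K) ∈ I) : IsMonomialIdeal I := by
  refine ⟨{m | monomial m (1 : K) ∈ I}, le_antisymm ?_ ?_⟩
  · intro p hp
    rw [mem_ideal_span_monomial_image]
    intro m hm
    exact ⟨m, h p hp m (mem_support_iff.1 hm), le_rfl⟩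
  · rw [Ideal.span_le]
    rintro _ ⟨m, hm, rfl⟩
    exact hm

theorem IsMonomialIdeal.hcmp_mem (h : IsMonomialIdeal I) (z : ℤ) (p : MvPolynomial (Fin n) K)
    (hp : p ∈ I) : hcmp z p ∈ I := by
  rw [h.mem_iff] at hp ⊢
  intro m hm
  rw [coeff_hcmp] at hm
  split_ifs at hm
  · exact hp m hm
  · exact absurd rfl hm

theorem mem_colon_mon (u p : MvPolynomial (Fin n) K) :
    u * p ∈ I ↔ p ∈ Submodule.colon I ((Ideal.span {u} : Ideal (MvPolynomial (Fin n) K)) : Set _) := by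
  rw [Submodule.mem_colon]
  constructor
  · intro h s hs
    obtain ⟨t, rfl⟩ := Ideal.mem_span_singleton'.1 hs
    have := I.mul_mem_left t h
    rw [smul_eq_mul]
    convert this using 1; ring
  · intro h
    have := h u (Ideal.mem_span_singleton_self u)
    rwa [smul_eq_mul, mul_comm] at this

theorem mem_add_mon (u p : MvPolynomial (Fin n) K) :
    p ∈ I + Ideal.span {u} ↔ ∃ s, p - u * s ∈ I := by
  rw [Submodule.add_eq_sup, Submodule.mem_sup]
  constructor
  · rintro ⟨y, hy, z, hz, rfl⟩
    obtain ⟨t, rfl⟩ := Ideal.mem_span_singleton'.1 hz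
    refine ⟨t, ?_⟩
    convert hy using 1; ring
  · rintro ⟨s, hs⟩
    exact ⟨_, hs, u * s, Ideal.mul_mem_right _ _ (Ideal.mem_span_singleton_self u), by ring⟩

theorem IsMonomialIdeal.colon (h : IsMonomialIdeal I) (a : Fin n →₀ ℕ) :
    IsMonomialIdeal (Submodule.colon I
      ((Ideal.span {monomial a (1 : K)} : Ideal (MvPolynomial (Fin n) K)) : Set _)) := by
  apply isMonomialIdeal_of_mem_iff
  intro p hp m hm
  rw [← mem_colon_mon] at hp ⊢
  rw [monomial_mul, one_mul]
  refine (h.mem_iff _).1 hp _ ?_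
  rw [coeff_monomial_mul, one_mul]
  exact hm

theorem IsMonomialIdeal.add (h : IsMonomialIdeal I) (a : Fin n →₀ ℕ) :
    IsMonomialIdeal (I + Ideal.span {monomial a (1 : K)}) := by
  obtain ⟨G, rfl⟩ := h
  refine ⟨G ∪ {a}, ?_⟩
  rw [Set.image_union, Ideal.span_union, Set.image_singleton]
  rfl

theorem IsMonomialIdeal.prime_eq (h : IsMonomialIdeal I) (hp : I.IsPrime) :
    I = Ideal.span (X '' {i : Fin n | (X i : MvPolynomial (Fin n) K) ∈ I}) := by
  apply le_antisymm
  · intro p hpI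
    rw [mem_ideal_span_X_image]
    intro m hm
    have := (h.mem_iff p).1 hpI m (mem_support_iff.1 hm)
    rw [monomial_eq, C_1, one_mul, Finsupp.prod, hp.prod_mem_iff] at this
    obtain ⟨i, hi, hi2⟩ := this
    exact ⟨i, hp.mem_of_pow_mem _ hi2, Finsupp.mem_support_iff.1 hi⟩
  · rw [Ideal.span_le]
    rintro _ ⟨i, hi, rfl⟩
    exact hi

theorem minimalPrimes_colon_subset (hne : NoEmbeddedPrimes I) (u : MvPolynomial (Fin n) K) :
    (Submodule.colon I ((Ideal.span {u} : Ideal (MvPolynomial (Fin n) K)) : Set _)).minimalPrimes ⊆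
      I.minimalPrimes := by
  intro P hP
  apply hne
  set J := Submodule.colon I ((Ideal.span {u} : Ideal (MvPolynomial (Fin n) K)) : Set _) with hJ
  have h1 : P ∈ associatedPrimes (MvPolynomial (Fin n) K) (MvPolynomial (Fin n) K ⧸ J) := by
    apply Module.associatedPrimes.minimalPrimes_annihilator_subset_associatedPrimes
    rwa [Ideal.annihilator_quotient]
  let f : (MvPolynomial (Fin n) K ⧸ J) →ₗ[MvPolynomial (Fin n) K] (MvPolynomial (Fin n) K ⧸ I) :=
    Submodule.mapQ J I (LinearMap.mulLeft _ u) (by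
      intro p hp
      exact (mem_colon_mon u p).2 hp)
  have hf : Function.Injective f := by
    rw [← LinearMap.ker_eq_bot, Submodule.eq_bot_iff]
    intro x hx
    obtain ⟨p, rfl⟩ := Submodule.Quotient.mk_surjective _ x
    have hx2 : (Submodule.Quotient.mk (u * p) : MvPolynomial (Fin n) K ⧸ I) = 0 := hx
    rw [Submodule.Quotient.mk_eq_zero] at hx2
    rw [Submodule.Quotient.mk_eq_zero]
    exact (mem_colon_mon u p).1 hx2
  exact associatedPrimes.subset_of_injective hf h1

end mono

/-! ## Koszul resolutions of monomial primes -/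

namespace Res
open Matrix
section cone
variable {K : Type*} [Field K] {n : ℕ} {P P' : Ideal (MvPolynomial (Fin n) K)}

/-- shifted index types -/
def sI (G : Res P) : ℕ → Type
  | 0 => Empty
  | i + 1 => G.ι i

instance sI_fin (G : Res P) : ∀ i, Fintype (G.sI i)
  | 0 => inferInstanceAs (Fintype Empty)
  | i + 1 => G.fin i

instance sI_dec (G : Res P) : ∀ i, DecidableEq (G.sI i)
  | 0 => inferInstanceAs (DecidableEq Empty)
  | i + 1 => G.dec i

/-- degrees of the shifted part -/
def sdg (G : Res P) : ∀ i, G.sI i → ℕ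
  | 0, e => Empty.elim e
  | i + 1, j => G.dg i j + 1

/-- differential of the cone -/
noncomputable def cD (G : Res P) (x : MvPolynomial (Fin n) K) :
    ∀ i, Matrix (G.ι i ⊕ G.sI i) (G.ι (i + 1) ⊕ G.sI (i + 1)) (MvPolynomial (Fin n) K)
  | 0 => fromBlocks (G.D 0) (x • (1 : Matrix (G.ι 0) (G.ι 0) (MvPolynomial (Fin n) K))) 0
      (fun e => Empty.elim e)
  | i + 1 => fromBlocks (G.D (i + 1))
      (x • (1 : Matrix (G.ι (i + 1)) (G.ι (i + 1)) (MvPolynomial (Fin n) K))) 0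
      (-(G.D i))

/-- cochains on the cone -/
def cE (G : Res P) (i : ℕ) (v : G.ι (i + 1) → MvPolynomial (Fin n) K)
    (w : G.ι i → MvPolynomial (Fin n) K) : G.ι (i + 1) ⊕ G.sI (i + 1) → MvPolynomial (Fin n) K :=
  Sum.elim v w

/-- cochains on the cone, degree zero -/
def cZ (G : Res P) (v : G.ι 0 → MvPolynomial (Fin n) K) :
    G.ι 0 ⊕ G.sI 0 → MvPolynomial (Fin n) K :=
  Sum.elim v (fun e => Empty.elim e)

theorem cE_surj (G : Res P) (i : ℕ) (v) : ∃ v₁ v₂, v = G.cE i v₁ v₂ :=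
  ⟨_, _, (elim_eta v).symm⟩

theorem cZ_surj (G : Res P) (v) : ∃ v₁, v = G.cZ v₁ :=
  ⟨v ∘ Sum.inl, by funext k; rcases k with k | k; · rfl
                   · exact Empty.elim k⟩

theorem cZ_inj (G : Res P) (v w) : G.cZ v = G.cZ w ↔ v = w :=
  ⟨fun h => funext fun k => congrFun h (Sum.inl k), fun h => by rw [h]⟩

theorem cE_inj (G : Res P) (i : ℕ) (v w v' w') : G.cE i v w = G.cE i v' w' ↔ v = v' ∧ w = w' :=
  ⟨fun h => ⟨funext fun k => congrFun h (Sum.inl k), funext fun k => congrFun h (Sum.inr k)⟩,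
    fun h => by rw [h.1, h.2]⟩

theorem cZ_zero (G : Res P) : G.cZ 0 = 0 := by
  funext k; rcases k with k | k
  · rfl
  · exact Empty.elim k

theorem cE_zero (G : Res P) (i : ℕ) : G.cE i 0 0 = 0 := by
  funext k; rcases k with k | k <;> rfl

theorem cD_mulVec_zero (G : Res P) (x : MvPolynomial (Fin n) K) (v w) :
    G.cD x 0 *ᵥ G.cE 0 v w = G.cZ (G.D 0 *ᵥ v + x • w) := by
  funext k
  rcases k with k | k
  · have := congrFun (blk_mulVec (G.D 0)
      (x • (1 : Matrix (G.ι 0) (G.ι 0) (MvPolynomial (Fin n) K)))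
      (fun e : Empty => Empty.elim e) v w) (Sum.inl k)
    refine this.trans ?_
    rw [smul_mulVec, one_mulVec]; rfl
  · exact Empty.elim k

theorem cD_mulVec_succ (G : Res P) (x : MvPolynomial (Fin n) K) (i : ℕ) (v w) :
    G.cD x (i + 1) *ᵥ G.cE (i + 1) v w =
      G.cE i (G.D (i + 1) *ᵥ v + x • w) (-(G.D i *ᵥ w)) := by
  have := blk_mulVec (G.D (i + 1))
    (x • (1 : Matrix (G.ι (i + 1)) (G.ι (i + 1)) (MvPolynomial (Fin n) K))) (-(G.D i)) v w
  refine this.trans ?_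
  rw [smul_mulVec, one_mulVec, neg_mulVec]; rfl

theorem cD_vecMul_zero (G : Res P) (x : MvPolynomial (Fin n) K) (φ) :
    G.cZ φ ᵥ* G.cD x 0 = G.cE 0 (φ ᵥ* G.D 0) (x • φ) := by
  have := blk_vecMul (G.D 0)
    (x • (1 : Matrix (G.ι 0) (G.ι 0) (MvPolynomial (Fin n) K)))
    (fun e : Empty => Empty.elim e) φ (fun e => Empty.elim e)
  refine this.trans ?_
  rw [vecMul_smul, vecMul_one]
  funext k
  rcases k with k | k
  · rfl
  · have h0 : ∀ w : Matrix Empty (G.ι 0) (MvPolynomial (Fin n) K),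
        ((fun e => Empty.elim e : Empty → MvPolynomial (Fin n) K) ᵥ* w) k = 0 :=
      fun w => by simp [vecMul, dotProduct]
    exact (congrArg ((x • φ) k + ·) (h0 _)).trans (add_zero _)

theorem cD_vecMul_succ (G : Res P) (x : MvPolynomial (Fin n) K) (i : ℕ) (φ ψ) :
    G.cE i φ ψ ᵥ* G.cD x (i + 1) =
      G.cE (i + 1) (φ ᵥ* G.D (i + 1)) (x • φ - ψ ᵥ* G.D i) := by
  have := blk_vecMul (G.D (i + 1))
    (x • (1 : Matrix (G.ι (i + 1)) (G.ι (i + 1)) (MvPolynomial (Fin n) K))) (-(G.D i)) φ ψ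
  refine this.trans ?_
  rw [vecMul_smul, vecMul_one, vecMul_neg, ← sub_eq_add_neg]; rfl

theorem cone_ex (G : Res P) (x : MvPolynomial (Fin n) K) (i : ℕ) (v w)
    (h1 : G.D i *ᵥ v + x • w = 0) (h2 : G.Cyc i w) :
    ∃ a, G.cD x (i + 1) *ᵥ a = G.cE i v w := by
  obtain ⟨w', rfl⟩ := (G.cyc_iff i w).1 h2
  have : G.D i *ᵥ (v + x • w') = 0 := by rw [mulVec_add, mulVec_smul]; exact h1
  obtain ⟨a, ha⟩ := (G.ex1 i _).1 this
  refine ⟨G.cE (i + 1) a (-w'), ?_⟩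
  rw [cD_mulVec_succ, ha, mulVec_neg, neg_neg]
  congr 1
  rw [smul_neg]; abel

/-- The mapping cone of multiplication by `x`. -/
noncomputable def cone (G : Res P) (x : MvPolynomial (Fin n) K) (hx1 : HD x 1)
    (hx : ∀ p, x * p ∈ P → p ∈ P) (hP' : ∀ p, p ∈ P' ↔ ∃ s, p - x * s ∈ P) : Res P' where
  ι i := G.ι i ⊕ G.sI i
  fin i := inferInstance
  dec i := inferInstance
  dg i := Sum.elim (G.dg i) (G.sdg i)
  D i := G.cD x i
  g := G.cZ G.g
  bdd := by
    obtain ⟨N, hN⟩ := G.bdd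
    refine ⟨N + 1, fun i hi => ?_⟩
    obtain ⟨j, rfl⟩ : ∃ j, i = j + 1 := ⟨i - 1, by omega⟩
    have h1 := hN (j + 1) (by omega)
    have h2 : IsEmpty (G.sI (j + 1)) := hN j (by omega)
    infer_instance
  g_hom j := by
    rcases j with j | j
    · exact G.g_hom j
    · exact Empty.elim j
  D_hom i k l := by
    have hone : ∀ (i) (k l : G.ι i), HD ((x • (1 : Matrix (G.ι i) (G.ι i) (MvPolynomial (Fin n) K))) k l)
        (((G.dg i l + 1 : ℕ) : ℤ) - G.dg i k) := by
      intro i k l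
      rw [Matrix.smul_apply, smul_eq_mul, one_apply]
      split_ifs with h
      · subst h
        rw [mul_one]
        convert hx1 using 1
        push_cast; ring
      · rw [mul_zero]; exact HD.zero _
    rcases i with _ | i
    · rcases k with k | k
      · rcases l with l | l
        · exact G.D_hom 0 k l
        · exact hone 0 k l
      · exact Empty.elim k
    · rcases k with k | k
      · rcases l with l | l
        · exact G.D_hom (i + 1) k l
        · exact hone (i + 1) k l
      · rcases l with l | l
        · exact HD.zero _
        · change HD (- G.D i k l) (((G.dg (i + 1) l + 1 : ℕ) : ℤ) - ((G.dg i k + 1 : ℕ) : ℤ))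
          convert (G.D_hom i k l).neg using 1
          push_cast; ring
  surj p := by
    obtain ⟨v, hv⟩ := G.surj p
    refine ⟨G.cZ v, ?_⟩
    rw [hP']
    refine ⟨0, ?_⟩
    rw [mul_zero, sub_zero, cZ, cZ, sumElim_dotProduct_sumElim]
    have h0 : ((fun e => Empty.elim e : G.sI 0 → MvPolynomial (Fin n) K) ⬝ᵥ
      fun e => Empty.elim e) = 0 := Finset.sum_eq_zero fun e _ => Empty.elim e
    rw [h0, add_zero]
    exact hv
  ex0 v := by
    obtain ⟨v, rfl⟩ := G.cZ_surj v
    have h0 : ((fun e => Empty.elim e : G.sI 0 → MvPolynomial (Fin n) K) ⬝ᵥ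
      fun e => Empty.elim e) = 0 := Finset.sum_eq_zero fun e _ => Empty.elim e
    have h1 : G.cZ G.g ⬝ᵥ G.cZ v = G.g ⬝ᵥ v := by
      rw [cZ, cZ, sumElim_dotProduct_sumElim, h0, add_zero]
    rw [h1, hP']
    constructor
    · rintro ⟨s, hs⟩
      obtain ⟨w, hw⟩ := G.surj s
      have : G.g ⬝ᵥ (v - x • w) ∈ P := by
        rw [dotProduct_sub, dotProduct_smul, smul_eq_mul]
        have := P.add_mem hs (P.mul_mem_left x hw)
        convert this using 1; ring
      obtain ⟨w', hw'⟩ := (G.ex0 _).1 this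
      refine ⟨G.cE 0 w' w, ?_⟩
      rw [cD_mulVec_zero, hw', sub_add_cancel]
    · rintro ⟨w, hw⟩
      obtain ⟨w₁, w₂, rfl⟩ := G.cE_surj 0 w
      rw [cD_mulVec_zero, cZ_inj] at hw
      refine ⟨G.g ⬝ᵥ w₂, ?_⟩
      rw [← hw, dotProduct_add, dotProduct_smul, smul_eq_mul, add_sub_cancel_right]
      exact (G.ex0 _).2 ⟨_, rfl⟩
  ex1 i v := by
    constructor
    · intro h
      obtain ⟨v, w, rfl⟩ := G.cE_surj i v
      rcases i with _ | i
      · rw [cD_mulVec_zero, ← cZ_zero, cZ_inj] at h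
        refine G.cone_ex x 0 v w h (hx _ ?_)
        have h2 : x * (G.g ⬝ᵥ w) = -(G.g ⬝ᵥ (G.D 0 *ᵥ v)) := by
          have := congrArg (fun z => G.g ⬝ᵥ z) h
          simp only [dotProduct_add, dotProduct_smul, smul_eq_mul, dotProduct_zero] at this
          linear_combination this
        rw [h2]
        exact P.neg_mem ((G.ex0 _).2 ⟨_, rfl⟩)
      · rw [cD_mulVec_succ, ← cE_zero, cE_inj] at h
        exact G.cone_ex x (i + 1) v w h.1 (neg_eq_zero.1 h.2)
    · rintro ⟨w, rfl⟩
      obtain ⟨a, b, rfl⟩ := G.cE_surj (i + 1) w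
      rw [cD_mulVec_succ]
      have h1 : G.D i *ᵥ (G.D (i + 1) *ᵥ a + x • b) + x • -(G.D i *ᵥ b) = 0 := by
        rw [mulVec_add, mulVec_mulVec, D_mul_D, zero_mulVec, mulVec_smul, smul_neg]
        abel
      rcases i with _ | i
      · rw [cD_mulVec_zero, h1, cZ_zero]
      · rw [cD_mulVec_succ, h1, mulVec_neg, neg_neg, mulVec_mulVec, D_mul_D, zero_mulVec, cE_zero]

variable (G : Res P) (x : MvPolynomial (Fin n) K) (hx1 : HD x 1)
    (hx : ∀ p, x * p ∈ P → p ∈ P) (hP' : ∀ p, p ∈ P' ↔ ∃ s, p - x * s ∈ P)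

theorem cone_cob (i : ℕ) (φ ψ) : G.cE i φ ψ ∈ (G.cone x hx1 hx hP').Cob (i + 1) ↔
    ∃ α, α ᵥ* G.D i = φ ∧ x • α - ψ ∈ G.Cob i := by
  refine (mem_cob_succ _ _ _).trans ?_
  rcases i with _ | i
  · constructor
    · rintro ⟨α, h⟩
      obtain ⟨α, rfl⟩ := G.cZ_surj α
      have h2 : G.cZ α ᵥ* G.cD x 0 = G.cE 0 φ ψ := h
      rw [cD_vecMul_zero, cE_inj] at h2
      exact ⟨α, h2.1, (mem_cob_zero _ _).2 (sub_eq_zero.2 h2.2)⟩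
    · rintro ⟨α, h1, h2⟩
      rw [mem_cob_zero, sub_eq_zero] at h2
      refine ⟨G.cZ α, ?_⟩
      change G.cZ α ᵥ* G.cD x 0 = G.cE 0 φ ψ
      rw [cD_vecMul_zero, h1, h2]
  · constructor
    · rintro ⟨α, h⟩
      obtain ⟨α, β, rfl⟩ := G.cE_surj i α
      have h2 : G.cE i α β ᵥ* G.cD x (i + 1) = G.cE (i + 1) φ ψ := h
      rw [cD_vecMul_succ, cE_inj] at h2
      exact ⟨α, h2.1, (mem_cob_succ _ _ _).2 ⟨β, by rw [← h2.2]; abel⟩⟩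
    · rintro ⟨α, h1, h2⟩
      obtain ⟨β, hβ⟩ := (mem_cob_succ _ _ _).1 h2
      refine ⟨G.cE i α β, ?_⟩
      change G.cE i α β ᵥ* G.cD x (i + 1) = G.cE (i + 1) φ ψ
      rw [cD_vecMul_succ, h1, hβ, sub_sub_cancel]

end cone

/-- Resolutions behaving like the Koszul complex. -/
def Kos {K : Type*} [Field K] {n : ℕ} {P : Ideal (MvPolynomial (Fin n) K)} (G : Res P) (c : ℕ) :
    Prop :=
  (∀ i j, G.dg i j = i) ∧ (∀ i, i ≠ c → ∀ φ, φ ᵥ* G.D i = 0 → φ ∈ G.Cob i) ∧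
  (∃ e : G.ι c, (∀ j, j = e) ∧ ∀ φ, φ ∈ G.Cob c ↔ φ e ∈ P) ∧ ∀ i, c < i → IsEmpty (G.ι i)

theorem Kos.cone {K : Type*} [Field K] {n : ℕ} {P P' : Ideal (MvPolynomial (Fin n) K)} {G : Res P}
    {c : ℕ} (h : G.Kos c) (x : MvPolynomial (Fin n) K) (hx0 : x ≠ 0) (hx1 : HD x 1)
    (hx : ∀ p, x * p ∈ P → p ∈ P) (hP' : ∀ p, p ∈ P' ↔ ∃ s, p - x * s ∈ P) :
    (G.cone x hx1 hx hP').Kos (c + 1) := by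
  obtain ⟨h1, h2, ⟨e, he, hc⟩, h4⟩ := h
  refine ⟨?_, ?_, ?_, ?_⟩
  · intro i j
    rcases j with j | j
    · exact h1 i j
    · rcases i with _ | i
      · exact Empty.elim j
      · exact congrArg (· + 1) (h1 i j)
  · intro i hi φ hφ
    rcases i with _ | i
    · obtain ⟨φ, rfl⟩ := G.cZ_surj φ
      have hφ2 : G.cZ φ ᵥ* G.cD x 0 = 0 := hφ
      rw [cD_vecMul_zero, ← cE_zero, cE_inj] at hφ2
      have : φ = 0 := by
        funext k
        have := congrFun hφ2.2 k
        simp only [Pi.smul_apply, smul_eq_mul, Pi.zero_apply, mul_eq_zero] at this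
        exact this.resolve_left hx0
      rw [this]
      exact (mem_cob_zero _ _).2 G.cZ_zero
    · obtain ⟨φ, ψ, rfl⟩ := G.cE_surj i φ
      have hφ2 : G.cE i φ ψ ᵥ* G.cD x (i + 1) = 0 := hφ
      rw [cD_vecMul_succ, ← cE_zero, cE_inj, sub_eq_zero] at hφ2
      have h5 : φ ∈ G.Cob (i + 1) := by
        by_cases hic : i + 1 = c
        · subst hic
          rw [hc]
          apply hx
          have : x • φ ∈ G.Cob (i + 1) := (mem_cob_succ _ _ _).2 ⟨ψ, hφ2.2.symm⟩
          exact (hc _).1 this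
        · exact h2 _ hic _ hφ2.1
      obtain ⟨α, hα⟩ := (mem_cob_succ _ _ _).1 h5
      refine (G.cone_cob x hx1 hx hP' i φ ψ).2 ⟨α, hα, h2 i (by omega) _ ?_⟩
      rw [sub_vecMul, smul_vecMul, hα, hφ2.2, sub_self]
  · refine ⟨Sum.inr e, ?_, ?_⟩
    · rintro (j | j)
      · exact (h4 (c + 1) (by omega)).elim j
      · exact congrArg Sum.inr (he j)
    · intro φ
      obtain ⟨φ, ψ, rfl⟩ := G.cE_surj c φ
      refine (G.cone_cob x hx1 hx hP' c φ ψ).trans ?_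
      change _ ↔ ψ e ∈ P'
      rw [hP']
      constructor
      · rintro ⟨α, -, h⟩
        refine ⟨α e, ?_⟩
        have := P.neg_mem ((hc _).1 h)
        simpa using this
      · rintro ⟨s, hs⟩
        refine ⟨fun _ => s, ?_, ?_⟩
        · have := h4 (c + 1) (by omega)
          exact Subsingleton.elim _ _
        · rw [hc]
          have := P.neg_mem hs
          simpa using this
  · intro i hi
    obtain ⟨j, rfl⟩ : ∃ j, i = j + 1 := ⟨i - 1, by omega⟩
    have h1 := h4 (j + 1) (by omega)
    have h2 : IsEmpty (G.sI (j + 1)) := h4 j (by omega)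
    exact inferInstanceAs (IsEmpty (G.ι (j + 1) ⊕ G.sI (j + 1)))

/-- index types of the trivial resolution -/
def tI : ℕ → Type
  | 0 => Unit
  | _ + 1 => Empty

instance tI_fin : ∀ i, Fintype (tI i)
  | 0 => inferInstanceAs (Fintype Unit)
  | _ + 1 => inferInstanceAs (Fintype Empty)

instance tI_dec : ∀ i, DecidableEq (tI i)
  | 0 => inferInstanceAs (DecidableEq Unit)
  | _ + 1 => inferInstanceAs (DecidableEq Empty)

/-- trivial resolution -/
noncomputable def triv (K : Type*) [Field K] (n : ℕ) : Res (⊥ : Ideal (MvPolynomial (Fin n) K)) where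
  ι := tI
  fin i := inferInstance
  dec i := inferInstance
  dg i _ := i
  D i := 0
  g _ := 1
  bdd := ⟨0, fun i hi => by
    obtain ⟨j, rfl⟩ : ∃ j, i = j + 1 := ⟨i - 1, by omega⟩
    exact inferInstanceAs (IsEmpty Empty)⟩
  g_hom j := HD.one
  D_hom i k l := HD.zero _
  surj p := ⟨fun _ => p, by
    have : ((fun _ : tI 0 => (1 : MvPolynomial (Fin n) K)) ⬝ᵥ fun _ => p) = p := by
      change ∑ _ : Unit, 1 * p = p
      simp
    rw [this, sub_self]; exact Ideal.zero_mem _⟩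
  ex0 v := by
    have : ((fun _ : tI 0 => (1 : MvPolynomial (Fin n) K)) ⬝ᵥ v) = v () := by
      change ∑ j : Unit, 1 * v j = v ()
      simp only [one_mul]
      exact Fintype.sum_unique (ι := Unit) v
    rw [this, Ideal.mem_bot]
    constructor
    · intro h
      refine ⟨0, ?_⟩
      rw [mulVec_zero]
      funext j
      exact h.symm
    · rintro ⟨w, rfl⟩
      rw [zero_mulVec]; rfl
  ex1 i v := ⟨fun _ => ⟨0, funext fun j => Empty.elim j⟩, fun _ => by rw [zero_mulVec]⟩

theorem triv_kos (K : Type*) [Field K] (n : ℕ) : (triv K n).Kos 0 := by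
  refine ⟨fun _ _ => rfl, ?_, ⟨(), fun j => rfl, fun φ => ?_⟩, ?_⟩
  · intro i hi φ _
    obtain ⟨j, rfl⟩ : ∃ j, i = j + 1 := ⟨i - 1, by omega⟩
    have : φ = 0 := funext fun j => Empty.elim j
    rw [this]; exact Submodule.zero_mem _
  · rw [mem_cob_zero, Ideal.mem_bot]
    exact ⟨fun h => congrFun h (), fun h => funext fun _ => h⟩
  · intro i hi
    obtain ⟨j, rfl⟩ : ∃ j, i = j + 1 := ⟨i - 1, by omega⟩
    exact inferInstanceAs (IsEmpty Empty)

theorem exists_kos {K : Type*} [Field K] {n : ℕ} (A : Finset (Fin n)) :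
    ∀ P : Ideal (MvPolynomial (Fin n) K), P = Ideal.span (X '' (A : Set (Fin n))) →
      ∃ G : Res P, G.Kos A.card := by
  induction A using Finset.induction_on with
  | empty =>
    intro P hP
    have : P = ⊥ := by rw [hP]; simp
    subst this
    exact ⟨triv K n, triv_kos K n⟩
  | insert a A ha ih =>
    intro P hP
    obtain ⟨G, hG⟩ := ih _ rfl
    rw [Finset.card_insert_of_notMem ha]
    refine ⟨_, hG.cone (X a) (X_ne_zero a) (HD.X a) ?_ ?_⟩
    · intro p hp
      rw [mem_ideal_span_X_image] at hp ⊢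
      intro m hm
      obtain ⟨i, hi, h⟩ := hp (Finsupp.single a 1 + m) (by
        rw [mem_support_iff, coeff_X_mul]; exact mem_support_iff.1 hm)
      refine ⟨i, hi, ?_⟩
      have : a ≠ i := by rintro rfl; exact ha hi
      simpa [Finsupp.single_apply, this] using h
    · intro p
      rw [← mem_add_mon, hP, Finset.coe_insert, Set.image_insert_eq, Ideal.span_insert, sup_comm]
      rfl

end Res

theorem good_prime {K : Type*} [Field K] {n : ℕ} {P : Ideal (MvPolynomial (Fin n) K)}
    (hm : IsMonomialIdeal P) (hp : P.IsPrime) : Good P 0 P.minimalPrimes := by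
  classical
  have hmin : P.minimalPrimes = {P} := Ideal.minimalPrimes_eq_subsingleton_self
  rw [hmin]
  obtain ⟨G, h1, h2, ⟨e, he, hc⟩, h4⟩ := Res.exists_kos
    (Set.toFinset {i : Fin n | (X i : MvPolynomial (Fin n) K) ∈ P}) P (by
      rw [Set.coe_toFinset]; exact hm.prime_eq hp)
  have hcard : (Set.toFinset {i : Fin n | (X i : MvPolynomial (Fin n) K) ∈ P}).card = htv P := by
    rw [htv, Set.ncard_eq_toFinset_card']
  generalize (Set.toFinset {i : Fin n | (X i : MvPolynomial (Fin n) K) ∈ P}).card = c at *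
  have hz : ∀ φ, Matrix.vecMul φ (G.D c) = 0 := by
    intro φ
    have := h4 (c + 1) (by omega)
    exact Subsingleton.elim _ _
  have hone : (1 : MvPolynomial (Fin n) K) ∉ P := (Ideal.ne_top_iff_one P).1 hp.ne_top
  refine ⟨G, fun i j => by rw [h1]; omega, ⟨c, fun _ => 1, hz _, fun j => ?_, ?_⟩, ?_, ?_⟩
  · rw [h1]
    convert HD.one using 1
    simp
  · rw [hc]; exact hone
  · intro c' J hJ φ hφ hs
    by_cases hcc : c' = c
    · subst hcc
      have := hJ P rfl hcard.symm
      obtain ⟨s, hsJ, hsP⟩ := SetLike.not_le_iff_exists.1 this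
      have h5 := (hc _).1 (hs s hsJ)
      rw [hc]
      exact (hp.mem_or_mem h5).resolve_left hsP
    · exact h2 _ hcc _ hφ
  · intro c'
    by_cases hcc : c' = c
    · subst hcc
      refine ⟨P, fun s hs φ _ => ?_, fun Q _ hQ => hQ P rfl hcard.symm⟩
      rw [hc]
      exact P.mul_mem_right _ hs
    · refine ⟨⊤, fun s _ φ hφ => Submodule.smul_mem _ _ (h2 _ hcc _ hφ), fun Q hQ _ h => ?_⟩
      exact hQ.ne_top (top_le_iff.1 h)

/-! ## The main theorem -/

theorem good_step {K : Type*} [Field K] {n : ℕ} {I : Ideal (MvPolynomial (Fin n) K)}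
    (hmon : IsMonomialIdeal I) {a : Fin n →₀ ℕ} (hcl : IsCleaner I a) {r₁ r₂ : ℕ}
    (h₁ : Good (Submodule.colon I (Ideal.span {(monomial a (1 : K))})) r₁
      (Submodule.colon I (Ideal.span {(monomial a (1 : K))})).minimalPrimes)
    (h₂ : Good (I + Ideal.span {(monomial a (1 : K))}) r₂
      (I + Ideal.span {(monomial a (1 : K))}).minimalPrimes) :
    Good I (max r₂ (r₁ + a.degree))
      ((Submodule.colon I (Ideal.span {(monomial a (1 : K))})).minimalPrimes ∪
        (I + Ideal.span {(monomial a (1 : K))}).minimalPrimes) := by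
  refine Good.combine (u := monomial a (1 : K)) (HD.monomial a) hmon.hcmp_mem
    (hmon.colon a).hcmp_mem (mem_colon_mon _) (mem_add_mon _) h₁ h₂ ?_ ?_
  · intro Q hQ
    exact hQ.1.1
  · intro P hP Q hQ hPQ
    refine le_antisymm hPQ ((hcl.2.2 hQ).2 ⟨hP.1.1, fun p hp => hP.1.2 ?_⟩ hPQ)
    exact (mem_colon_mon _ _).1 (I.mul_mem_left _ hp)

theorem KClean.good {K : Type*} [Field K] {n k : ℕ} {I : Ideal (MvPolynomial (Fin n) K)}
    (h : KClean K (Fin n) k I) : IsMonomialIdeal I → ∃ r, Good I r I.minimalPrimes := by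
  induction h with
  | prime I h => exact fun hm => ⟨0, good_prime hm h⟩
  | step I a hne hcl hsupp hcolon hsum ih₁ ih₂ =>
    intro hm
    obtain ⟨r₁, h₁⟩ := ih₁ (hm.colon a)
    obtain ⟨r₂, h₂⟩ := ih₂ (hm.add a)
    exact ⟨_, (good_step hm hcl h₁ h₂).mono
      (Set.union_subset (minimalPrimes_colon_subset hne _) hcl.2.2)⟩


/-- If `I` is a `k`-clean monomial ideal with cleaner monomial `u = x^a`,
then `reg(S/I) = max {reg(S/(I + Su)), reg(S/(I : u)) + deg u}`. -/
theorem reg_eq_max {K : Type*} [Field K] {n : ℕ}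
    (I : Ideal (MvPolynomial (Fin n) K)) (hmon : IsMonomialIdeal I)
    (k : ℕ) (hk : KClean K (Fin n) k I) (a : Fin n →₀ ℕ)
    (hcl : IsCleaner I a) (hsupp : a.support.card ≤ k + 1)
    (hcolon : KClean K (Fin n) k (Submodule.colon I (Ideal.span {(monomial a (1 : K))})))
    (hsum : KClean K (Fin n) k (I + Ideal.span {(monomial a (1 : K))})) :
    regQuot I = max (regQuot (I + Ideal.span {(monomial a (1 : K))}))
      (regQuot (Submodule.colon I (Ideal.span {(monomial a (1 : K))}))
        + (monomial a (1 : K)).totalDegree) := by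
  obtain ⟨r₁, h₁⟩ := hcolon.good (hmon.colon a)
  obtain ⟨r₂, h₂⟩ := hsum.good (hmon.add a)
  have h₃ := good_step hmon hcl h₁ h₂
  rw [h₃.regQuot_eq hmon.hcmp_mem, h₁.regQuot_eq (hmon.colon a).hcmp_mem,
    h₂.regQuot_eq (hmon.add a).hcmp_mem, totalDegree_monomial _ one_ne_zero]
  rfl
end

section
/- Every unmixed k-clean monomial ideal is Cohen–Macaulay. That is, if I ⊆ S is a k-clean monomial ideal all of whose associated primes have the same height (equivalently, all minimal primes of I have the same dimension), then S/I is a Cohen–Macaulay ring. -/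
open MvPolynomial

/-- The depth of `S/I` with respect to the irrelevant maximal ideal
`m = (x₁,…,xₙ)`: the supremum of the lengths of regular sequences on `S/I`
consisting of elements of `m`. -/
noncomputable def depthQuot {K : Type*} [Field K] {n : ℕ}
    (I : Ideal (MvPolynomial (Fin n) K)) : ℕ :=
  sSup {r : ℕ | ∃ rs : List (MvPolynomial (Fin n) K), rs.length = r ∧
    (∀ x ∈ rs, x ∈ Ideal.span (Set.range (X : Fin n → MvPolynomial (Fin n) K))) ∧
    RingTheory.Sequence.IsRegular (MvPolynomial (Fin n) K ⧸ I) rs}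

/-- `S/I` is Cohen–Macaulay: its depth equals its Krull dimension. -/
def IsCohenMacaulayQuot {K : Type*} [Field K] {n : ℕ}
    (I : Ideal (MvPolynomial (Fin n) K)) : Prop :=
  (depthQuot I : WithBot ℕ∞) = ringKrullDim (MvPolynomial (Fin n) K ⧸ I)

open RingTheory.Sequence CategoryTheory Abelian Pointwise

universe u

section aux

variable {K : Type u} [Field K] {n : ℕ}

/-- The ideal generated by the variables indexed by `F`. -/
noncomputable def varIdeal (K : Type u) [Field K] {n : ℕ} (F : Finset (Fin n)) :
    Ideal (MvPolynomial (Fin n) K) :=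
  Ideal.span (X '' (F : Set (Fin n)))

lemma X_mem_varIdeal {F : Finset (Fin n)} {j : Fin n} :
    (X j : MvPolynomial (Fin n) K) ∈ varIdeal K F ↔ j ∈ F := by
  rw [varIdeal, mem_ideal_span_X_image]
  simp [support_X, Finsupp.single_apply]

lemma varIdeal_isPrime (F : Finset (Fin n)) : (varIdeal K F).IsPrime := by
  classical
  let φ : MvPolynomial (Fin n) K →ₐ[K] MvPolynomial (Fin n) K :=
    aeval (fun i => if i ∈ F then 0 else X i)
  have h : varIdeal K F = RingHom.ker φ.toRingHom := by
    apply le_antisymm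
    · rw [varIdeal, Ideal.span_le]
      rintro _ ⟨i, hi, rfl⟩
      have : i ∈ F := hi
      simp [φ, RingHom.mem_ker, this]
    · intro p hp
      have key : ∀ p : MvPolynomial (Fin n) K, p - φ p ∈ varIdeal K F := by
        intro p
        rw [← Ideal.Quotient.eq]
        have : (Ideal.Quotient.mkₐ K (varIdeal K F)) =
            (Ideal.Quotient.mkₐ K (varIdeal K F)).comp φ := by
          ext i
          by_cases hi : i ∈ F
          · simp [φ, hi, Ideal.Quotient.eq_zero_iff_mem, X_mem_varIdeal]
          · simp [φ, hi]
        exact DFunLike.congr_fun this p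
      have h0 : φ p = 0 := hp
      simpa [h0] using key p
  rw [h]
  exact RingHom.ker_isPrime _

lemma varIdeal_insert (F : Finset (Fin n)) (j : Fin n) :
    varIdeal K (insert j F) = varIdeal K F ⊔ Ideal.span {X j} := by
  simp [varIdeal, Set.image_insert_eq, Ideal.span_insert, sup_comm]

lemma varIdeal_le (F : Finset (Fin n)) :
    varIdeal K F ≤ Ideal.span (Set.range (X : Fin n → MvPolynomial (Fin n) K)) :=
  Ideal.span_mono (Set.image_subset_range _ _)

lemma vars_ne_top :
    Ideal.span (Set.range (X : Fin n → MvPolynomial (Fin n) K)) ≠ ⊤ := by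
  have := (varIdeal_isPrime (K := K) (Finset.univ : Finset (Fin n))).ne_top
  simpa [varIdeal] using this

lemma varIdeal_height (F : Finset (Fin n)) : (varIdeal K F).height = F.card := by
  classical
  apply le_antisymm
  · have := varIdeal_isPrime (K := K) F
    have h2 : varIdeal K F = Ideal.span ((F.image X : Finset (MvPolynomial (Fin n) K)) :
        Set (MvPolynomial (Fin n) K)) := by simp [varIdeal]
    have h := Ideal.height_le_card_of_mem_minimalPrimes_span_finset (p := varIdeal K F)
      (s := F.image X) (by
        rw [← h2, Ideal.minimalPrimes_eq_subsingleton_self]; rfl)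
    exact h.trans (by exact_mod_cast Finset.card_image_le)
  · induction F using Finset.induction_on with
    | empty => simp
    | insert j F hj ih =>
      have := varIdeal_isPrime (K := K) F
      have := varIdeal_isPrime (K := K) (insert j F)
      rw [Finset.card_insert_of_notMem hj]
      push_cast
      refine le_trans (add_le_add_left ih 1) (Ideal.height_add_one_le_of_lt_of_isPrime ?_)
      refine lt_of_le_of_ne (by rw [varIdeal_insert]; exact le_sup_left) ?_
      intro h
      apply hj
      rw [← X_mem_varIdeal (K := K), h, X_mem_varIdeal]
      exact Finset.mem_insert_self _ _

lemma minimalPrime_eq_varIdeal {I : Ideal (MvPolynomial (Fin n) K)} (hmon : IsMonomialIdeal I)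
    {P : Ideal (MvPolynomial (Fin n) K)} (hP : P ∈ I.minimalPrimes) :
    ∃ F : Finset (Fin n), P = varIdeal K F := by
  classical
  obtain ⟨G, rfl⟩ := hmon
  have hp : P.IsPrime := hP.isPrime
  refine ⟨Finset.univ.filter (fun i => X i ∈ P), ?_⟩
  have hle : varIdeal K (Finset.univ.filter (fun i => X i ∈ P)) ≤ P := by
    rw [varIdeal, Ideal.span_le]
    rintro _ ⟨i, hi, rfl⟩
    simpa using hi
  refine le_antisymm (hP.2 ⟨varIdeal_isPrime _, ?_⟩ hle) hle
  rw [Ideal.span_le]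
  rintro _ ⟨g, hg, rfl⟩
  have hgP : monomial g (1 : K) ∈ P := hP.1.2 (Ideal.subset_span ⟨g, hg, rfl⟩)
  rw [monomial_eq, C_1, one_mul, Finsupp.prod, hp.prod_mem_iff] at hgP
  obtain ⟨i, hi, hiP⟩ := hgP
  have hiX : X i ∈ P := hp.mem_of_pow_mem _ hiP
  simp only [SetLike.mem_coe]
  rw [varIdeal, mem_ideal_span_X_image]
  intro m hm
  rw [support_monomial, if_neg one_ne_zero, Finset.mem_singleton] at hm
  subst hm
  exact ⟨i, by simpa using hiX, by simpa using hi⟩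

end aux

section ring

variable {R : Type u} [CommRing R]

/-- `(R/I)/r(R/I) ≅ R/(I + r)`. -/
noncomputable def quotSMulTopEquivAux (I J : Ideal R) (r : R) (h : J = I ⊔ Ideal.span {r}) :
    QuotSMulTop r (R ⧸ I) ≃ₗ[R] (R ⧸ J) := by
  have hIJ : I ≤ J := h ▸ le_sup_left
  refine (Submodule.quotEquivOfEq _ (LinearMap.ker (Submodule.factor hIJ)) ?_).trans
    (LinearMap.quotKerEquivOfSurjective (Submodule.factor hIJ) (Submodule.factor_surjective hIJ))
  ext x
  obtain ⟨x, rfl⟩ := Submodule.Quotient.mk_surjective _ x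
  simp only [LinearMap.mem_ker, Submodule.mem_smul_pointwise_iff_exists]
  have h1 : Submodule.factor hIJ (Submodule.Quotient.mk x) = Submodule.Quotient.mk x := rfl
  rw [h1, Submodule.Quotient.mk_eq_zero, h]
  constructor
  · rintro ⟨y, -, hy⟩
    obtain ⟨y, rfl⟩ := Submodule.Quotient.mk_surjective _ y
    rw [← Submodule.Quotient.mk_smul, Submodule.Quotient.eq] at hy
    have h2 : r • y ∈ I ⊔ Ideal.span {r} :=
      le_sup_right (a := I) (Ideal.mul_mem_right _ _ (Ideal.mem_span_singleton_self r))
    have h3 := sub_mem h2 (le_sup_left (b := Ideal.span {r}) hy)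
    simpa using h3
  · intro hx
    obtain ⟨a, ha, b, hb, rfl⟩ := Submodule.mem_sup.1 hx
    obtain ⟨c, rfl⟩ := Ideal.mem_span_singleton'.1 hb
    refine ⟨Submodule.Quotient.mk c, trivial, ?_⟩
    rw [← Submodule.Quotient.mk_smul, Submodule.Quotient.eq]
    simp only [smul_eq_mul]
    have : r * c - (a + c * r) = -a := by ring
    rw [this]; exact neg_mem ha

lemma smul_top_lt_aux (m I : Ideal R) (hm : m ≠ ⊤) (hI : I ≤ m) :
    m • (⊤ : Submodule R (R ⧸ I)) < ⊤ := by
  refine lt_top_iff_ne_top.2 fun h => hm ?_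
  have h2 := congrArg (Submodule.map (Submodule.factor hI)) h
  rw [Submodule.map_smul'', Submodule.map_top,
    LinearMap.range_eq_top.2 (Submodule.factor_surjective hI)] at h2
  have h3 : m • (⊤ : Submodule R (R ⧸ m)) = ⊥ := by
    rw [eq_bot_iff, Submodule.smul_le]
    intro r hr x _
    obtain ⟨x, rfl⟩ := Submodule.Quotient.mk_surjective _ x
    rw [← Submodule.Quotient.mk_smul, Submodule.mem_bot, Submodule.Quotient.mk_eq_zero]
    exact Ideal.mul_mem_right _ _ hr
  rw [h3] at h2
  have h4 : (Submodule.Quotient.mk 1 : R ⧸ m) ∈ (⊥ : Submodule R (R ⧸ m)) := by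
    rw [h2]; trivial
  rw [Submodule.mem_bot, Submodule.Quotient.mk_eq_zero] at h4
  exact (Ideal.eq_top_iff_one _).2 h4

/-- Multiplication by `u`, as a map `R/(I:u) → R/I`. -/
noncomputable def colonMap (I : Ideal R) (u : R) :
    (R ⧸ Submodule.colon I (Ideal.span {u} : Set R)) →ₗ[R] (R ⧸ I) :=
  Submodule.mapQ _ _ (LinearMap.lsmul R R u) (by
    intro x hx
    have := Submodule.mem_colon.1 hx u (Ideal.mem_span_singleton_self u)
    simpa [mul_comm] using this)

lemma colonMap_mk (I : Ideal R) (u x : R) :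
    colonMap I u (Submodule.Quotient.mk x) = Submodule.Quotient.mk (u * x) := rfl

lemma colonMap_injective (I : Ideal R) (u : R) : Function.Injective (colonMap I u) := by
  rw [injective_iff_map_eq_zero]
  intro x hx
  obtain ⟨x, rfl⟩ := Submodule.Quotient.mk_surjective _ x
  rw [colonMap_mk, Submodule.Quotient.mk_eq_zero] at hx
  rw [Submodule.Quotient.mk_eq_zero, Submodule.mem_colon]
  intro s hs
  obtain ⟨c, rfl⟩ := Ideal.mem_span_singleton'.1 hs
  have : x • (c * u) = c * (u * x) := by simp only [smul_eq_mul]; ring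
  rw [this]
  exact Ideal.mul_mem_left _ _ hx

lemma colonMap_exact (I : Ideal R) (u : R) :
    Function.Exact (colonMap I u)
      (Submodule.factor (le_sup_left : I ≤ I ⊔ Ideal.span {u})) := by
  intro x
  obtain ⟨x, rfl⟩ := Submodule.Quotient.mk_surjective _ x
  have h1 : Submodule.factor (le_sup_left : I ≤ I ⊔ Ideal.span {u}) (Submodule.Quotient.mk x)
    = Submodule.Quotient.mk x := rfl
  rw [h1, Submodule.Quotient.mk_eq_zero]
  constructor
  · intro hx
    obtain ⟨a, ha, b, hb, rfl⟩ := Submodule.mem_sup.1 hx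
    obtain ⟨c, rfl⟩ := Ideal.mem_span_singleton'.1 hb
    refine ⟨Submodule.Quotient.mk c, ?_⟩
    rw [colonMap_mk, Submodule.Quotient.eq]
    have : u * c - (a + c * u) = -a := by ring
    rw [this]; exact neg_mem ha
  · rintro ⟨y, hy⟩
    obtain ⟨y, rfl⟩ := Submodule.Quotient.mk_surjective _ y
    rw [colonMap_mk, Submodule.Quotient.eq] at hy
    have h2 : u * y ∈ I ⊔ Ideal.span {u} :=
      le_sup_right (a := I) (Ideal.mul_mem_right _ _ (Ideal.mem_span_singleton_self u))
    have h3 := sub_mem h2 (le_sup_left (b := Ideal.span {u}) hy)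
    simpa using h3

lemma ext_step (N : ModuleCat.{u} R) (I : Ideal R) (u : R) (i : ℕ)
    (h1 : Subsingleton (Ext N
      (ModuleCat.of R (R ⧸ Submodule.colon I (Ideal.span {u} : Set R))) i))
    (h2 : Subsingleton (Ext N (ModuleCat.of R (R ⧸ (I ⊔ Ideal.span {u}))) i)) :
    Subsingleton (Ext N (ModuleCat.of R (R ⧸ I)) i) := by
  have hS : (ModuleCat.shortComplexOfCompEqZero (colonMap I u)
      (Submodule.factor (le_sup_left : I ≤ I ⊔ Ideal.span {u}))
      (colonMap_exact I u).linearMap_comp_eq_zero).ShortExact :=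
    ModuleCat.shortComplex_shortExact _ (colonMap_exact I u) (colonMap_injective I u)
      (Submodule.factor_surjective (le_sup_left : I ≤ I ⊔ Ideal.span {u}))
  refine ⟨fun x y => ?_⟩
  rw [← sub_eq_zero]
  obtain ⟨z, hz⟩ := Ext.covariant_sequence_exact₂ N hS (x - y) (h2.elim _ _)
  rw [← hz, h1.elim z 0, Ext.zero_comp]

lemma supportDim_ge_of_isRegular [IsNoetherianRing R] {M : Type*} [AddCommGroup M] [Module R M]
    [Module.Finite R M] (rs : List R) (reg : IsRegular M rs) :
    (rs.length : WithBot ℕ∞) ≤ Module.supportDim R M := by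
  induction rs generalizing M with
  | nil =>
    have := reg.nontrivial
    have h := Module.supportDim_ne_bot_of_nontrivial R M
    obtain ⟨a, ha⟩ := WithBot.ne_bot_iff_exists.1 h
    rw [← ha]
    exact WithBot.coe_le_coe.2 (by simp)
  | cons x rs ih =>
    obtain ⟨hx, hr⟩ := (isRegular_cons_iff M _ _).1 reg
    have h1 := ih hr
    have h2 := Module.supportDim_quotSMulTop_succ_le_of_notMem_minimalPrimes (M := M) (x := x)
      (fun _ => hx.notMem_of_mem_minimalPrimes)
    refine le_trans ?_ h2
    rw [List.length_cons]
    push_cast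
    gcongr

end ring

section main

variable {K : Type u} [Field K] {n : ℕ}

lemma varIdeal_exists_regular (d : ℕ) (F : Finset (Fin n)) (h : d + F.card = n) :
    ∃ rs : List (MvPolynomial (Fin n) K), rs.length = d ∧
      (∀ x ∈ rs, x ∈ Ideal.span (Set.range (X : Fin n → MvPolynomial (Fin n) K))) ∧
      IsRegular (MvPolynomial (Fin n) K ⧸ varIdeal K F) rs := by
  classical
  induction d generalizing F with
  | zero =>
    have := Ideal.Quotient.nontrivial_iff.2 (varIdeal_isPrime (K := K) F).ne_top
    exact ⟨[], rfl, by simp, IsRegular.nil _ _⟩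
  | succ d ih =>
    obtain ⟨j, hj⟩ : ∃ j, j ∉ F := by
      by_contra hc
      push Not at hc
      have : F = Finset.univ := Finset.eq_univ_iff_forall.2 hc
      rw [this, Finset.card_univ, Fintype.card_fin] at h
      omega
    obtain ⟨rs, h1, h2, h3⟩ := ih (insert j F) (by rw [Finset.card_insert_of_notMem hj]; omega)
    refine ⟨X j :: rs, by simp [h1], ?_, ?_⟩
    · intro x hx
      rcases List.mem_cons.1 hx with rfl | hx
      · exact Ideal.subset_span ⟨j, rfl⟩
      · exact h2 x hx
    · rw [isRegular_cons_iff]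
      refine ⟨?_, ?_⟩
      · intro x y hxy
        obtain ⟨x, rfl⟩ := Submodule.Quotient.mk_surjective _ x
        obtain ⟨y, rfl⟩ := Submodule.Quotient.mk_surjective _ y
        simp only [← Submodule.Quotient.mk_smul] at hxy
        rw [Submodule.Quotient.eq] at hxy ⊢
        rw [← smul_sub, smul_eq_mul] at hxy
        exact ((varIdeal_isPrime F).mem_or_mem hxy).resolve_left (by rwa [X_mem_varIdeal])
      · exact (LinearEquiv.isRegular_congr
          (quotSMulTopEquivAux _ _ _ (varIdeal_insert F j)) rs).2 h3

/-- The residue module at the irrelevant ideal. -/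
noncomputable abbrev resMod (K : Type u) [Field K] (n : ℕ) : ModuleCat.{u} (MvPolynomial (Fin n) K) :=
  ModuleCat.of _ (MvPolynomial (Fin n) K ⧸
    Ideal.span (Set.range (X : Fin n → MvPolynomial (Fin n) K)))

lemma resMod_supp : Module.support (MvPolynomial (Fin n) K) (resMod K n) =
    PrimeSpectrum.zeroLocus
      (Ideal.span (Set.range (X : Fin n → MvPolynomial (Fin n) K)) : Set _) := by
  rw [Module.support_eq_zeroLocus, Ideal.annihilator_quotient]

lemma kClean_ext (k d : ℕ) (J : Ideal (MvPolynomial (Fin n) K)) (hJ : KClean K (Fin n) k J)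
    (hmin : ∀ P ∈ J.minimalPrimes, ∃ F : Finset (Fin n), P = varIdeal K F ∧ d + F.card = n) :
    ∀ i < d, Subsingleton (Ext (resMod K n)
      (ModuleCat.of _ (MvPolynomial (Fin n) K ⧸ J)) i) := by
  induction hJ with
  | prime I h =>
    obtain ⟨F, rfl, hF⟩ := hmin I (by rw [Ideal.minimalPrimes_eq_subsingleton_self]; rfl)
    obtain ⟨rs, h1, h2, h3⟩ := varIdeal_exists_regular (K := K) d F hF
    have := ModuleCat.subsingleton_ext_of_exists_isRegular _ (resMod K n) resMod_supp.subset
      (ModuleCat.of _ (MvPolynomial (Fin n) K ⧸ varIdeal K F))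
      (smul_top_lt_aux _ _ vars_ne_top (varIdeal_le F)) rs h2 h3
    rwa [h1] at this
  | step I a hne hcl hsupp hcolon hsum ih1 ih2 =>
    intro i hi
    refine ext_step _ _ (monomial a (1 : K)) _ (ih1 ?_ i hi) (ih2 ?_ i hi)
    · intro P hP
      apply hmin
      apply hne
      apply associatedPrimes.subset_of_injective (colonMap_injective I (monomial a (1 : K)))
      apply Module.associatedPrimes.minimalPrimes_annihilator_subset_associatedPrimes
      rwa [Ideal.annihilator_quotient]
    · intro P hP
      exact hmin P (hcl.2.2 hP)

lemma KClean.ne_top {k : ℕ} {J : Ideal (MvPolynomial (Fin n) K)} (hJ : KClean K (Fin n) k J) :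
    J ≠ ⊤ := by
  cases hJ with
  | prime _ h => exact h.ne_top
  | step _ a hne hcl => rintro rfl; exact hcl.2.1 trivial

lemma dim_le_aux (I : Ideal (MvPolynomial (Fin n) K)) (d h : ℕ) (hd : d + h = n)
    (hmin : ∀ P ∈ I.minimalPrimes, P.height = h) :
    ringKrullDim (MvPolynomial (Fin n) K ⧸ I) ≤ d := by
  rw [ringKrullDim_quotient, Order.krullDim]
  refine iSup_le fun l => ?_
  let l' : LTSeries (PrimeSpectrum (MvPolynomial (Fin n) K)) := l.map Subtype.val (fun _ _ h => h)
  have h1 : (l.length : ℕ∞) ≤ Order.coheight l'.head := Order.length_le_coheight_head (p := l')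
  have h2 : (h : ℕ∞) ≤ Order.height l'.head := by
    rw [← PrimeSpectrum.height_eq_orderHeight]
    have hI : I ≤ l'.head.asIdeal := l.head.2
    obtain ⟨P, hP, hle⟩ := Ideal.exists_minimalPrimes_le hI
    rw [← hmin P hP]
    exact Ideal.height_mono hle
  have h3 : Order.krullDim (PrimeSpectrum (MvPolynomial (Fin n) K)) = (n : ℕ∞) := by
    have := MvPolynomial.ringKrullDim_of_isNoetherianRing (R := K) (ι := Fin n)
    rw [ringKrullDim] at this
    rw [this]; simp
  rw [Order.krullDim_eq_iSup_height_add_coheight_of_nonempty] at h3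
  have h4 := WithBot.coe_injective h3
  have h5 : Order.height l'.head + Order.coheight l'.head ≤ n := by
    rw [← h4]
    exact le_iSup (fun a : PrimeSpectrum (MvPolynomial (Fin n) K) =>
      Order.height a + Order.coheight a) l'.head
  have h6 : ((h + l.length : ℕ) : ℕ∞) ≤ n := by
    push_cast
    exact (add_le_add h2 h1).trans h5
  have h7 : h + l.length ≤ n := by exact_mod_cast h6
  have : l.length ≤ d := by omega
  exact_mod_cast this

end main

/-- Every unmixed `k`-clean monomial ideal is Cohen–Macaulay: if `I` is
`k`-clean and all associated primes of `S/I` have the same height, then `S/I` is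
Cohen–Macaulay. -/
theorem kClean_unmixed_isCM {K : Type*} [Field K] {n : ℕ}
    (I : Ideal (MvPolynomial (Fin n) K)) (hmon : IsMonomialIdeal I)
    (k : ℕ) (hk : KClean K (Fin n) k I)
    (hunmixed : ∀ (P Q : Ideal (MvPolynomial (Fin n) K))
      (hP : P ∈ associatedPrimes (MvPolynomial (Fin n) K) (MvPolynomial (Fin n) K ⧸ I))
      (hQ : Q ∈ associatedPrimes (MvPolynomial (Fin n) K) (MvPolynomial (Fin n) K ⧸ I)),
      Order.height (⟨P, hP.1⟩ : PrimeSpectrum (MvPolynomial (Fin n) K))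
        = Order.height (⟨Q, hQ.1⟩ : PrimeSpectrum (MvPolynomial (Fin n) K))) :
    IsCohenMacaulayQuot I := by
  have hne := hk.ne_top
  have hass : ∀ P ∈ I.minimalPrimes, P ∈ associatedPrimes (MvPolynomial (Fin n) K)
      (MvPolynomial (Fin n) K ⧸ I) := by
    intro P hP
    apply Module.associatedPrimes.minimalPrimes_annihilator_subset_associatedPrimes
    rwa [Ideal.annihilator_quotient]
  obtain ⟨P₀, hP₀⟩ := Ideal.nonempty_minimalPrimes hne
  obtain ⟨F₀, rfl⟩ := minimalPrime_eq_varIdeal hmon hP₀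
  have hheight : ∀ P ∈ I.minimalPrimes, P.height = F₀.card := by
    intro P hP
    rw [← varIdeal_height (K := K) F₀]
    have := hunmixed P _ (hass P hP) (hass _ hP₀)
    rwa [← PrimeSpectrum.height_eq_orderHeight, ← PrimeSpectrum.height_eq_orderHeight] at this
  have hle : F₀.card ≤ n := by simpa using Finset.card_le_univ F₀
  obtain ⟨d, hd⟩ : ∃ d, d + F₀.card = n := ⟨n - F₀.card, by omega⟩
  have hdim := dim_le_aux I d _ hd hheight
  have hext := kClean_ext k d I hk (by
    intro P hP
    obtain ⟨F, rfl⟩ := minimalPrime_eq_varIdeal hmon hP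
    have h1 := hheight _ hP
    rw [varIdeal_height] at h1
    have h2 : F.card = F₀.card := by exact_mod_cast h1
    exact ⟨F, rfl, by omega⟩)
  have hIm : I ≤ Ideal.span (Set.range (X : Fin n → MvPolynomial (Fin n) K)) :=
    hP₀.1.2.trans (varIdeal_le F₀)
  obtain ⟨rs, hl, hmem, hreg⟩ := ModuleCat.exists_isRegular_of_exists_subsingleton_ext _ d
    (ModuleCat.of _ (MvPolynomial (Fin n) K ⧸ I)) (smul_top_lt_aux _ _ vars_ne_top hIm)
    (resMod K n) resMod_supp hext
  have hub : ∀ rs : List (MvPolynomial (Fin n) K),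
      RingTheory.Sequence.IsRegular (MvPolynomial (Fin n) K ⧸ I) rs →
      (rs.length : WithBot ℕ∞) ≤ ringKrullDim (MvPolynomial (Fin n) K ⧸ I) := by
    intro rs h
    rw [← Module.supportDim_quotient_eq_ringKrullDim]
    exact supportDim_ge_of_isRegular rs h
  have hdepth : depthQuot I = d := by
    apply IsGreatest.csSup_eq
    refine ⟨⟨rs, hl, hmem, hreg⟩, ?_⟩
    rintro _ ⟨rs', rfl, -, h⟩
    exact_mod_cast (hub rs' h).trans hdim
  rw [IsCohenMacaulayQuot, hdepth]
  refine le_antisymm ?_ hdim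
  rw [← hl]
  exact hub rs hreg
end
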